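/- arXiv:2303.10682 — 3 statements merged into one kernel-verified Lean document; each statement's English description precedes it below -/
import Mathlib

section
/- Let p > 2 be a prime with p ≤ n, and write n + 1 in base p with digit set {a_i} and top digit a_k ≠ 0. Then the p-Jones–Wenzl idempotent ^pJW_n := Σ_{m ∈ I_n} E_{t_m} ∈ TL_n^ℚ lies in the image of the canonical ring homomorphism TL_n^{ℤ_(p)} → TL_n^ℚ induced by the inclusion ℤ_(p) ⊆ ℚ. -/
/-- Relations defining the Temperley–Lieb algebra with loop parameter `2`,
on generators `u_1, …, u_{n-1}` (indexed by `Fin (n-1)`). -/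
inductive TLRel (R : Type) [CommRing R] (n : ℕ) :
    FreeAlgebra R (Fin (n - 1)) → FreeAlgebra R (Fin (n - 1)) → Prop
  | sq (i : Fin (n - 1)) :
      TLRel R n (FreeAlgebra.ι R i * FreeAlgebra.ι R i) (2 * FreeAlgebra.ι R i)
  | braid (i j : Fin (n - 1)) (h : Nat.dist i.val j.val = 1) :
      TLRel R n (FreeAlgebra.ι R i * FreeAlgebra.ι R j * FreeAlgebra.ι R i) (FreeAlgebra.ι R i)
  | comm (i j : Fin (n - 1)) (h : 1 < Nat.dist i.val j.val) :
      TLRel R n (FreeAlgebra.ι R i * FreeAlgebra.ι R j) (FreeAlgebra.ι R j * FreeAlgebra.ι R i)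

/-- The Temperley–Lieb algebra `TL_n` over `R`, with loop parameter `2`. -/
abbrev TL (R : Type) [CommRing R] (n : ℕ) : Type := RingQuot (TLRel R n)

/-- The generator `u_{i+1}` of the Temperley–Lieb algebra. -/
noncomputable def TLu (R : Type) [CommRing R] (n : ℕ) (i : Fin (n - 1)) : TL R n :=
  RingQuot.mkAlgHom R (TLRel R n) (FreeAlgebra.ι R i)


theorem TLu_mul_self (R : Type) [CommRing R] (n : ℕ) (i : Fin (n - 1)) :
    TLu R n i * TLu R n i = 2 * TLu R n i := by
  have h := RingQuot.mkAlgHom_rel R (TLRel.sq (R := R) (n := n) i)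
  simpa [TLu, map_mul, map_ofNat] using h

theorem TLu_braid (R : Type) [CommRing R] (n : ℕ) (i j : Fin (n - 1))
    (h : Nat.dist i.val j.val = 1) :
    TLu R n i * TLu R n j * TLu R n i = TLu R n i := by
  have h' := RingQuot.mkAlgHom_rel R (TLRel.braid (R := R) (n := n) i j h)
  simpa [TLu, map_mul] using h'

theorem TLu_comm (R : Type) [CommRing R] (n : ℕ) (i j : Fin (n - 1))
    (h : 1 < Nat.dist i.val j.val) :
    TLu R n i * TLu R n j = TLu R n j * TLu R n i := by
  have h' := RingQuot.mkAlgHom_rel R (TLRel.comm (R := R) (n := n) i j h)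
  simpa [TLu, map_mul] using h'

/-- The canonical (non-unital only in the trivial sense: it is unital) algebra inclusion
`TL_m → TL_n` for `m ≤ n`, sending `u_i` to `u_i`. -/
noncomputable def TLincl (R : Type) [CommRing R] {m n : ℕ} (h : m ≤ n) :
    TL R m →ₐ[R] TL R n :=
  RingQuot.liftAlgHom R
    ⟨FreeAlgebra.lift R
        (fun i : Fin (m - 1) => TLu R n ⟨i.val, by have := i.isLt; omega⟩), by
      intro x y hxy
      induction hxy with
      | sq i =>
          simp only [map_mul, FreeAlgebra.lift_ι_apply, map_ofNat]
          exact TLu_mul_self R n _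
      | braid i j hd =>
          simp only [map_mul, FreeAlgebra.lift_ι_apply]
          exact TLu_braid R n _ _ hd
      | comm i j hd =>
          simp only [map_mul, FreeAlgebra.lift_ι_apply]
          exact TLu_comm R n _ _ hd⟩

/-- Base change of the Temperley–Lieb algebra along a ring homomorphism `φ : R → S`,
sending each generator `u_i` to `u_i`. -/
noncomputable def TLbase {R S : Type} [CommRing R] [CommRing S] (φ : R →+* S) (n : ℕ) :
    TL R n →+* TL S n :=
  letI : Algebra R (TL S n) := RingHom.toAlgebra' ((algebraMap S (TL S n)).comp φ)
    (fun c x => by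
      simp only [RingHom.coe_comp, Function.comp_apply]
      exact Algebra.commutes (φ c) x)
  (RingQuot.liftAlgHom R (s := TLRel R n)
    ⟨FreeAlgebra.lift R (fun i : Fin (n - 1) => TLu S n i), by
      intro x y hxy
      induction hxy with
      | sq i =>
          simp only [map_mul, FreeAlgebra.lift_ι_apply, map_ofNat]
          exact TLu_mul_self S n i
      | braid i j hd =>
          simp only [map_mul, FreeAlgebra.lift_ι_apply]
          exact TLu_braid S n i j hd
      | comm i j hd =>
          simp only [map_mul, FreeAlgebra.lift_ι_apply]
          exact TLu_comm S n i j hd⟩).toRingHom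

instance instSpanPIsPrime (p : ℕ) [hp : Fact p.Prime] :
    (Ideal.span {(p : ℤ)}).IsPrime := by
  rw [Ideal.span_singleton_prime (by exact_mod_cast hp.out.ne_zero)]
  exact Nat.prime_iff_prime_int.mp hp.out

/-- The localization `ℤ_(p)` of `ℤ` at the prime `p`. -/
abbrev Zp (p : ℕ) [Fact p.Prime] : Type := Localization.AtPrime (Ideal.span {(p : ℤ)})

/-- The canonical embedding `ℤ_(p) → ℚ`. -/
noncomputable def ZpToQ (p : ℕ) [Fact p.Prime] : Zp p →+* ℚ :=
  IsLocalization.lift (M := (Ideal.span {(p : ℤ)}).primeCompl) (S := Zp p)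
    (g := Int.castRingHom ℚ)
    (by
      intro y
      refine IsUnit.mk0 _ ?_
      have hy : (y : ℤ) ≠ 0 := by
        intro h0
        exact y.2 (by rw [h0]; exact Ideal.zero_mem _)
      simpa using (Int.cast_ne_zero (α := ℚ)).mpr hy)

/-- A two-column standard Young tableau of size `n`, encoded by the function
`col : Fin n → Fin 2` recording the column (`0` = first, `1` = second) containing
the entry `j+1`, subject to the ballot (lattice word) condition, which is
equivalent to standardness. -/
structure TwoColTab (n : ℕ) where
  col : Fin n → Fin 2
  ballot : ∀ m : Fin n,
    (Finset.univ.filter fun i : Fin n => i ≤ m ∧ col i = 1).card ≤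
    (Finset.univ.filter fun i : Fin n => i ≤ m ∧ col i = 0).card

theorem TwoColTab.ext' {n : ℕ} : ∀ {s t : TwoColTab n}, s.col = t.col → s = t
  | ⟨a, _⟩, ⟨b, _⟩, h => by
      obtain rfl : a = b := h
      rfl

noncomputable instance (n : ℕ) : Fintype (TwoColTab n) :=
  Fintype.ofInjective TwoColTab.col (fun _ _ h => TwoColTab.ext' h)

/-- The content `c_t(j+1) = (column of j+1) − (row of j+1)` of the entry `j+1`,
computed from the column word `c`: if `j+1` lies in column `k ∈ {1,2}` then its row
is the number of `i ≤ j+1` lying in column `k`, and its content is `k − row`. -/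
def colContent {n : ℕ} (c : Fin n → Fin 2) (j : Fin n) : ℤ :=
  if c j = 0 then
    1 - ((Finset.univ.filter fun i : Fin n => i ≤ j ∧ c i = 0).card : ℤ)
  else
    2 - ((Finset.univ.filter fun i : Fin n => i ≤ j ∧ c i = 1).card : ℤ)

/-- The content function of a two-column standard tableau. -/
def tabContent {n : ℕ} (t : TwoColTab n) (j : Fin n) : ℤ := colContent t.col j

/-- Membership in the `p`-class of the one-column standard tableau `t_n`
(whose content at the entry `j+1` is `−j`), expressed on column words. -/
def inOneColClass (p n : ℕ) (c : Fin n → Fin 2) : Prop :=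
  ∀ j : Fin n, ((colContent c j : ℤ) : ZMod p) = ((-(j.val : ℤ) : ℤ) : ZMod p)

/-- Two tableaux are in the same `p`-class if their contents agree modulo `p`. -/
def pClassEq (p n : ℕ) (s t : TwoColTab n) : Prop :=
  ∀ j : Fin n, ((tabContent s j : ℤ) : ZMod p) = ((tabContent t j : ℤ) : ZMod p)

/-- The one-column standard tableau `t_n`. -/
def oneColTab (n : ℕ) : TwoColTab n :=
  ⟨fun _ => 0, by intro m; simp⟩
/-- `upSum p a k i = Σ_{l=i}^{k} a_l p^l`, the starting position of the segment of the
digit `i − 1` in the word of length `n+1` obtained by reading the signed base-`p`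
digits of `n+1` from the top digit `k` downwards. -/
def upSum (p : ℕ) (a : ℕ → ℕ) (k i : ℕ) : ℕ := ∑ l ∈ Finset.Ico i (k + 1), a l * p ^ l

/-- The sign attached to the digit `i`: the digits `0, …, k−1` carry the chosen signs
`ε` (`true` = `+`), and the top digit `k` is always positive. -/
def sgn (k : ℕ) (ε : Fin k → Bool) (i : ℕ) : Bool := if h : i < k then ε ⟨i, h⟩ else true

/-- The index of the digit governing position `q` of the word of length `n+1`:
the smallest `i` with `Σ_{l>i} a_l p^l ≤ q`. -/
def digitAt (p : ℕ) (a : ℕ → ℕ) (k q : ℕ) : ℕ :=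
  Nat.find (⟨k, by simp [upSum]⟩ : ∃ i, upSum p a k (i + 1) ≤ q)

/-- The column word of the tableau `t_m` associated to the sign choice `ε` (the element
`m = (a_k p^k ± a_{k−1} p^{k−1} ± ⋯ ± a_0) − 1` of `I_n`): the full word of length `n+1`
consists, for each digit `i = k, k−1, …, 0`, of a segment of length `a_i p^i` of
first-column letters (if the sign of `a_i` is `+`) or second-column letters (if `−`);
the word of `t_m` is obtained by deleting the first letter.  The entry `j+1` of `t_m`
lies in the first column iff the sign of the digit governing position `j+1` is `+`. -/
def tmCol (p n k : ℕ) (a : ℕ → ℕ) (ε : Fin k → Bool) : Fin n → Fin 2 :=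
  fun j => if sgn k ε (digitAt p a k (j.val + 1)) then 0 else 1

/-- The group algebra `R𝔖_n` of the symmetric group on `{1, …, n}`. -/
abbrev SymGrpAlg (R : Type) [CommRing R] (n : ℕ) : Type := MonoidAlgebra R (Equiv.Perm (Fin n))

/-- The simple transposition `s_{i+1} = (i+1, i+2)` (1-based) in `𝔖_n`, for `i : Fin (n-1)`. -/
def simpleT (n : ℕ) (i : Fin (n - 1)) : Equiv.Perm (Fin n) :=
  Equiv.swap ⟨i.val, by have := i.isLt; omega⟩ ⟨i.val + 1, by have := i.isLt; omega⟩

/-- The Jucys–Murphy element `L_{l+1} = (1,l+1) + (2,l+1) + ⋯ + (l,l+1)` (1-based)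
in the group algebra, for `l : Fin n`; in particular `L_1 = 0`. -/
noncomputable def JMelt (R : Type) [CommRing R] (n : ℕ) (l : Fin n) : SymGrpAlg R n :=
  ∑ j ∈ Finset.univ.filter (fun j : Fin n => j < l),
    MonoidAlgebra.of R (Equiv.Perm (Fin n)) (Equiv.swap j l)

/-- The set `𝒞` of all contents `c_s(i)` of entries of two-column standard tableaux of
size `n`, as a finite set of integers. -/
noncomputable def ContSet (n : ℕ) : Finset ℤ :=
  ((Finset.univ : Finset ((Fin n → Fin 2) × Fin n)).filter fun x =>
      ∀ m : Fin n,
        (Finset.univ.filter fun i : Fin n => i ≤ m ∧ x.1 i = 1).card ≤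
        (Finset.univ.filter fun i : Fin n => i ≤ m ∧ x.1 i = 0).card).image
    fun x => colContent x.1 x.2

/-- The seminormal idempotent
`E_t = ∏_{c ∈ 𝒞} ∏_{1 ≤ i ≤ n, c_t(i) ≠ c} (𝐋_i − c)/(c_t(i) − c)`
attached to the content function of the column word `c`; here `L : Fin n → TL ℚ n`
is the family of Jucys–Murphy elements `𝐋_i` of `TL_n^ℚ`.  (All the factors commute,
so the ordered product below agrees with the usual product.) -/
noncomputable def EeltC (n : ℕ) (L : Fin n → TL ℚ n) (c : Fin n → Fin 2) : TL ℚ n :=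
  (((ContSet n).sort (· ≤ ·)).map fun d =>
    (((List.finRange n).filter fun i => colContent c i ≠ d).map fun i =>
      (((colContent c i - d : ℤ) : ℚ))⁻¹ • (L i - (d : TL ℚ n))).prod).prod

/-- The seminormal idempotent `E_t` of a two-column standard tableau `t`. -/
noncomputable def Eelt (n : ℕ) (L : Fin n → TL ℚ n) (t : TwoColTab n) : TL ℚ n :=
  EeltC n L t.col

section IntegralFunctions

/-- The function `f` on the finite set `S` is integral with respect to the family `P` if
`∑ f(s) P(s)` lies in the subring `O`. -/
def IntFun {B ι : Type} [Ring B] [Algebra ℚ B] (O : Subring B) (S : Finset ι) (P : ι → B)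
    (f : ι → ℚ) : Prop :=
  ∑ s ∈ S, f s • P s ∈ O

/-- `P` restricted to `S` is a family of orthogonal idempotents. -/
def OrthFam {B ι : Type} [Ring B] (S : Finset ι) (P : ι → B) : Prop :=
  ∀ s ∈ S, ∀ t ∈ S, (s = t → P s * P t = P s) ∧ (s ≠ t → P s * P t = 0)

variable {B ι : Type} [Ring B] [Algebra ℚ B] {O : Subring B} {S : Finset ι} {P : ι → B}
  {f g : ι → ℚ}

theorem IntFun.congr (hf : IntFun O S P f) (h : ∀ s ∈ S, f s = g s) : IntFun O S P g := by
  unfold IntFun at *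
  rwa [← Finset.sum_congr rfl fun s hs => congrArg (· • P s) (h s hs)]

theorem IntFun.add (hf : IntFun O S P f) (hg : IntFun O S P g) :
    IntFun O S P (fun s => f s + g s) := by
  unfold IntFun at *
  simpa only [add_smul, Finset.sum_add_distrib] using O.add_mem hf hg

theorem IntFun.neg (hf : IntFun O S P f) : IntFun O S P (fun s => - f s) := by
  unfold IntFun at *
  simpa only [neg_smul, Finset.sum_neg_distrib] using O.neg_mem hf

theorem IntFun.sub (hf : IntFun O S P f) (hg : IntFun O S P g) :
    IntFun O S P (fun s => f s - g s) := by
  simpa only [sub_eq_add_neg] using hf.add hg.neg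

theorem OrthFam.sum_mul_sum (hP : OrthFam S P) (f g : ι → ℚ) :
    (∑ s ∈ S, f s • P s) * (∑ s ∈ S, g s • P s) = ∑ s ∈ S, (f s * g s) • P s := by
  classical
  rw [Finset.sum_mul_sum]
  refine Finset.sum_congr rfl fun s hs => ?_
  rw [Finset.sum_eq_single_of_mem s hs]
  · rw [smul_mul_smul_comm, (hP s hs s hs).1 rfl]
  · intro t ht hts
    rw [smul_mul_smul_comm, (hP s hs t ht).2 (Ne.symm hts), smul_zero]

theorem IntFun.mul (hP : OrthFam S P) (hf : IntFun O S P f) (hg : IntFun O S P g) :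
    IntFun O S P (fun s => f s * g s) := by
  unfold IntFun at *
  rw [← hP.sum_mul_sum]
  exact O.mul_mem hf hg

theorem IntFun.const_mul {R : Subring ℚ} (hR : ∀ c ∈ R, ∀ x ∈ O, c • x ∈ O) {c : ℚ} (hc : c ∈ R)
    (hf : IntFun O S P f) : IntFun O S P (fun s => c * f s) := by
  unfold IntFun at *
  simpa only [mul_smul, ← Finset.smul_sum] using hR c hc _ hf

theorem IntFun.const {R : Subring ℚ} (hR : ∀ c ∈ R, ∀ x ∈ O, c • x ∈ O) {c : ℚ} (hc : c ∈ R)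
    (h1 : IntFun O S P 1) : IntFun O S P (fun _ => c) :=
  (h1.const_mul hR hc).congr fun _ _ => mul_one c

theorem IntFun.prod (hP : OrthFam S P) (h1 : IntFun O S P 1) {κ : Type} (T : Finset κ)
    (F : κ → ι → ℚ) (hF : ∀ k ∈ T, IntFun O S P (F k)) :
    IntFun O S P (fun s => ∏ k ∈ T, F k s) := by
  classical
  induction T using Finset.induction_on with
  | empty => exact h1.congr fun _ _ => rfl
  | insert k T hk ih =>
    simp only [Finset.prod_insert hk]
    exact (hF k (by simp)).mul hP (ih fun k hk => hF k (by simp [hk]))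

theorem IntFun.inv {R : Subring ℚ} (hR : ∀ c ∈ R, ∀ x ∈ O, c • x ∈ O) (hP : OrthFam S P)
    (h1 : IntFun O S P 1) (hf : IntFun O S P f) (hv : ∀ s ∈ S, f s ∈ R)
    (hi : ∀ s ∈ S, (f s)⁻¹ ∈ R) (h0 : ∀ s ∈ S, f s ≠ 0) :
    IntFun O S P (fun s => (f s)⁻¹) := by
  classical
  have key : ∀ T ⊆ S, ∃ h : ι → ℚ, IntFun O S P h ∧
      ∀ s, ∏ t ∈ T, (f s - f t) = ∏ t ∈ T, (- f t) + f s * h s := by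
    intro T
    induction T using Finset.induction_on with
    | empty => exact fun _ => ⟨fun _ => 0, by simp [IntFun, O.zero_mem], by simp⟩
    | insert t T ht ih =>
      intro hT
      obtain ⟨h, hh, e⟩ := ih (fun x hx => hT (by simp [hx]))
      have htS : t ∈ S := hT (by simp)
      refine ⟨fun s => ∏ t ∈ T, (- f t) + f s * h s + (- f t) * h s,
        ((IntFun.const hR ?_ h1).add (hf.mul hP hh)).add (hh.const_mul hR (R.neg_mem (hv t htS))),
        fun s => ?_⟩
      · exact R.prod_mem fun u hu => R.neg_mem (hv u (hT (by simp [hu])))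
      · rw [Finset.prod_insert ht, Finset.prod_insert ht, e]
        ring
  obtain ⟨h, hh, e⟩ := key S subset_rfl
  have hne : ∏ t ∈ S, (- f t) ≠ 0 := Finset.prod_ne_zero_iff.2 fun t ht => neg_ne_zero.2 (h0 t ht)
  have hmem : -(∏ t ∈ S, (- f t))⁻¹ ∈ R := by
    refine R.neg_mem ?_
    rw [← Finset.prod_inv_distrib]
    exact R.prod_mem fun u hu => by rw [inv_neg]; exact R.neg_mem (hi u hu)
  refine (hh.const_mul hR hmem).congr fun s hs => ?_
  have := e s
  rw [Finset.prod_eq_zero hs (sub_self _)] at this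
  have hs0 := h0 s hs
  field_simp
  linear_combination this

theorem IntFun.indicator {R : Subring ℚ} (hR : ∀ c ∈ R, ∀ x ∈ O, c • x ∈ O) {p : ℕ}
    (hp : p.Prime) (hRp : ∀ z : ℤ, ¬ (p : ℤ) ∣ z → (z : ℚ)⁻¹ ∈ R) (hP : OrthFam S P)
    (h1 : IntFun O S P 1) (y : ι → ℤ) (hy : IntFun O S P (fun s => (y s : ℚ))) (r : ℤ) :
    IntFun O S P (fun s => if (p : ℤ) ∣ y s - r then 1 else 0) := by
  classical
  have hp' : Prime (p : ℤ) := Nat.prime_iff_prime_int.mp hp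
  have hprod : ∀ T : Finset ι, IntFun O S P (fun s => ((∏ t ∈ T, (y s - y t) : ℤ) : ℚ)) := by
    intro T
    push_cast
    exact IntFun.prod hP h1 T _ fun t _ =>
      hy.sub (IntFun.const hR (intCast_mem R _) h1)
  set T₁ := S.filter fun s => (p : ℤ) ∣ y s - r
  set T₂ := S.filter fun s => ¬ (p : ℤ) ∣ y s - r
  have hv := hprod T₂
  have hw := hprod T₁
  have hz1 : ∀ s ∈ S, (p : ℤ) ∣ y s - r → ∏ t ∈ T₁, (y s - y t) = 0 := fun s hs h =>
    Finset.prod_eq_zero (i := s) (by simp [T₁, hs, h]) (sub_self _)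
  have hz2 : ∀ s ∈ S, ¬ (p : ℤ) ∣ y s - r → ∏ t ∈ T₂, (y s - y t) = 0 := fun s hs h =>
    Finset.prod_eq_zero (i := s) (by simp [T₂, hs, h]) (sub_self _)
  have hn1 : ∀ s ∈ S, ¬ (p : ℤ) ∣ y s - r → ¬ (p : ℤ) ∣ ∏ t ∈ T₁, (y s - y t) := by
    intro s hs h hd
    obtain ⟨t, ht, hd⟩ := hp'.exists_mem_finset_dvd hd
    simp only [T₁, Finset.mem_filter] at ht
    exact h (by simpa using dvd_add hd ht.2)
  have hn2 : ∀ s ∈ S, (p : ℤ) ∣ y s - r → ¬ (p : ℤ) ∣ ∏ t ∈ T₂, (y s - y t) := by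
    intro s hs h hd
    obtain ⟨t, ht, hd⟩ := hp'.exists_mem_finset_dvd hd
    simp only [T₂, Finset.mem_filter] at ht
    exact ht.2 (by simpa using dvd_sub h hd)
  have hu : ∀ s ∈ S, ¬ (p : ℤ) ∣ ∏ t ∈ T₂, (y s - y t) + ∏ t ∈ T₁, (y s - y t) := by
    intro s hs
    by_cases h : (p : ℤ) ∣ y s - r
    · rw [hz1 s hs h, add_zero]; exact hn2 s hs h
    · rw [hz2 s hs h, zero_add]; exact hn1 s hs h
  have hsum : IntFun O S P (fun s =>
      ((∏ t ∈ T₂, (y s - y t) + ∏ t ∈ T₁, (y s - y t) : ℤ) : ℚ)) :=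
    (hv.add hw).congr fun s _ => by push_cast; rfl
  have h0 : ∀ s ∈ S, ((∏ t ∈ T₂, (y s - y t) + ∏ t ∈ T₁, (y s - y t) : ℤ) : ℚ) ≠ 0 :=
    fun s hs => Int.cast_ne_zero.2 fun h => hu s hs (h ▸ dvd_zero _)
  refine (hv.mul hP (IntFun.inv hR hP h1 hsum (fun s _ => intCast_mem R _)
    (fun s hs => hRp _ (hu s hs)) h0)).congr fun s hs => ?_
  have h0s := h0 s hs
  split_ifs with h
  · rw [hz1 s hs h, add_zero] at h0s ⊢
    exact mul_inv_cancel₀ h0s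
  · rw [hz2 s hs h]; simp

/-- Integrality is preserved when the family is cut down by an integral indicator function. -/
theorem IntFun.restrict (hP : OrthFam S P) {q : ι → Prop} [DecidablePred q]
    (hq : IntFun O S P (fun s => if q s then 1 else 0)) (hf : IntFun O S P f) :
    IntFun O (S.filter q) P f := by
  have := hq.mul hP hf
  unfold IntFun at *
  simpa [Finset.sum_filter, ite_smul] using this

end IntegralFunctions

section PathIdempotents

/-- The shifted height `1 + ∑ εᵢ` of a path, given as the list of its steps `εᵢ = ±1`,
the last step first. -/
def pathHeight (w : List ℤ) : ℤ := 1 + w.sum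

/-- Steps are `±1` and no step starts at a height that is not positive. -/
def ValidPath : List ℤ → Prop
  | [] => True
  | e :: v => ValidPath v ∧ 0 < pathHeight v ∧ (e = 1 ∨ e = -1)

theorem pathHeight_cons (e : ℤ) (v : List ℤ) : pathHeight (e :: v) = pathHeight v + e := by
  simp [pathHeight]; ring

theorem pathHeight_replicate_append (r : ℕ) (e : ℤ) (v : List ℤ) :
    pathHeight (List.replicate r e ++ v) = pathHeight v + r * e := by
  simp [pathHeight]; ring

theorem ValidPath.replicate_append {r : ℕ} {e : ℤ} {v : List ℤ} (hv : ValidPath v)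
    (he : e = 1 ∨ e = -1) (hr : (r : ℤ) ≤ pathHeight v) :
    ValidPath (List.replicate r e ++ v) := by
  induction r with
  | zero => simpa
  | succ r ih =>
    rw [List.replicate_succ, List.cons_append]
    push_cast at hr
    refine ⟨ih (by omega), ?_, he⟩
    rw [pathHeight_replicate_append]
    rcases he with rfl | rfl <;> omega

variable {B : Type} [Ring B] [Algebra ℚ B]

/-- The joint spectral projection of the commuting elements `x 0, x 1, …` attached to a path:
at the `N`-th step `ε`, starting at height `M`, the eigenvalue of `x N` is `ε M`. -/
noncomputable def pathIdem (x : ℕ → B) : List ℤ → B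
  | [] => 1
  | e :: v => pathIdem x v *
      ((2 * pathHeight v : ℚ)⁻¹ • ((pathHeight v : ℚ) • (1 : B) + (e : ℚ) • x v.length))

variable {x : ℕ → B}

theorem commute_pathIdem (hc : ∀ i j, Commute (x i) (x j)) (i : ℕ) (w : List ℤ) :
    Commute (x i) (pathIdem x w) := by
  induction w with
  | nil => exact Commute.one_right _
  | cons e v ih =>
    exact ih.mul_right ((((Commute.one_right _).smul_right _).add_right
      ((hc _ _).smul_right _)).smul_right _)

theorem pathIdem_mul_comm (hc : ∀ i j, Commute (x i) (x j)) (v w : List ℤ) :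
    Commute (pathIdem x v) (pathIdem x w) := by
  induction v with
  | nil => exact Commute.one_left _
  | cons e v ih =>
    exact ih.mul_left ((((Commute.one_left _).smul_left _).add_left
      ((commute_pathIdem hc _ _).smul_left _)).smul_left _)

theorem pathIdem_split (e : ℤ) (v : List ℤ) (hv : 0 < pathHeight v) :
    pathIdem x (e :: v) + pathIdem x (-e :: v) = pathIdem x v := by
  have h : (pathHeight v : ℚ) ≠ 0 := by exact_mod_cast hv.ne'
  simp only [pathIdem, ← mul_add, ← smul_add]
  push_cast
  have : (pathHeight v : ℚ) • (1 : B) + (e : ℚ) • x v.length +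
      ((pathHeight v : ℚ) • 1 + (-(e : ℚ)) • x v.length) = (2 * pathHeight v : ℚ) • 1 := by
    module
  rw [this, smul_smul, inv_mul_cancel₀ (by positivity), one_smul, mul_one]

/-- The eigenvalue equations of `pathIdem`. -/
structure QuadRel (n : ℕ) (x : ℕ → B) : Prop where
  comm : ∀ i j, Commute (x i) (x j)
  quad : ∀ N < n, x N * x N = 1 + ∑ l ∈ Finset.range N, (1 + 2 * x l)

variable {n : ℕ}

theorem QuadRel.casimir_mul (h : QuadRel n x) (w : List ℤ) (hw : ValidPath w)
    (hn : w.length ≤ n) :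
    (1 + ∑ l ∈ Finset.range w.length, (1 + 2 * x l)) * pathIdem x w =
      ((pathHeight w : ℚ) ^ 2) • pathIdem x w ∧
    ∀ e v, w = e :: v → x v.length * pathIdem x w = ((e * pathHeight v : ℤ) : ℚ) • pathIdem x w := by
  induction w with
  | nil => simp [pathIdem, pathHeight]
  | cons e v ih =>
    obtain ⟨hv, hM, he⟩ := hw
    simp only [List.length_cons] at hn
    obtain ⟨ih, -⟩ := ih hv (by omega)
    have hM0 : (pathHeight v : ℚ) ≠ 0 := by exact_mod_cast hM.ne'
    have he2 : (e : ℚ) * e = 1 := by rcases he with rfl | rfl <;> norm_num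
    have hxx : pathIdem x v * (x v.length * x v.length) =
        ((pathHeight v : ℚ) ^ 2) • pathIdem x v := by
      rw [← ((commute_pathIdem h.comm _ v).mul_left (commute_pathIdem h.comm _ v)).eq,
        h.quad _ (by omega), ih]
    have key : x v.length * pathIdem x (e :: v) =
        ((e * pathHeight v : ℤ) : ℚ) • pathIdem x (e :: v) := by
      rw [(commute_pathIdem h.comm _ (e :: v)).eq]
      simp only [pathIdem, mul_smul_comm, smul_mul_assoc, mul_add, mul_one, add_mul, smul_add,
        mul_assoc, hxx, smul_smul]
      have h1 : (2 * (pathHeight v : ℚ))⁻¹ * (e * pathHeight v ^ 2) =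
        ((e * pathHeight v : ℤ) : ℚ) * ((2 * (pathHeight v : ℚ))⁻¹ * pathHeight v) := by
        push_cast; ring
      have h2 : (2 * (pathHeight v : ℚ))⁻¹ * pathHeight v =
        ((e * pathHeight v : ℤ) : ℚ) * ((2 * (pathHeight v : ℚ))⁻¹ * e) := by
        push_cast; linear_combination (-(2 * (pathHeight v : ℚ))⁻¹ * pathHeight v) * he2
      rw [h1, h2, add_comm]
    refine ⟨?_, ?_⟩
    · have h3 : (1 + ∑ l ∈ Finset.range v.length, (1 + 2 * x l)) * pathIdem x (e :: v) =
          ((pathHeight v : ℚ) ^ 2) • pathIdem x (e :: v) := by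
        rw [pathIdem, ← mul_assoc, ih, smul_mul_assoc]
      rw [List.length_cons, Finset.sum_range_succ, ← add_assoc, add_mul, h3, add_mul, one_mul,
        mul_assoc, key, pathHeight_cons, two_mul]
      push_cast
      rw [show ((pathHeight v : ℚ) + e) ^ 2 =
        pathHeight v ^ 2 + (1 + 2 * (e * pathHeight v)) by linear_combination he2]
      module
    · rintro e' v' ⟨⟩
      exact key

theorem QuadRel.step_mul (h : QuadRel n x) {e : ℤ} {v : List ℤ} (hw : ValidPath (e :: v))
    (hn : (e :: v).length ≤ n) :
    x v.length * pathIdem x (e :: v) =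
      ((e * pathHeight v : ℤ) : ℚ) • pathIdem x (e :: v) :=
  (h.casimir_mul _ hw hn).2 _ _ rfl

theorem ValidPath.of_append {u v : List ℤ} (h : ValidPath (u ++ v)) : ValidPath v := by
  induction u with
  | nil => exact h
  | cons e u ih => exact ih h.1

theorem mul_pathIdem_append {u v : List ℤ} {y : B} {c : ℚ}
    (hy : y * pathIdem x v = c • pathIdem x v) :
    y * pathIdem x (u ++ v) = c • pathIdem x (u ++ v) := by
  induction u with
  | nil => exact hy
  | cons e u ih => rw [List.cons_append, pathIdem, ← mul_assoc, ih, smul_mul_assoc]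

/-- The eigenvalue of `x N` on the projection of a path passing through `e :: v`. -/
theorem QuadRel.eigen (h : QuadRel n x) {e : ℤ} {u v : List ℤ} (hw : ValidPath (u ++ e :: v))
    (hn : v.length + 1 ≤ n) :
    x v.length * pathIdem x (u ++ e :: v) =
      ((e * pathHeight v : ℤ) : ℚ) • pathIdem x (u ++ e :: v) :=
  mul_pathIdem_append (h.step_mul hw.of_append (by simpa))

theorem QuadRel.pathIdem_mul_self (h : QuadRel n x) {w : List ℤ} (hw : ValidPath w)
    (hn : w.length ≤ n) : pathIdem x w * pathIdem x w = pathIdem x w := by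
  induction w with
  | nil => simp [pathIdem]
  | cons e v ih =>
    have hM0 : (pathHeight v : ℚ) ≠ 0 := by exact_mod_cast hw.2.1.ne'
    have he2 : (e : ℚ) * e = 1 := by rcases hw.2.2 with rfl | rfl <;> norm_num
    have h1 : pathIdem x v * pathIdem x (e :: v) = pathIdem x (e :: v) := by
      rw [pathIdem, ← mul_assoc, ih hw.1 (by simp at hn; omega)]
    have h2 := h.step_mul hw hn
    rw [(commute_pathIdem h.comm _ _).eq] at h2
    nth_rw 2 [pathIdem]
    rw [← mul_assoc, ← (pathIdem_mul_comm h.comm _ _).eq, h1, mul_smul_comm, mul_add,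
      mul_smul_comm, mul_smul_comm, h2, mul_one, smul_smul, ← add_smul, smul_smul]
    push_cast
    rw [show (2 * (pathHeight v : ℚ))⁻¹ * (pathHeight v + e * (e * pathHeight v)) = 1 by
      rw [← mul_assoc, he2]; field_simp; norm_num, one_smul]

theorem QuadRel.pathIdem_mul_ne (h : QuadRel n x) {w w' : List ℤ} (hw : ValidPath w)
    (hw' : ValidPath w') (hl : w.length = w'.length) (hne : w ≠ w') (hn : w.length ≤ n) :
    pathIdem x w * pathIdem x w' = 0 := by
  induction w generalizing w' with
  | nil => exact absurd (List.length_eq_zero_iff.1 hl.symm).symm hne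
  | cons e v ih =>
    cases w' with
    | nil => simp at hl
    | cons e' v' =>
      simp only [List.length_cons, Nat.add_right_cancel_iff] at hl
      by_cases hvv : v = v'
      · subst hvv
        have hee : e ≠ e' := fun he => hne (by rw [he])
        have h1 := h.step_mul hw hn
        have h2 := h.step_mul hw' (by simpa using hn)
        have h3 : ((e * pathHeight v : ℤ) : ℚ) • (pathIdem x (e :: v) * pathIdem x (e' :: v)) =
            ((e' * pathHeight v : ℤ) : ℚ) • (pathIdem x (e :: v) * pathIdem x (e' :: v)) := by
          rw [← smul_mul_assoc, ← h1, (commute_pathIdem h.comm _ _).eq, mul_assoc, h2,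
            mul_smul_comm]
        rw [← sub_eq_zero, ← sub_smul] at h3
        refine (smul_eq_zero.1 h3).resolve_left ?_
        rw [← Int.cast_sub, ← sub_mul]
        exact Int.cast_ne_zero.2 (mul_ne_zero (sub_ne_zero.2 hee) hw.2.1.ne')
      · rw [pathIdem, pathIdem, mul_assoc, ← mul_assoc _ (pathIdem x v'),
          Commute.eq (b := pathIdem x v'), mul_assoc, ← mul_assoc,
          ih hw.1 hw'.1 hl hvv (by simp at hn; omega), zero_mul]
        exact ((((Commute.one_left _).smul_left _).add_left
          ((commute_pathIdem h.comm _ _).smul_left _)).smul_left _)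

theorem QuadRel.orthFam (h : QuadRel n x) {ι : Type} {S : Finset ι} {W : ι → List ℤ} {N : ℕ}
    (hN : N ≤ n) (hinj : Set.InjOn W S)
    (hW : ∀ s ∈ S, ValidPath (W s) ∧ (W s).length = N) :
    OrthFam S (fun s => pathIdem x (W s)) := by
  intro s hs t ht
  refine ⟨?_, fun hst => ?_⟩
  · rintro rfl
    exact h.pathIdem_mul_self (hW s hs).1 (by rw [(hW s hs).2]; exact hN)
  · exact h.pathIdem_mul_ne (hW s hs).1 (hW t ht).1 (by rw [(hW s hs).2, (hW t ht).2])
      (fun he => hst (hinj hs ht he)) (by rw [(hW s hs).2]; exact hN)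

end PathIdempotents

section JucysMurphy

open Equiv

variable {B : Type} [Ring B] {n : ℕ}

/-- The Jucys–Murphy sums of transpositions in the image of a representation of `𝔖_n`. -/
def jmSum (T : Perm (Fin n) →* B) (l : Fin n) : B :=
  ∑ j ∈ Finset.univ.filter (· < l), T (swap j l)

/-- The representation factors through the Temperley–Lieb quotient: the sum over each
symmetric group on three letters vanishes. -/
def KillsSymmetrizers (T : Perm (Fin n) →* B) : Prop :=
  ∀ a b c : Fin n, a ≠ b → a ≠ c → b ≠ c →
    1 + T (swap a b) + T (swap a c) + T (swap b c) + T (swap a c * swap b c) +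
      T (swap b c * swap a c) = 0

/-- The normalised Jucys–Murphy elements, whose eigenvalues on a path are `± height`. -/
noncomputable def jmShift [Algebra ℚ B] (T : Perm (Fin n) →* B) (N : ℕ) : B :=
  if h : N < n then (1 - N : ℚ) • (1 : B) - (2 : ℚ) • jmSum T ⟨N, h⟩ else 0

variable (T : Perm (Fin n) →* B)

theorem commute_jmSum {σ : Perm (Fin n)} {l : Fin n} (hl : σ l = l)
    (h : ∀ j, j < l ↔ σ j < l) : Commute (T σ) (jmSum T l) := by
  unfold jmSum Commute SemiconjBy
  rw [Finset.mul_sum, Finset.sum_mul]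
  refine Finset.sum_equiv σ (by simpa using h) fun j _ => ?_
  rw [← map_mul, ← map_mul, mul_swap_eq_swap_mul, hl]

theorem jmSum_commute (k l : Fin n) : Commute (jmSum T k) (jmSum T l) := by
  wlog hkl : k < l generalizing k l
  · rcases eq_or_lt_of_le (not_lt.1 hkl) with rfl | h
    · exact Commute.refl _
    · exact (this l k h).symm
  refine Commute.sum_left _ _ _ fun a ha => ?_
  simp only [Finset.mem_filter, Finset.mem_univ, true_and] at ha
  refine commute_jmSum T (swap_apply_of_ne_of_ne (ha.trans hkl).ne' hkl.ne') fun j => ?_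
  have hal := ha.trans hkl
  rcases eq_or_ne j a with rfl | hja
  · simp [hkl, hal]
  · rcases eq_or_ne j k with rfl | hjk
    · simp [hkl, hal]
    · rw [swap_apply_of_ne_of_ne hja hjk]

theorem jmShift_commute [Algebra ℚ B] (i j : ℕ) : Commute (jmShift T i) (jmShift T j) := by
  unfold jmShift
  split_ifs
  · exact (((Commute.one_left _).smul_left _).sub_left
      (((Commute.one_right _).smul_right _).sub_right
        ((jmSum_commute T _ _).smul_right _) |>.smul_left _))
  all_goals simp

theorem sum_filter_lt_eq_sum_range {M : Type} [AddCommMonoid M] {N : ℕ} (hN : N ≤ n)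
    (g : ℕ → M) :
    ∑ a ∈ Finset.univ.filter (fun a : Fin n => a.val < N), g a = ∑ l ∈ Finset.range N, g l := by
  refine Finset.sum_nbij (fun a => a.val) (by simp) (fun a _ b _ h => Fin.ext h) ?_ (by simp)
  intro l hl
  simp only [Finset.coe_range, Set.mem_Iio] at hl
  exact ⟨⟨l, by omega⟩, by simpa using hl, rfl⟩

theorem sum_swap_eq [Algebra ℚ B] (S : Finset (Fin n)) (hS : ∀ a ∈ S, ∀ b < a, b ∈ S) :
    ∑ a ∈ S, ∑ b ∈ S, T (swap a b) = (S.card : ℚ) • 1 + (2 : ℚ) • ∑ a ∈ S, jmSum T a := by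
  classical
  have h1 : ∀ a ∈ S, ∑ b ∈ S, T (swap a b) = 1 + jmSum T a +
      ∑ b ∈ S, if a < b then T (swap a b) else 0 := by
    intro a ha
    have : ∀ b ∈ S, T (swap a b) = (if b = a then 1 else 0) +
        (if b < a then T (swap b a) else 0) + (if a < b then T (swap a b) else 0) := by
      intro b _
      rcases lt_trichotomy a b with h | rfl | h
      · simp [h, h.ne', h.le]
      · simp [swap_self, Perm.one_def.symm]
      · simp [h, h.ne, h.le, swap_comm]
    rw [Finset.sum_congr rfl this, Finset.sum_add_distrib, Finset.sum_add_distrib,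
      Finset.sum_ite_eq' S a, if_pos ha, jmSum]
    congr 2
    rw [← Finset.sum_filter]
    refine Finset.sum_congr ?_ fun _ _ => rfl
    ext b
    simpa using fun h => hS a ha b h
  have h2 : ∑ a ∈ S, (∑ b ∈ S, if a < b then T (swap a b) else 0) = ∑ a ∈ S, jmSum T a := by
    rw [Finset.sum_comm]
    refine Finset.sum_congr rfl fun b hb => ?_
    rw [← Finset.sum_filter, jmSum]
    refine Finset.sum_congr ?_ fun _ _ => rfl
    ext a
    simpa using fun h => hS b hb a h
  rw [Finset.sum_congr rfl h1, Finset.sum_add_distrib, Finset.sum_add_distrib, h2,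
    Finset.sum_const]
  simp only [← Nat.cast_smul_eq_nsmul ℚ]
  module

theorem jmSum_mul_self [Algebra ℚ B] (hT : KillsSymmetrizers T) (l : Fin n) :
    (2 : ℚ) • (jmSum T l * jmSum T l) = ((l : ℚ) * (3 - l)) • 1 - (2 * (l - 1) : ℚ) • jmSum T l -
      (2 : ℚ) • ∑ a ∈ Finset.univ.filter (· < l), jmSum T a := by
  classical
  set S := Finset.univ.filter (· < l) with hS
  have hcard : S.card = l.val := by
    rw [hS, ← Fin.card_Iio]
    congr 1
    ext a
    simp
  have hsq : jmSum T l * jmSum T l = ∑ a ∈ S, ∑ b ∈ S, T (swap a l * swap b l) := by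
    rw [jmSum, Finset.sum_mul_sum]
    simp [hS]
  have hsq' : jmSum T l * jmSum T l = ∑ a ∈ S, ∑ b ∈ S, T (swap b l * swap a l) := by
    rw [hsq, Finset.sum_comm]
  have hpt : ∀ a ∈ S, ∀ b ∈ S, T (swap a l * swap b l) + T (swap b l * swap a l) =
      (if a = b then (4 : ℚ) • 1 + (2 : ℚ) • T (swap a l) else 0) -
        (1 + T (swap a b) + T (swap a l) + T (swap b l)) := by
    intro a ha b hb
    simp only [hS, Finset.mem_filter, Finset.mem_univ, true_and] at ha hb
    split_ifs with hab
    · subst hab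
      rw [swap_mul_self, swap_self, ← Perm.one_def, map_one]
      module
    · have := hT a b l hab ha.ne hb.ne
      linear_combination (norm := module) (1 : ℚ) • this
  have hsum : (2 : ℚ) • (jmSum T l * jmSum T l) = ∑ a ∈ S, ∑ b ∈ S,
      ((if a = b then (4 : ℚ) • 1 + (2 : ℚ) • T (swap a l) else 0) -
        (1 + T (swap a b) + T (swap a l) + T (swap b l))) := by
    rw [two_smul]
    nth_rw 1 [hsq]
    rw [hsq', ← Finset.sum_add_distrib]
    refine Finset.sum_congr rfl fun a ha => ?_
    rw [← Finset.sum_add_distrib]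
    exact Finset.sum_congr rfl fun b hb => hpt a ha b hb
  have hswap := sum_swap_eq T S fun a ha b hb => by
    simp only [hS, Finset.mem_filter, Finset.mem_univ, true_and] at ha ⊢
    exact hb.trans ha
  have hJ : ∑ a ∈ S, T (swap a l) = jmSum T l := rfl
  have hite : ∑ a ∈ S, ∑ b ∈ S, (if a = b then (4 : ℚ) • (1 : B) + (2 : ℚ) • T (swap a l) else 0) =
      (4 * l : ℚ) • 1 + (2 : ℚ) • jmSum T l := by
    have : ∀ a ∈ S, ∑ b ∈ S, (if a = b then (4 : ℚ) • (1 : B) + (2 : ℚ) • T (swap a l) else 0) =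
        (4 : ℚ) • (1 : B) + (2 : ℚ) • T (swap a l) := fun a ha => by
      rw [Finset.sum_ite_eq S a, if_pos ha]
    rw [Finset.sum_congr rfl this, Finset.sum_add_distrib, Finset.sum_const, ← Finset.smul_sum, hJ,
      hcard, ← Nat.cast_smul_eq_nsmul ℚ]
    module
  rw [hsum]
  simp only [Finset.sum_sub_distrib, Finset.sum_add_distrib, hite, hswap, hJ, Finset.sum_const,
    ← Finset.smul_sum, hcard, ← Nat.cast_smul_eq_nsmul ℚ]
  module

theorem quadRel_jmShift [Algebra ℚ B] (hT : KillsSymmetrizers T) : QuadRel n (jmShift T) := by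
  refine ⟨jmShift_commute T, fun N hN => ?_⟩
  have h := jmSum_mul_self T hT ⟨N, hN⟩
  have h1 : ∑ l ∈ Finset.range N, (1 + 2 * jmShift T l) =
      (N + N * (3 - N) - 2 * N : ℚ) • (1 : B) + (2 * N : ℚ) • 1 -
        (4 : ℚ) • ∑ a ∈ Finset.univ.filter (fun a => a < (⟨N, hN⟩ : Fin n)), jmSum T a := by
    have h2 : ∀ a ∈ Finset.univ.filter (fun a : Fin n => a.val < N),
        (1 + 2 * jmShift T a) = (3 - 2 * (a.val : ℚ)) • (1 : B) - (4 : ℚ) • jmSum T a := by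
      intro a _
      rw [jmShift, dif_pos a.isLt, two_mul]
      module
    have h3 : ∑ a ∈ Finset.univ.filter (fun a : Fin n => a.val < N), (3 - 2 * (a.val : ℚ)) =
        N + N * (3 - N) := by
      rw [sum_filter_lt_eq_sum_range hN.le (fun l => 3 - 2 * (l : ℚ))]
      clear h hN h2
      induction N with
      | zero => simp
      | succ N ih => rw [Finset.sum_range_succ, ih]; push_cast; ring
    rw [← sum_filter_lt_eq_sum_range hN.le (fun l => 1 + 2 * jmShift T l),
      Finset.sum_congr rfl h2, Finset.sum_sub_distrib, ← Finset.sum_smul, h3, ← Finset.smul_sum]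
    have h4 : Finset.univ.filter (fun a : Fin n => a.val < N) =
      Finset.univ.filter (fun a => a < (⟨N, hN⟩ : Fin n)) := rfl
    rw [h4]
    module
  rw [h1, jmShift, dif_pos hN]
  simp only [sub_mul, mul_sub, smul_mul_assoc, mul_smul_comm, one_mul, mul_one]
  simp only [] at h
  linear_combination (norm := module) (2 : ℚ) • h

theorem swap_succ_mul_jmSum {i : ℕ} (hi : i + 1 < n) :
    T (swap ⟨i, by omega⟩ ⟨i + 1, hi⟩) * jmSum T ⟨i, by omega⟩ =
      jmSum T ⟨i + 1, hi⟩ * T (swap ⟨i, by omega⟩ ⟨i + 1, hi⟩) - 1 := by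
  have hfilter : Finset.univ.filter (· < (⟨i + 1, hi⟩ : Fin n)) =
      insert ⟨i, by omega⟩ (Finset.univ.filter (· < (⟨i, by omega⟩ : Fin n))) := by
    ext a
    simp only [Finset.mem_filter, Finset.mem_univ, true_and, Finset.mem_insert, Fin.lt_def,
      Fin.ext_iff]
    omega
  rw [jmSum, jmSum, hfilter, Finset.sum_insert (by simp), add_mul, ← map_mul, swap_mul_self,
    map_one, add_sub_cancel_left, Finset.mul_sum, Finset.sum_mul]
  refine Finset.sum_congr rfl fun a ha => ?_
  simp only [Finset.mem_filter, Finset.mem_univ, true_and, Fin.lt_def] at ha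
  rw [← map_mul, ← map_mul, mul_swap_eq_swap_mul, swap_apply_left,
    swap_apply_of_ne_of_ne (Fin.ne_of_lt ha) (Fin.ne_of_lt (by simp [Fin.lt_def]; omega))]

theorem jmSum_mul_swap_succ {i : ℕ} (hi : i + 1 < n) :
    jmSum T ⟨i, by omega⟩ * T (swap ⟨i, by omega⟩ ⟨i + 1, hi⟩) =
      T (swap ⟨i, by omega⟩ ⟨i + 1, hi⟩) * jmSum T ⟨i + 1, hi⟩ - 1 := by
  have h := swap_succ_mul_jmSum T hi
  set s := T (swap ⟨i, by omega⟩ ⟨i + 1, hi⟩)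
  have hs : s * s = 1 := by rw [← map_mul, swap_mul_self, map_one]
  have h2 : s * (s * jmSum T ⟨i, by omega⟩) * s = s * (jmSum T ⟨i + 1, hi⟩ * s - 1) * s := by
    rw [h]
  rw [← mul_assoc s s, hs, one_mul, mul_sub, sub_mul, mul_one, hs, mul_assoc, mul_assoc, hs,
    mul_one] at h2
  exact h2

theorem swap_succ_mul_jmShift [Algebra ℚ B] {i : ℕ} (hi : i + 1 < n) :
    T (swap ⟨i, by omega⟩ ⟨i + 1, hi⟩) * jmShift T i =
        (jmShift T (i + 1) + 1) * T (swap ⟨i, by omega⟩ ⟨i + 1, hi⟩) + (2 : ℚ) • 1 ∧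
    jmShift T i * T (swap ⟨i, by omega⟩ ⟨i + 1, hi⟩) =
        T (swap ⟨i, by omega⟩ ⟨i + 1, hi⟩) * (jmShift T (i + 1) + 1) + (2 : ℚ) • 1 := by
  rw [jmShift, jmShift, dif_pos (by omega), dif_pos hi]
  simp only [add_mul, mul_add, sub_mul, mul_sub, smul_mul_assoc, mul_smul_comm, one_mul, mul_one,
    swap_succ_mul_jmSum T hi, jmSum_mul_swap_succ T hi]
  push_cast
  constructor <;> module

/-- A transposition of consecutive letters acts by `-1` on a path with two equal
consecutive steps. -/
theorem swap_succ_mul_pathIdem [Algebra ℚ B] (hT : KillsSymmetrizers T) {e : ℤ} {u v : List ℤ}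
    (hw : ValidPath (u ++ e :: e :: v)) (hn : v.length + 1 < n) :
    T (swap ⟨v.length, by omega⟩ ⟨v.length + 1, hn⟩) * pathIdem (jmShift T) (u ++ e :: e :: v) =
        - pathIdem (jmShift T) (u ++ e :: e :: v) ∧
    pathIdem (jmShift T) (u ++ e :: e :: v) * T (swap ⟨v.length, by omega⟩ ⟨v.length + 1, hn⟩) =
        - pathIdem (jmShift T) (u ++ e :: e :: v) := by
  have hq := quadRel_jmShift T hT
  have hw' := hw.of_append
  obtain ⟨h1, h2⟩ := swap_succ_mul_jmShift T hn
  set P := pathIdem (jmShift T) (e :: e :: v) with hP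
  set s := T (swap ⟨v.length, by omega⟩ ⟨v.length + 1, hn⟩)
  set C : B := 1 + ∑ l ∈ Finset.range v.length, (1 + 2 * jmShift T l) with hC
  have hM := hw'.2.1
  rw [pathHeight_cons] at hM
  have hM' := hw'.1.2.1
  have he := hw'.2.2
  have hne : (((e * pathHeight v : ℤ) : ℚ) + 2) ^ 2 - (pathHeight v : ℚ) ^ 2 ≠ 0 := by
    have : ((e * pathHeight v + 2) ^ 2 - pathHeight v ^ 2 : ℤ) ≠ 0 := by
      rcases he with rfl | rfl
      · nlinarith
      · intro h0; nlinarith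
    exact_mod_cast this
  have hx : jmShift T v.length * P = ((e * pathHeight v : ℤ) : ℚ) • P :=
    hq.eigen (u := [e]) hw' (by omega)
  have hx' : jmShift T (v.length + 1) * P = (((e * pathHeight v : ℤ) : ℚ) + 1) • P := by
    have := hq.step_mul hw' (by simp; omega)
    rw [pathHeight_cons] at this
    rw [List.length_cons] at this
    rw [this]
    have he2 : e * e = 1 := by rcases he with rfl | rfl <;> norm_num
    rw [mul_add, he2]; push_cast; rfl
  have hCP : C * P = ((pathHeight v : ℚ) ^ 2) • P :=
    mul_pathIdem_append (u := [e, e]) (hq.casimir_mul v hw'.1.1 (by omega)).1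
  have hCs : Commute C s := by
    refine (Commute.one_left _).add_left (Commute.sum_left _ _ _ fun l hl => ?_)
    rw [Finset.mem_range] at hl
    refine (Commute.one_left _).add_left ?_
    rw [two_mul]
    suffices h : Commute (jmShift T l) s from h.add_left h
    rw [jmShift, dif_pos (by omega)]
    refine ((Commute.one_left _).smul_left _).sub_left (Commute.smul_left ?_ _)
    refine (commute_jmSum T (swap_apply_of_ne_of_ne ?_ ?_) fun j => ?_).symm
    · simp [Fin.ext_iff]; omega
    · simp [Fin.ext_iff]; omega
    · rw [swap_apply_def]
      split_ifs with ha hb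
      · simp [ha, Fin.lt_def]; omega
      · simp [hb, Fin.lt_def]; omega
      · rfl
  have hPx : ∀ i, P * jmShift T i = jmShift T i * P := fun i =>
    (commute_pathIdem hq.comm i _).eq.symm
  have hPC : P * C = C * P := by
    rw [hC, mul_add, add_mul, Finset.mul_sum, Finset.sum_mul]
    simp [mul_add, add_mul, two_mul, hPx]
  have hxx := hq.quad v.length (by omega)
  have hleft : s * P + P = 0 := by
    have e1 : jmShift T v.length * (s * P + P) =
        (((e * pathHeight v : ℤ) : ℚ) + 2) • (s * P + P) := by
      rw [mul_add, ← mul_assoc, h2, add_mul, mul_assoc, add_mul, hx', hx, smul_mul_assoc]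
      simp only [one_mul, mul_add, mul_smul_comm]
      module
    have e2 : C * (s * P + P) = ((pathHeight v : ℚ) ^ 2) • (s * P + P) := by
      rw [mul_add, ← mul_assoc, hCs.eq, mul_assoc, hCP, mul_smul_comm, smul_add]
    have e3 : C * (s * P + P) = ((((e * pathHeight v : ℤ) : ℚ) + 2) ^ 2) • (s * P + P) := by
      rw [hC, ← hxx, mul_assoc, e1, mul_smul_comm, e1, smul_smul, sq]
    rw [e2, eq_comm, ← sub_eq_zero, ← sub_smul] at e3
    exact (smul_eq_zero.1 e3).resolve_left hne
  have hright : P * s + P = 0 := by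
    have e1 : (P * s + P) * jmShift T v.length =
        (((e * pathHeight v : ℤ) : ℚ) + 2) • (P * s + P) := by
      rw [add_mul, mul_assoc, h1, mul_add, ← mul_assoc, mul_add, hPx, hPx, hx', hx,
        mul_smul_comm]
      simp only [mul_one, add_mul, smul_mul_assoc]
      module
    have e2 : (P * s + P) * C = ((pathHeight v : ℚ) ^ 2) • (P * s + P) := by
      rw [add_mul, mul_assoc, ← hCs.eq, ← mul_assoc, hPC, hCP, smul_mul_assoc, smul_add]
    have e3 : (P * s + P) * C = ((((e * pathHeight v : ℤ) : ℚ) + 2) ^ 2) • (P * s + P) := by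
      rw [hC, ← hxx, ← mul_assoc, e1, smul_mul_assoc, e1, smul_smul, sq]
    rw [e2, eq_comm, ← sub_eq_zero, ← sub_smul] at e3
    exact (smul_eq_zero.1 e3).resolve_left hne
  have hPP : P * P = P := hq.pathIdem_mul_self hw' (by simp; omega)
  have habs : P * pathIdem (jmShift T) (u ++ e :: e :: v) =
      pathIdem (jmShift T) (u ++ e :: e :: v) := by
    have := mul_pathIdem_append (u := u) (v := e :: e :: v) (y := P) (c := 1)
      (by rw [one_smul]; exact hPP)
    rwa [one_smul] at this
  constructor
  · rw [← habs, ← mul_assoc, eq_neg_of_add_eq_zero_left hleft, neg_mul]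
  · rw [← habs, (pathIdem_mul_comm hq.comm _ _).eq, mul_assoc,
      eq_neg_of_add_eq_zero_left hright, mul_neg]

end JucysMurphy

section PairSwap

open Equiv

variable {α : Type} [DecidableEq α]

/-- The product of the transpositions `(f l, g l)`. -/
def pairSwap : ∀ {j : ℕ}, (Fin j → α) → (Fin j → α) → Perm α
  | 0, _, _ => 1
  | _ + 1, f, g => swap (f 0) (g 0) * pairSwap (Fin.tail f) (Fin.tail g)

theorem pairSwap_apply {j : ℕ} {f g : Fin j → α} (hf : f.Injective) (hg : g.Injective)
    (hfg : ∀ l m, f l ≠ g m) :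
    (∀ l, pairSwap f g (g l) = f l) ∧ (∀ l, pairSwap f g (f l) = g l) ∧
      ∀ a, (∀ l, a ≠ f l) → (∀ l, a ≠ g l) → pairSwap f g a = a := by
  induction j with
  | zero => exact ⟨fun l => l.elim0, fun l => l.elim0, fun a _ _ => rfl⟩
  | succ j ih =>
    have hf' : (Fin.tail f).Injective := hf.comp (Fin.succ_injective j)
    have hg' : (Fin.tail g).Injective := hg.comp (Fin.succ_injective j)
    obtain ⟨h1, h2, h3⟩ := ih hf' hg' fun l m => hfg _ _
    have hf0 : ∀ l : Fin j, f 0 ≠ Fin.tail f l := fun l => hf.ne (Fin.succ_ne_zero l).symm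
    have hg0 : ∀ l : Fin j, g 0 ≠ Fin.tail g l := fun l => hg.ne (Fin.succ_ne_zero l).symm
    refine ⟨fun l => ?_, fun l => ?_, fun a ha hb => ?_⟩
    · cases l using Fin.cases with
      | zero =>
        rw [pairSwap, Perm.mul_apply, h3 _ (fun l => (hfg _ _).symm) hg0, swap_apply_right]
      | succ l =>
        have := h1 l
        rw [pairSwap, Perm.mul_apply]
        change swap (f 0) (g 0) (pairSwap (Fin.tail f) (Fin.tail g) (Fin.tail g l)) = _
        rw [this, swap_apply_of_ne_of_ne (hf0 l).symm (hfg _ _)]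
        rfl
    · cases l using Fin.cases with
      | zero =>
        rw [pairSwap, Perm.mul_apply, h3 _ hf0 (fun l => hfg _ _), swap_apply_left]
      | succ l =>
        have := h2 l
        rw [pairSwap, Perm.mul_apply]
        change swap (f 0) (g 0) (pairSwap (Fin.tail f) (Fin.tail g) (Fin.tail f l)) = _
        have hne : Fin.tail g l ≠ f 0 := fun h => hfg 0 l.succ h.symm
        rw [this, swap_apply_of_ne_of_ne hne (hg0 l).symm]
        rfl
    · rw [pairSwap, Perm.mul_apply, h3 _ (fun l => ha _) (fun l => hb _),
        swap_apply_of_ne_of_ne (ha 0) (hb 0)]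

theorem conj_pairSwap (σ : Perm α) {j : ℕ} (f g : Fin j → α) :
    σ * pairSwap f g * σ⁻¹ = pairSwap (σ ∘ f) (σ ∘ g) := by
  induction j with
  | zero => simp [pairSwap]
  | succ j ih =>
    have h := ih (Fin.tail f) (Fin.tail g)
    have h' := swap_apply_apply σ (f 0) (g 0)
    rw [pairSwap, pairSwap, Function.comp_apply, Function.comp_apply, h']
    change _ = _ * pairSwap (σ ∘ Fin.tail f) (σ ∘ Fin.tail g)
    rw [← h]
    group

theorem pairSwap_comp {j : ℕ} {f g : Fin j → α} (hf : f.Injective) (hg : g.Injective)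
    (hfg : ∀ l m, f l ≠ g m) (π : Perm (Fin j)) :
    pairSwap (f ∘ π) (g ∘ π) = pairSwap f g := by
  obtain ⟨h1, h2, h3⟩ := pairSwap_apply hf hg hfg
  obtain ⟨h1', h2', h3'⟩ := pairSwap_apply (hf.comp π.injective) (hg.comp π.injective)
    fun l m => hfg _ _
  ext a
  by_cases ha : ∃ l, a = f l
  · obtain ⟨l, rfl⟩ := ha
    have := h2' (π.symm l)
    simp only [Function.comp_apply, apply_symm_apply] at this
    rw [this, h2]
  · by_cases hb : ∃ l, a = g l
    · obtain ⟨l, rfl⟩ := hb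
      have := h1' (π.symm l)
      simp only [Function.comp_apply, apply_symm_apply] at this
      rw [this, h1]
    · push Not at ha hb
      rw [h3 a ha hb, h3' a (fun l => ha _) (fun l => hb _)]

/-- Injective sequences of length `j` with entries in `D`. -/
def injSeq (D : Finset α) (j : ℕ) : Finset (Fin j → α) :=
  (Fintype.piFinset fun _ => D).filter Function.Injective

theorem mem_injSeq {D : Finset α} {j : ℕ} {f : Fin j → α} :
    f ∈ injSeq D j ↔ (∀ l, f l ∈ D) ∧ f.Injective := by
  simp [injSeq]

theorem sum_injSeq_succ {M : Type} [AddCommMonoid M] (D : Finset α) (j : ℕ)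
    (G : (Fin (j + 1) → α) → M) :
    ∑ f ∈ injSeq D (j + 1), G f =
      ∑ f ∈ injSeq D j, ∑ y ∈ D \ Finset.univ.image f, G (Fin.cons y f) := by
  rw [Finset.sum_sigma']
  refine Finset.sum_bij' (fun f _ => ⟨Fin.tail f, f 0⟩) (fun x _ => Fin.cons x.2 x.1)
    ?_ ?_ ?_ ?_ ?_
  · intro f hf
    rw [mem_injSeq] at hf
    simp only [Finset.mem_sigma, mem_injSeq, Finset.mem_sdiff, Finset.mem_image, Finset.mem_univ,
      true_and, not_exists]
    exact ⟨⟨fun l => hf.1 _, hf.2.comp (Fin.succ_injective j)⟩, hf.1 0,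
      fun l => hf.2.ne (Fin.succ_ne_zero l)⟩
  · rintro ⟨f, y⟩ h
    simp only [Finset.mem_sigma, mem_injSeq, Finset.mem_sdiff, Finset.mem_image, Finset.mem_univ,
      true_and, not_exists] at h
    rw [mem_injSeq, Fin.cons_injective_iff]
    refine ⟨fun l => ?_, ?_, h.1.2⟩
    · cases l using Fin.cases with
      | zero => exact h.2.1
      | succ l => exact h.1.1 l
    · rintro ⟨l, hl⟩
      exact h.2.2 l hl
  · intro f _
    simp
  · rintro ⟨f, y⟩ _
    simp
  · intro f _
    simp

variable {B : Type} [Ring B] (T : Perm α →* B) {D : Finset α}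

theorem sum_pairSwap_mul [Algebra ℚ B] {E e : B} {c : ℚ} {j : ℕ} {g : Fin j → α}
    (hg : g.Injective) (hgD : ∀ l, g l ∉ D)
    (hE : ∀ l, E * ∑ b ∈ D, T (swap b (g l)) = c • E)
    (he : ∀ l m, l ≠ m → T (swap (g l) (g m)) * e = -e) :
    E * (∑ f ∈ injSeq D j, T (pairSwap f g)) * e = (∏ i ∈ Finset.range j, (c + i)) • (E * e) := by
  induction j with
  | zero =>
    have : injSeq D 0 = Finset.univ := by
      ext f
      simp only [mem_injSeq, Function.injective_of_subsingleton, Finset.mem_univ, iff_true, and_true]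
      exact fun l => l.elim0
    simp [this, pairSwap]
  | succ j ih =>
    have hg' : (Fin.tail g).Injective := hg.comp (Fin.succ_injective j)
    have ih' := ih hg' (fun l => hgD _) (fun l => hE _)
      (fun l m h => he _ _ (fun h' => h (Fin.succ_injective j h')))
    have key : ∀ f ∈ injSeq D j,
        ∑ y ∈ D \ Finset.univ.image f, T (pairSwap (Fin.cons y f) g) * e =
          (∑ y ∈ D, T (swap y (g 0))) * (T (pairSwap f (Fin.tail g)) * e) +
            (j : ℚ) • (T (pairSwap f (Fin.tail g)) * e) := by
      intro f hf
      rw [mem_injSeq] at hf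
      have hfg : ∀ l m, f l ≠ g m := fun l m h => hgD m (h ▸ hf.1 l)
      obtain ⟨h1, -, h3⟩ := pairSwap_apply hf.2 hg' fun l m => hfg _ _
      set w := pairSwap f (Fin.tail g) with hw
      have hcons : ∀ y, T (pairSwap (Fin.cons y f : Fin (j + 1) → α) g) * e =
          T (swap y (g 0)) * (T w * e) := fun y => by
        rw [pairSwap, map_mul, mul_assoc]; simp [hw]
      have hcol : ∀ l : Fin j, T (swap (f l) (g 0)) * (T w * e) = - (T w * e) := by
        intro l
        have h0 : w (g 0) = g 0 := h3 _ (fun l => (hfg _ _).symm)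
          fun l => hg.ne (Fin.succ_ne_zero l).symm
        have hl : w (Fin.tail g l) = f l := h1 l
        rw [← mul_assoc, ← map_mul, ← hl]
        nth_rw 1 [← h0]
        rw [← mul_swap_eq_swap_mul, map_mul, mul_assoc, Fin.tail, he _ _ (Fin.succ_ne_zero l),
          mul_neg]
      rw [Finset.sum_congr rfl fun y _ => hcons y, ← Finset.sum_mul]
      have hsub : Finset.univ.image f ⊆ D := by
        intro a ha
        obtain ⟨l, -, rfl⟩ := Finset.mem_image.1 ha
        exact hf.1 l
      have hs := Finset.sum_sdiff (f := fun y => T (swap y (g 0)) * (T w * e)) hsub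
      rw [Finset.sum_image fun a _ b _ h => hf.2 h, Finset.sum_congr rfl fun l _ => hcol l,
        Finset.sum_const, Finset.card_univ, Fintype.card_fin, ← Nat.cast_smul_eq_nsmul ℚ,
        ← Finset.sum_mul, ← Finset.sum_mul] at hs
      rw [← hs]
      module
    rw [sum_injSeq_succ, mul_assoc, Finset.sum_mul]
    simp only [Finset.sum_mul]
    rw [Finset.sum_congr rfl key, Finset.sum_add_distrib, ← Finset.mul_sum, ← Finset.smul_sum,
      ← Finset.sum_mul, mul_add, ← mul_assoc, hE, mul_smul_comm, ← mul_assoc E, ih',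
      smul_mul_assoc, ← mul_assoc E, ih', Finset.prod_range_succ]
    module

theorem mul_pairSwap_comp {e : B} {q : ℕ} {f g : Fin q → α} (hf : f.Injective)
    (hg : g.Injective) (hfg : ∀ l m, f l ≠ g m)
    (he : ∀ l m, l ≠ m → T (swap (g l) (g m)) * e = -e)
    (he' : ∀ l m, l ≠ m → e * T (swap (g l) (g m)) = -e) (π : Perm (Fin q)) :
    e * T (pairSwap (f ∘ π) g) * e = e * T (pairSwap f g) * e := by
  have hstep : ∀ (f : Fin q → α), f.Injective → (∀ l m, f l ≠ g m) → ∀ i j, i ≠ j →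
      e * T (pairSwap (f ∘ swap i j) g) * e = e * T (pairSwap f g) * e := by
    intro f hf hfg i j hij
    have hσf : swap (g i) (g j) ∘ f = (f ∘ swap i j) ∘ swap i j := by
      ext l
      simp [swap_apply_of_ne_of_ne (hfg l i) (hfg l j)]
    have hσg : swap (g i) (g j) ∘ g = g ∘ swap i j := by
      ext l
      exact hg.swap_apply i j l
    have := conj_pairSwap (swap (g i) (g j)) f g
    rw [hσf, hσg, pairSwap_comp (hf.comp (swap i j).injective) hg (fun l m => hfg _ _),
      swap_inv] at this
    rw [← this, map_mul, map_mul, mul_assoc, mul_assoc, he i j hij, ← mul_assoc, ← mul_assoc,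
      he' i j hij]
    simp [mul_assoc]
  induction π using Perm.swap_induction_on' with
  | one => simp
  | mul_swap π i j hij ih =>
    rw [← ih, Perm.coe_mul, ← Function.comp_assoc]
    exact hstep (f ∘ π) (hf.comp π.injective) (fun l m => hfg _ _) i j hij

theorem sum_pairSwap_eq_smul [Algebra ℚ B] {O : Subring B} (hO : ∀ w, T w ∈ O) {e : B}
    (heO : e ∈ O) {q : ℕ} {g : Fin q → α} (hg : g.Injective) (hgD : ∀ l, g l ∉ D)
    (he : ∀ l m, l ≠ m → T (swap (g l) (g m)) * e = -e)
    (he' : ∀ l m, l ≠ m → e * T (swap (g l) (g m)) = -e) :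
    ∃ z ∈ O, e * (∑ f ∈ injSeq D q, T (pairSwap f g)) * e = (q.factorial : ℚ) • z := by
  have hmem : ∀ f : Fin q → α, e * T (pairSwap f g) * e ∈ O := fun f =>
    O.mul_mem (O.mul_mem heO (hO _)) heO
  have hfib : ∀ A ∈ (injSeq D q).image fun f => Finset.univ.image f, ∃ z ∈ O,
      ∑ f ∈ (injSeq D q).filter (fun f => Finset.univ.image f = A), e * T (pairSwap f g) * e =
        (q.factorial : ℚ) • z := by
    intro A hA
    obtain ⟨f, hf, rfl⟩ := Finset.mem_image.1 hA
    rw [mem_injSeq] at hf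
    refine ⟨_, hmem f, ?_⟩
    have h1 : ∑ f' ∈ (injSeq D q).filter (fun f' => Finset.univ.image f' = Finset.univ.image f),
        e * T (pairSwap f' g) * e = ∑ π : Perm (Fin q), e * T (pairSwap (f ∘ π) g) * e := by
      symm
      refine Finset.sum_bij (fun π _ => f ∘ π) ?_ ?_ ?_ fun _ _ => rfl
      · intro π _
        rw [Finset.mem_filter, mem_injSeq]
        refine ⟨⟨fun l => hf.1 _, hf.2.comp π.injective⟩, ?_⟩
        rw [← Finset.image_image, Finset.image_univ_equiv]
      · intro π _ π' _ h
        ext l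
        exact congrArg _ (hf.2 (congrFun h l))
      · intro f' hf'
        rw [Finset.mem_filter, mem_injSeq] at hf'
        have hr : ∀ l, ∃ m, f m = f' l := fun l => by
          have : f' l ∈ Finset.univ.image f := by
            rw [← hf'.2]; exact Finset.mem_image_of_mem _ (Finset.mem_univ l)
          simpa using this
        choose m hm using hr
        have hinj : m.Injective := fun x y h => hf'.1.2 (by rw [← hm, ← hm, h])
        exact ⟨Equiv.ofBijective m (Finite.injective_iff_bijective.1 hinj), Finset.mem_univ _,
          funext hm⟩
    rw [h1, Finset.sum_congr rfl fun π _ => mul_pairSwap_comp T hf.2 hg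
      (fun l m h => hgD m (h ▸ hf.1 l)) he he' π, Finset.sum_const, Finset.card_univ,
      Fintype.card_perm, Fintype.card_fin, Nat.cast_smul_eq_nsmul]
  choose! z hz hz' using hfib
  refine ⟨∑ A ∈ (injSeq D q).image fun f => Finset.univ.image f, z A, O.sum_mem hz, ?_⟩
  rw [Finset.smul_sum, ← Finset.sum_congr rfl hz', Finset.mul_sum, Finset.sum_mul]
  exact (Finset.sum_fiberwise_of_maps_to (fun f hf => Finset.mem_image_of_mem _ hf) _).symm

/-- The rising factorials of the eigenvalues of the partial Jucys–Murphy sums, divided by `q!`,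
are integral. -/
theorem IntFun.risingFactorial [Algebra ℚ B] {O : Subring B} (hO : ∀ w, T w ∈ O) {ι : Type}
    {S : Finset ι} {P : ι → B} (hP : OrthFam S P) (h1 : IntFun O S P 1) {q : ℕ} {g : Fin q → α}
    (hg : g.Injective) (hgD : ∀ l, g l ∉ D) {c : ι → ℚ}
    (hc : ∀ s ∈ S, ∀ l, P s * ∑ b ∈ D, T (swap b (g l)) = c s • P s)
    (he : ∀ s ∈ S, ∀ l m, l ≠ m → T (swap (g l) (g m)) * P s = - P s)
    (he' : ∀ s ∈ S, ∀ l m, l ≠ m → P s * T (swap (g l) (g m)) = - P s) :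
    IntFun O S P fun s => (∏ i ∈ Finset.range q, (c s + i)) / q.factorial := by
  have h1' : ∑ s ∈ S, P s ∈ O := by simpa [IntFun] using h1
  have hel : ∀ l m, l ≠ m → T (swap (g l) (g m)) * ∑ s ∈ S, P s = - ∑ s ∈ S, P s := by
    intro l m h
    rw [Finset.mul_sum, ← Finset.sum_neg_distrib]
    exact Finset.sum_congr rfl fun s hs => he s hs l m h
  have her : ∀ l m, l ≠ m → (∑ s ∈ S, P s) * T (swap (g l) (g m)) = - ∑ s ∈ S, P s := by
    intro l m h
    rw [Finset.sum_mul, ← Finset.sum_neg_distrib]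
    exact Finset.sum_congr rfl fun s hs => he' s hs l m h
  obtain ⟨z, hz, hz'⟩ := sum_pairSwap_eq_smul T hO h1' hg hgD hel her
  have hPe : ∀ s ∈ S, P s * ∑ t ∈ S, P t = P s := by
    classical
    intro s hs
    rw [Finset.mul_sum, Finset.sum_eq_single_of_mem s hs fun t ht hts => (hP s hs t ht).2 hts.symm]
    exact (hP s hs s hs).1 rfl
  have hq : (q.factorial : ℚ) ≠ 0 := by exact_mod_cast q.factorial_ne_zero
  have hsum : (∑ s ∈ S, P s) * (∑ f ∈ injSeq D q, T (pairSwap f g)) * (∑ s ∈ S, P s) =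
      ∑ s ∈ S, (∏ i ∈ Finset.range q, (c s + i)) • P s := by
    rw [mul_assoc, Finset.sum_mul]
    refine Finset.sum_congr rfl fun s hs => ?_
    rw [← mul_assoc, sum_pairSwap_mul T hg hgD (hc s hs) hel, hPe s hs]
  unfold IntFun
  have : ∑ s ∈ S, ((∏ i ∈ Finset.range q, (c s + i)) / q.factorial) • P s = z := by
    have h2 : ∀ s ∈ S, ((∏ i ∈ Finset.range q, (c s + i)) / (q.factorial : ℚ)) • P s =
        (q.factorial : ℚ)⁻¹ • ((∏ i ∈ Finset.range q, (c s + i)) • P s) := fun s _ => by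
      rw [smul_smul, div_eq_inv_mul]
    rw [Finset.sum_congr rfl h2, ← Finset.smul_sum, ← hsum, hz', smul_smul,
      inv_mul_cancel₀ hq, one_smul]
  rwa [this]

end PairSwap

section BlockSwap

open Equiv

variable {B : Type} [Ring B] [Algebra ℚ B] {n : ℕ} {T : Perm (Fin n) →* B}

/-- Transpositions inside a block of equal steps act by `-1` on a path. -/
theorem swap_mul_pathIdem_replicate (hT : KillsSymmetrizers T) {e : ℤ} {q : ℕ} {v : List ℤ}
    (hw : ValidPath (List.replicate q e ++ v)) {a b : Fin n} (hab : a ≠ b)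
    (ha : v.length ≤ a.val) (ha' : a.val < v.length + q) (hb : v.length ≤ b.val)
    (hb' : b.val < v.length + q) :
    T (swap a b) * pathIdem (jmShift T) (List.replicate q e ++ v) =
        - pathIdem (jmShift T) (List.replicate q e ++ v) ∧
    pathIdem (jmShift T) (List.replicate q e ++ v) * T (swap a b) =
        - pathIdem (jmShift T) (List.replicate q e ++ v) := by
  set P := pathIdem (jmShift T) (List.replicate q e ++ v) with hP
  have hadj : ∀ i (hi : i + 1 < n), v.length ≤ i → i + 1 < v.length + q →
      T (swap ⟨i, by omega⟩ ⟨i + 1, hi⟩) * P = - P ∧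
      P * T (swap ⟨i, by omega⟩ ⟨i + 1, hi⟩) = - P := by
    intro i hi h1 h2
    have hsplit : List.replicate q e ++ v =
        List.replicate (q - (i - v.length) - 2) e ++
          e :: e :: (List.replicate (i - v.length) e ++ v) := by
      have : q = (q - (i - v.length) - 2) + (1 + (1 + (i - v.length))) := by omega
      nth_rw 1 [this]
      simp only [List.replicate_add, List.append_assoc]
      rfl
    have hlen : (List.replicate (i - v.length) e ++ v).length = i := by simp; omega
    rw [hP, hsplit]
    rw [hsplit] at hw
    have := swap_succ_mul_pathIdem T hT hw (by omega)
    simpa only [hlen] using this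
  have hlt : ∀ d (a b : Fin n), a.val + d + 1 = b.val → v.length ≤ a.val →
      b.val < v.length + q → T (swap a b) * P = - P ∧ P * T (swap a b) = - P := by
    intro d
    induction d with
    | zero =>
      intro a b h h1 h2
      obtain ⟨b, hb⟩ := b
      simp only [add_zero] at h
      subst h
      exact hadj a hb h1 h2
    | succ d ih =>
      intro a b h h1 h2
      have hc : a.val + d + 1 < n := by omega
      obtain ⟨i1, i2⟩ := ih a ⟨a.val + d + 1, hc⟩ rfl h1 (by simp; omega)
      obtain ⟨j1, j2⟩ := hadj (a.val + d + 1) (by omega) (by omega) (by omega)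
      have hb : b = ⟨a.val + d + 1 + 1, by omega⟩ := Fin.ext (by simp; omega)
      rw [← hb] at j1 j2
      set c : Fin n := ⟨a.val + d + 1, hc⟩
      have hac : a ≠ c := Fin.ne_of_val_ne (by simp [c]; omega)
      have hab : a ≠ b := Fin.ne_of_val_ne (by omega)
      have : swap a b = swap c b * swap a c * swap c b := by
        have := swap_apply_apply (swap c b) a c
        rw [swap_apply_left, swap_apply_of_ne_of_ne hac hab, swap_inv] at this
        exact this
      rw [this, map_mul, map_mul]
      constructor
      · rw [mul_assoc, j1, mul_assoc, mul_neg, i1, neg_neg, j1]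
      · rw [← mul_assoc, ← mul_assoc, j2, neg_mul, i2, neg_neg, j2]
  rcases lt_or_gt_of_ne (Fin.val_ne_of_ne hab) with h | h
  · exact hlt (b.val - a.val - 1) a b (by omega) ha hb'
  · rw [swap_comm]
    exact hlt (a.val - b.val - 1) b a (by omega) hb ha'

/-- The partial Jucys–Murphy sums attached to the letters of a block of equal steps all act by
the first content of the block. -/
theorem pathIdem_mul_sum_swap (hT : KillsSymmetrizers T) {e : ℤ} {q : ℕ} {v : List ℤ}
    (hw : ValidPath (List.replicate q e ++ v)) {y : Fin n}
    (hy : v.length ≤ y.val) (hy' : y.val < v.length + q) :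
    pathIdem (jmShift T) (List.replicate q e ++ v) *
        ∑ b ∈ Finset.univ.filter (fun b : Fin n => b.val < v.length), T (swap b y) =
      ((1 - v.length - e * pathHeight v : ℚ) / 2) •
        pathIdem (jmShift T) (List.replicate q e ++ v) := by
  have hq := quadRel_jmShift T hT
  set P := pathIdem (jmShift T) (List.replicate q e ++ v) with hP
  set N : Fin n := ⟨v.length, by omega⟩ with hN
  have h0 : P * jmSum T N = ((1 - v.length - e * pathHeight v : ℚ) / 2) • P := by
    have hsplit : List.replicate q e ++ v = List.replicate (q - 1) e ++ e :: v := by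
      have : q = (q - 1) + 1 := by omega
      nth_rw 1 [this]
      rw [List.replicate_add, List.append_assoc]
      rfl
    have h1 : jmShift T v.length * P = ((e * pathHeight v : ℤ) : ℚ) • P := by
      rw [hP, hsplit]
      rw [hsplit] at hw
      exact hq.eigen hw (by omega)
    rw [(commute_pathIdem hq.comm _ _).eq, jmShift, dif_pos (by omega), ← hP, mul_sub,
      mul_smul_comm, mul_smul_comm, mul_one] at h1
    push_cast at h1
    linear_combination (norm := module) (-1 / 2 : ℚ) • h1
  by_cases hne : N = y
  · rw [← hne]
    exact h0
  · obtain ⟨s1, s2⟩ := swap_mul_pathIdem_replicate hT hw hne le_rfl (by simp [hN]; omega) hy hy'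
    have hsum : ∑ b ∈ Finset.univ.filter (fun b : Fin n => b.val < v.length), T (swap b y) =
        T (swap N y) * jmSum T N * T (swap N y) := by
      rw [jmSum, Finset.mul_sum, Finset.sum_mul]
      refine Finset.sum_congr rfl fun b hb => ?_
      replace hb : b.val < v.length := (Finset.mem_filter.1 hb).2
      have := swap_apply_apply (swap N y) b N
      rw [swap_apply_left, swap_apply_of_ne_of_ne (Fin.ne_of_val_ne (by simp [hN]; omega))
        (Fin.ne_of_val_ne (by omega)), swap_inv] at this
      rw [this, map_mul, map_mul]
    rw [hsum, ← mul_assoc, ← mul_assoc, s2, neg_mul, h0, neg_mul, smul_mul_assoc, s2, smul_neg,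
      neg_neg]

end BlockSwap

section PathFamilies

open Equiv

/-- Finite families of distinct admissible paths of length `N`. -/
structure PathFamily {ι : Type} (S : Finset ι) (W : ι → List ℤ) (N : ℕ) : Prop where
  inj : Set.InjOn W S
  valid : ∀ s ∈ S, ValidPath (W s)
  length : ∀ s ∈ S, (W s).length = N

/-- The two directions of a step. -/
def stepSigns : Finset ℤ := {1, -1}

/-- Continue each path by `q` equal steps in either direction. -/
def extendPaths {ι : Type} (q : ℕ) (W : ι → List ℤ) (s : ℤ × ι) : List ℤ :=
  List.replicate q s.1 ++ W s.2

theorem mem_stepSigns {e : ℤ} : e ∈ stepSigns ↔ e = 1 ∨ e = -1 := by simp [stepSigns]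

theorem PathFamily.extend {ι : Type} {S : Finset ι} {W : ι → List ℤ} {N q : ℕ}
    (h : PathFamily S W N) (hq : 0 < q) (hM : ∀ s ∈ S, (q : ℤ) ≤ pathHeight (W s)) :
    PathFamily (stepSigns ×ˢ S) (extendPaths q W) (N + q) := by
  refine ⟨?_, ?_, ?_⟩
  · rintro ⟨e, s⟩ hs ⟨e', s'⟩ hs' heq
    simp only [Finset.coe_product, Set.mem_prod, Finset.mem_coe] at hs hs'
    have hlen : (List.replicate q e).length = (List.replicate q e').length := by simp
    obtain ⟨h1, h2⟩ := List.append_inj heq hlen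
    rw [h.inj hs.2 hs'.2 h2]
    simp only [List.replicate_inj, true_and] at h1
    rw [h1.resolve_left (by omega)]
  · rintro ⟨e, s⟩ hs
    rw [Finset.mem_product, mem_stepSigns] at hs
    exact (h.valid s hs.2).replicate_append hs.1 (hM s hs.2)
  · rintro ⟨e, s⟩ hs
    rw [Finset.mem_product] at hs
    simp [extendPaths, h.length s hs.2]
    omega

variable {B : Type} [Ring B] [Algebra ℚ B]

theorem IntFun.reindex {ι κ : Type} {O : Subring B} {S : Finset ι} {S' : Finset κ}
    {P : ι → B} {P' : κ → B} {f : ι → ℚ} {f' : κ → ℚ} (hf : IntFun O S P f) (i : κ → ι)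
    (hi : ∀ k ∈ S', i k ∈ S) (hinj : Set.InjOn i S') (hsurj : ∀ s ∈ S, ∃ k ∈ S', i k = s)
    (hP : ∀ k ∈ S', P' k = P (i k)) (hff : ∀ k ∈ S', f' k = f (i k)) : IntFun O S' P' f' := by
  unfold IntFun at *
  rw [Finset.sum_nbij (g := fun s => f s • P s) i hi hinj (fun s hs => hsurj s hs)
    fun k hk => by rw [hP k hk, hff k hk]]
  exact hf

/-- An order over a `p`-local subring of `ℚ` containing the image of `𝔖_n` in a quotient of the
Temperley–Lieb algebra. -/
structure IntegralRep {n : ℕ} (p : ℕ) (T : Perm (Fin n) →* B) (O : Subring B) (R : Subring ℚ) :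
    Prop where
  kills : KillsSymmetrizers T
  mem : ∀ w, T w ∈ O
  smul_mem : ∀ c ∈ R, ∀ x ∈ O, c • x ∈ O
  inv_mem : ∀ z : ℤ, ¬ (p : ℤ) ∣ z → (z : ℚ)⁻¹ ∈ R
  prime : p.Prime
  odd : 2 < p

variable {n p : ℕ} {T : Perm (Fin n) →* B} {O : Subring B} {R : Subring ℚ}

theorem IntegralRep.jmShift_mem (h : IntegralRep p T O R) (N : ℕ) : jmShift T N ∈ O := by
  unfold jmShift
  split_ifs with hN
  · refine O.sub_mem (h.smul_mem _ ?_ _ O.one_mem) (h.smul_mem _ ?_ _ (O.sum_mem fun _ _ => h.mem _))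
    · exact R.sub_mem R.one_mem (natCast_mem R N)
    · exact ofNat_mem R 2
  · exact O.zero_mem

theorem IntegralRep.orthFam (h : IntegralRep p T O R) {ι : Type} {S : Finset ι} {W : ι → List ℤ}
    {N : ℕ} (hS : PathFamily S W N) (hN : N ≤ n) :
    OrthFam S (fun s => pathIdem (jmShift T) (W s)) :=
  (quadRel_jmShift T h.kills).orthFam hN hS.inj fun s hs => ⟨hS.valid s hs, hS.length s hs⟩

theorem IntegralRep.risingFactorial (h : IntegralRep p T O R) {ι : Type} {S : Finset ι}
    {W : ι → List ℤ} {N q : ℕ} (hS : PathFamily S W N) (hq : 0 < q)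
    (hM : ∀ s ∈ S, (q : ℤ) ≤ pathHeight (W s)) (hn : N + q ≤ n)
    (h1 : IntFun O (stepSigns ×ˢ S) (fun s => pathIdem (jmShift T) (extendPaths q W s)) 1) :
    IntFun O (stepSigns ×ˢ S) (fun s => pathIdem (jmShift T) (extendPaths q W s)) fun s =>
      (∏ i ∈ Finset.range q, ((1 - N - s.1 * pathHeight (W s.2) : ℚ) / 2 + i)) / q.factorial := by
  have hS' := hS.extend hq hM
  let g : Fin q → Fin n := fun l => ⟨N + l.val, by omega⟩
  have hg : g.Injective := fun a b hab => by
    have := Fin.val_eq_of_eq hab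
    exact Fin.ext (by simpa [g] using this)
  refine IntFun.risingFactorial T (D := Finset.univ.filter fun b : Fin n => b.val < N) h.mem
    (h.orthFam hS' hn) h1 hg (fun l => by simp [g]) ?_ ?_ ?_
  · intro s hs l
    have hs' := Finset.mem_product.1 hs
    have hlen := hS.length s.2 hs'.2
    have := pathIdem_mul_sum_swap h.kills (hS'.valid s hs) (y := g l)
      (by simp [g, hlen]) (by simp [g, hlen])
    rw [hlen] at this
    exact this
  · intro s hs l m hlm
    have hs' := Finset.mem_product.1 hs
    have hlen := hS.length s.2 hs'.2
    exact (swap_mul_pathIdem_replicate h.kills (hS'.valid s hs) (hg.ne hlm) (by simp [g, hlen])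
      (by simp [g, hlen]) (by simp [g, hlen]) (by simp [g, hlen])).1
  · intro s hs l m hlm
    have hs' := Finset.mem_product.1 hs
    have hlen := hS.length s.2 hs'.2
    exact (swap_mul_pathIdem_replicate h.kills (hS'.valid s hs) (hg.ne hlm) (by simp [g, hlen])
      (by simp [g, hlen]) (by simp [g, hlen]) (by simp [g, hlen])).2

/-- A single step from positive height preserves integrality. -/
theorem IntegralRep.one_step (h : IntegralRep p T O R) {ι : Type} {S : Finset ι}
    {W : ι → List ℤ} {N : ℕ} (hS : PathFamily S W N) (hM : ∀ s ∈ S, 0 < pathHeight (W s))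
    (hn : N + 1 ≤ n) (h1 : IntFun O S (fun s => pathIdem (jmShift T) (W s)) 1) :
    IntFun O (stepSigns ×ˢ S) (fun s => pathIdem (jmShift T) (extendPaths 1 W s)) 1 ∧
    IntFun O (stepSigns ×ˢ S) (fun s => pathIdem (jmShift T) (extendPaths 1 W s))
      fun s => s.1 * pathHeight (W s.2) := by
  have hq := quadRel_jmShift T h.kills
  have hS' := hS.extend one_pos (by exact_mod_cast hM)
  have e1 : IntFun O (stepSigns ×ˢ S) (fun s => pathIdem (jmShift T) (extendPaths 1 W s)) 1 := by
    unfold IntFun at *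
    rw [Finset.sum_product_right]
    rw [← Finset.sum_congr rfl fun s hs => ?_] at h1
    · exact h1
    · simp only [stepSigns, Finset.sum_pair (show (1 : ℤ) ≠ -1 by norm_num), Pi.one_apply, one_smul]
      exact pathIdem_split 1 (W s) (hM s hs)
  refine ⟨e1, ?_⟩
  unfold IntFun at *
  have := O.mul_mem (h.jmShift_mem N) e1
  rw [Finset.mul_sum] at this
  rw [Finset.sum_congr rfl fun s hs => ?_]
  · exact this
  · have hs' := Finset.mem_product.1 hs
    have hlen := hS.length s.2 hs'.2
    have := hq.eigen (u := []) (e := s.1) (v := W s.2) (hS'.valid s hs) (by omega)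
    rw [hlen] at this
    rw [Pi.one_apply, one_smul]
    refine Eq.trans ?_ this.symm
    push_cast
    rfl

end PathFamilies

section Steps

open Equiv

variable {B : Type} [Ring B] [Algebra ℚ B] {n p : ℕ} {T : Perm (Fin n) →* B} {O : Subring B}
  {R : Subring ℚ}

/-- Steps of length `Q` from heights divisible by `Q` preserve integrality. -/
def StepIntegral (T : Perm (Fin n) →* B) (O : Subring B) (Q : ℕ) : Prop :=
  ∀ {ι : Type} (S : Finset ι) (W : ι → List ℤ) (N : ℕ), PathFamily S W N →
    (∀ s ∈ S, 0 < pathHeight (W s) ∧ (Q : ℤ) ∣ pathHeight (W s)) → Q ∣ N + 1 → N + Q ≤ n →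
    IntFun O S (fun s => pathIdem (jmShift T) (W s)) 1 →
    IntFun O S (fun s => pathIdem (jmShift T) (W s)) (fun s => ((pathHeight (W s) : ℚ) / Q) ^ 2) →
    IntFun O (stepSigns ×ˢ S) (fun s => pathIdem (jmShift T) (extendPaths Q W s)) 1 ∧
    IntFun O (stepSigns ×ˢ S) (fun s => pathIdem (jmShift T) (extendPaths Q W s))
      (fun s => s.1 * pathHeight (W s.2) / Q)

theorem IntegralRep.multi_step (h : IntegralRep p T O R) {Q : ℕ} (hQ : 0 < Q)
    (hstep : StepIntegral T O Q) {ι : Type} {S : Finset ι} {W : ι → List ℤ} {N : ℕ}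
    (hS : PathFamily S W N)
    (hM : ∀ s ∈ S, 0 < pathHeight (W s) ∧ ((p * Q : ℕ) : ℤ) ∣ pathHeight (W s)) (hN : Q ∣ N + 1)
    (h1 : IntFun O S (fun s => pathIdem (jmShift T) (W s)) 1)
    (h2 : IntFun O S (fun s => pathIdem (jmShift T) (W s))
      (fun s => ((pathHeight (W s) : ℚ) / Q) ^ 2)) {b : ℕ} (hb : 1 ≤ b) (hbp : b ≤ p)
    (hn : N + b * Q ≤ n) :
    IntFun O (stepSigns ×ˢ S) (fun s => pathIdem (jmShift T) (extendPaths (b * Q) W s)) 1 ∧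
    IntFun O (stepSigns ×ˢ S) (fun s => pathIdem (jmShift T) (extendPaths (b * Q) W s))
      (fun s => s.1 * pathHeight (W s.2) / Q) := by
  have hQ0 : (Q : ℚ) ≠ 0 := by exact_mod_cast hQ.ne'
  induction b, hb using Nat.le_induction with
  | base =>
    rw [one_mul] at hn ⊢
    exact hstep S W N hS (fun s hs => ⟨(hM s hs).1,
      (Int.natCast_dvd_natCast.2 (dvd_mul_left Q p)).trans (hM s hs).2⟩) hN hn h1 h2
  | succ b hb ih =>
    have hn' : N + b * Q ≤ n := by rw [add_mul] at hn; omega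
    obtain ⟨i1, i2⟩ := ih (by omega) hn'
    have hle : ∀ s ∈ S, ((p * Q : ℕ) : ℤ) ≤ pathHeight (W s) := fun s hs =>
      Int.le_of_dvd (hM s hs).1 (hM s hs).2
    have hbQ : b * Q < p * Q := Nat.mul_lt_mul_of_pos_right (by omega) hQ
    have hS' := hS.extend (q := b * Q) (by positivity) fun s hs => by
      have := hle s hs
      omega
    have hht : ∀ s : ℤ × ι, pathHeight (extendPaths (b * Q) W s) =
        pathHeight (W s.2) + (b * Q : ℕ) * s.1 := fun s => pathHeight_replicate_append _ _ _
    have hsq : ∀ s ∈ stepSigns ×ˢ S, (s.1 : ℚ) * s.1 = 1 := by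
      intro s hs
      rcases mem_stepSigns.1 (Finset.mem_product.1 hs).1 with h | h <;> rw [h] <;> norm_num
    have hort := h.orthFam hS' hn'
    obtain ⟨j1, j2⟩ := hstep (stepSigns ×ˢ S) (extendPaths (b * Q) W) (N + b * Q) hS'
      (fun s hs => by
        have hs' := Finset.mem_product.1 hs
        have := hle s.2 hs'.2
        rw [hht]
        constructor
        · rcases mem_stepSigns.1 hs'.1 with h | h <;> rw [h] <;> omega
        · refine dvd_add ((Int.natCast_dvd_natCast.2 (dvd_mul_left Q p)).trans (hM _ hs'.2).2) ?_
          exact Dvd.dvd.mul_right (Int.natCast_dvd_natCast.2 (dvd_mul_left Q b)) _)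
      (by
        have : N + b * Q + 1 = (N + 1) + b * Q := by ring
        rw [this]
        exact dvd_add hN (dvd_mul_left _ _))
      (by rw [add_mul] at hn; omega) i1
      (by
        have e1 := (i2.mul hort i2).add ((i2.const_mul h.smul_mem (c := 2 * b)
          (R.mul_mem (ofNat_mem R 2) (natCast_mem R b))).add
          (IntFun.const h.smul_mem (pow_mem (natCast_mem R b) 2) i1))
        refine e1.congr fun s hs => ?_
        rw [hht]
        push_cast
        have := hsq s hs
        field_simp
        linear_combination ((pathHeight (W s.2) : ℚ) ^ 2 - (b * Q) ^ 2) * this)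
    have hS'' := hS'.extend (q := Q) hQ fun s hs => by
      have hs' := Finset.mem_product.1 hs
      have h3 := hle s.2 hs'.2
      have h4 : b * Q + Q ≤ p * Q := by
        rw [← Nat.succ_mul]; exact Nat.mul_le_mul_right _ hbp
      rw [hht]
      rcases mem_stepSigns.1 hs'.1 with h | h <;> rw [h] <;> omega
    have hort' := h.orthFam hS'' (by rw [add_mul] at hn; omega)
    let y : ℤ × ℤ × ι → ℤ := fun s => s.1 * (pathHeight (W s.2.2) / Q + b * s.2.1)
    have hdiv : ∀ s ∈ S, ((pathHeight (W s) / Q : ℤ) : ℚ) = pathHeight (W s) / Q := by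
      intro s hs
      obtain ⟨z, hz⟩ := (hM s hs).2
      rw [hz]
      push_cast
      rw [mul_comm (p : ℤ), mul_assoc, Int.mul_ediv_cancel_left _ (by exact_mod_cast hQ.ne')]
      push_cast
      field_simp
    have hy : ∀ s ∈ stepSigns ×ˢ stepSigns ×ˢ S,
        (y s : ℚ) = s.1 * pathHeight (extendPaths (b * Q) W s.2) / Q := by
      intro s hs
      simp only [Finset.mem_product] at hs
      simp only [y]
      rw [hht]
      push_cast
      rw [hdiv _ hs.2.2]
      field_simp
    have hyI := j2.congr fun s hs => (hy s hs).symm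
    have hind := IntFun.indicator h.smul_mem h.prime h.inv_mem hort' j1 y hyI b
    have hiff : ∀ s ∈ stepSigns ×ˢ stepSigns ×ˢ S, ((p : ℤ) ∣ y s - b ↔ s.1 = s.2.1) := by
      intro s hs
      simp only [Finset.mem_product, mem_stepSigns] at hs
      obtain ⟨z, hz⟩ := (hM _ hs.2.2).2
      have hz' : pathHeight (W s.2.2) / Q = p * z := by
        rw [hz]
        push_cast
        rw [mul_comm (p : ℤ), mul_assoc, Int.mul_ediv_cancel_left _ (by exact_mod_cast hQ.ne')]
      have hp' : Prime (p : ℤ) := Nat.prime_iff_prime_int.mp h.prime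
      have hndvd : ¬ (p : ℤ) ∣ 2 * b := by
        intro hd
        rcases hp'.dvd_or_dvd hd with hd | hd
        · have := Int.le_of_dvd (by norm_num) hd
          have := h.odd
          omega
        · have := Int.le_of_dvd (by exact_mod_cast hb) hd
          omega
      simp only [y, hz']
      rcases hs.1 with h3 | h3 <;> rcases hs.2.1 with h4 | h4 <;> rw [h3, h4]
      · simp
      · refine iff_of_false (fun hd => hndvd ?_) (by norm_num)
        obtain ⟨w, hw⟩ := hd
        exact ⟨z - w, by linear_combination -hw⟩
      · refine iff_of_false (fun hd => hndvd ?_) (by norm_num)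
        obtain ⟨w, hw⟩ := hd
        exact ⟨-z - w, by linear_combination -hw⟩
      · refine iff_of_true ⟨-z, ?_⟩ rfl
        ring
    have hre : ∀ {f : ℤ × ℤ × ι → ℚ} {f' : ℤ × ι → ℚ},
        IntFun O (stepSigns ×ˢ stepSigns ×ˢ S)
          (fun s => pathIdem (jmShift T) (extendPaths Q (extendPaths (b * Q) W) s)) f →
        (∀ s ∈ stepSigns ×ˢ S, f' s = f (s.1, s)) →
        IntFun O (stepSigns ×ˢ S)
          (fun s => pathIdem (jmShift T) (extendPaths ((b + 1) * Q) W s)) f' := by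
      intro f f' hf hff
      refine (IntFun.restrict hort' hind hf).reindex (fun s => (s.1, s)) ?_ ?_ ?_ ?_ hff
      · intro s hs
        have hs' := Finset.mem_product.1 hs
        have : (s.1, s) ∈ stepSigns ×ˢ stepSigns ×ˢ S := Finset.mem_product.2 ⟨hs'.1, hs⟩
        rw [Finset.mem_filter]
        exact ⟨this, (hiff _ this).2 rfl⟩
      · intro s _ t _ hst
        exact congrArg Prod.snd hst
      · rintro ⟨e, s⟩ hs
        rw [Finset.mem_filter] at hs
        have := (hiff _ hs.1).1 hs.2
        simp only at this
        exact ⟨s, (Finset.mem_product.1 hs.1).2, by rw [this]⟩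
      · intro s _
        simp only [extendPaths]
        rw [← List.append_assoc, ← List.replicate_add]
        congr 3
        ring
    refine ⟨hre j1 fun _ _ => rfl, ?_⟩
    refine hre (j2.sub (IntFun.const h.smul_mem (natCast_mem R b) j1)) fun s hs => ?_
    have := hsq s hs
    simp only [hht]
    push_cast
    field_simp
    linear_combination (-(b : ℚ) * Q) * this

end Steps

section PowerSteps

open Equiv

theorem exists_eq_pow_mul_of_lt {p i l : ℕ} (hp : p.Prime) (hl : 0 < l) (hli : l < p ^ (i + 1)) :
    ∃ v m, l = p ^ v * m ∧ ¬ p ∣ m ∧ v ≤ i := by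
  obtain ⟨v, m, hm, rfl⟩ := Nat.exists_eq_pow_mul_and_not_dvd hl.ne' p hp.ne_one
  refine ⟨v, m, rfl, hm, ?_⟩
  by_contra! hv
  have h1 : p ^ (i + 1) ≤ p ^ v := Nat.pow_le_pow_right hp.pos hv
  have h2 : p ^ v ≤ p ^ v * m := Nat.le_mul_of_pos_right _ (Nat.pos_of_mul_pos_left hl)
  omega

theorem prod_rising_div_factorial (q : ℕ) (hq : 0 < q) (θ : ℚ) :
    (∏ i ∈ Finset.range q, (1 - q * θ + i)) / q.factorial =
      (∏ l ∈ Finset.range (q - 1), (1 - q * θ / (l + 1))) * (1 - θ) := by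
  obtain ⟨r, rfl⟩ : ∃ r, q = r + 1 := ⟨q - 1, by omega⟩
  have h1 : ∀ m : ℕ, (∏ i ∈ Finset.range m, (1 - (r + 1 : ℕ) * θ + i)) / m.factorial =
      ∏ l ∈ Finset.range m, (1 - (r + 1 : ℕ) * θ / (l + 1)) := by
    intro m
    rw [← Finset.prod_range_add_one_eq_factorial]
    push_cast
    rw [← Finset.prod_div_distrib]
    refine Finset.prod_congr rfl fun l _ => ?_
    have : (l : ℚ) + 1 ≠ 0 := by positivity
    field_simp
    ring
  rw [h1, Finset.prod_range_succ, Nat.add_sub_cancel]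
  congr 1
  have : (r : ℚ) + 1 ≠ 0 := by positivity
  push_cast
  field_simp

variable {B : Type} [Ring B] [Algebra ℚ B] {n p : ℕ} {T : Perm (Fin n) →* B} {O : Subring B}
  {R : Subring ℚ}

theorem IntegralRep.two_mul_inv_mem (h : IntegralRep p T O R) {m : ℕ} (hm : ¬ p ∣ m) :
    (2 * m : ℚ)⁻¹ ∈ R := by
  have := h.inv_mem (2 * m : ℕ) fun hd => by
    rcases h.prime.dvd_mul.1 (Int.natCast_dvd_natCast.1 hd) with h2 | h2
    · have := Nat.le_of_dvd (by norm_num) h2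
      have := h.odd
      omega
    · exact hm h2
  simpa using this

/-- The factors `1 - p^(i+1) θ / l`, `0 < l < p^(i+1)`, are `p`-local units. -/
theorem IntegralRep.factor_unit (h : IntegralRep p T O R) {i l : ℕ} (hl : 0 < l)
    (hli : l < p ^ (i + 1)) (z : ℤ) :
    (p : ℚ) ^ i / (2 * l) ∈ R ∧ 1 - (p : ℚ) ^ i / (2 * l) * (p * z) ≠ 0 ∧
      1 - (p : ℚ) ^ i / (2 * l) * (p * z) ∈ R ∧ (1 - (p : ℚ) ^ i / (2 * l) * (p * z))⁻¹ ∈ R := by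
  obtain ⟨v, m, rfl, hm, hv⟩ := exists_eq_pow_mul_of_lt h.prime hl hli
  have hp0 : (p : ℚ) ≠ 0 := by exact_mod_cast h.prime.ne_zero
  have hm0 : (m : ℚ) ≠ 0 := by
    rintro h0
    exact hm (by rw [Nat.cast_eq_zero.1 h0]; exact dvd_zero p)
  have h1 : (p : ℚ) ^ i / (2 * (p ^ v * m : ℕ)) = p ^ (i - v) * (2 * m : ℚ)⁻¹ := by
    have : (p : ℚ) ^ i = p ^ (i - v) * p ^ v := by rw [← pow_add]; congr 1; omega
    rw [this]
    push_cast
    field_simp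
  have h2 : 1 - (p : ℚ) ^ i / (2 * (p ^ v * m : ℕ)) * (p * z) =
      ((2 * m - p ^ (i - v) * (p * z) : ℤ) : ℚ) * (2 * m : ℚ)⁻¹ := by
    rw [h1]
    push_cast
    field_simp
  have hz : ¬ (p : ℤ) ∣ 2 * m - p ^ (i - v) * (p * z) := by
    intro hd
    have h3 : (p : ℤ) ∣ 2 * m := by
      have := dvd_add hd (Dvd.intro_left ((p : ℤ) ^ (i - v) * z)
        (by ring : (p : ℤ) ^ (i - v) * z * p = p ^ (i - v) * (p * z)))
      simpa using this
    rcases h.prime.dvd_mul.1 (Int.natCast_dvd_natCast.1 (by exact_mod_cast h3 :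
      ((p : ℕ) : ℤ) ∣ ((2 * m : ℕ) : ℤ))) with h2 | h2
    · have := Nat.le_of_dvd (by norm_num) h2
      have := h.odd
      omega
    · exact hm h2
  have hinv := h.two_mul_inv_mem hm
  rw [h2]
  refine ⟨?_, ?_, ?_, ?_⟩
  · rw [h1]
    exact R.mul_mem (pow_mem (natCast_mem R p) _) hinv
  · refine mul_ne_zero (Int.cast_ne_zero.2 fun h0 => hz (h0 ▸ dvd_zero _)) ?_
    positivity
  · exact R.mul_mem (intCast_mem R _) hinv
  · rw [mul_inv, inv_inv]
    exact R.mul_mem (h.inv_mem _ hz) (R.mul_mem (ofNat_mem R 2) (natCast_mem R m))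

theorem IntegralRep.stepIntegral_pow (h : IntegralRep p T O R) (i : ℕ) :
    StepIntegral T O (p ^ i) := by
  induction i with
  | zero =>
    intro ι S W N hS hM _ hn h1 _
    have := h.one_step hS (fun s hs => (hM s hs).1) (by simpa using hn) h1
    simpa using this
  | succ i ih =>
    intro ι S W N hS hM hN hn h1 h2
    have hp0 : (p : ℚ) ≠ 0 := by exact_mod_cast h.prime.ne_zero
    have hQ : 0 < p ^ i := pow_pos h.prime.pos i
    have hq : 0 < p ^ (i + 1) := pow_pos h.prime.pos _
    have hle : ∀ s ∈ S, ((p ^ (i + 1) : ℕ) : ℤ) ≤ pathHeight (W s) := fun s hs =>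
      Int.le_of_dvd (hM s hs).1 (hM s hs).2
    obtain ⟨I1, I2⟩ := h.multi_step hQ ih hS
      (fun s hs => by rw [← pow_succ']; exact hM s hs)
      ((pow_dvd_pow p (Nat.le_succ i)).trans hN) h1
      ((h2.const_mul h.smul_mem (c := p ^ 2) (pow_mem (natCast_mem R p) 2)).congr fun s _ => by
        push_cast
        field_simp
        ring)
      h.prime.one_lt.le le_rfl (by rw [← pow_succ']; exact hn)
    rw [← pow_succ'] at I1 I2
    refine ⟨I1, ?_⟩
    have hort := h.orthFam (hS.extend hq hle) hn
    have hrf := h.risingFactorial hS hq hle hn I1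
    obtain ⟨m, hm⟩ := hN
    have hN' : (N : ℚ) = p ^ (i + 1) * m - 1 := by
      have : ((N + 1 : ℕ) : ℚ) = (p ^ (i + 1) * m : ℕ) := by rw [hm]
      push_cast at this
      linarith
    set θ : ℤ × ι → ℚ := fun s => (m + s.1 * pathHeight (W s.2) / (p ^ (i + 1) : ℕ)) / 2 with hθ
    have hpi : ((p : ℚ) ^ (i + 1)) ≠ 0 := pow_ne_zero _ hp0
    have hθc : ∀ s : ℤ × ι, (1 - N - s.1 * pathHeight (W s.2) : ℚ) / 2 =
        1 - (p ^ (i + 1) : ℕ) * θ s := by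
      intro s
      simp only [hθ, hN']
      push_cast
      field_simp
      ring
    have hz : ∀ s ∈ stepSigns ×ˢ S, ∃ z : ℤ, 2 * θ s = z := by
      intro s hs
      obtain ⟨y, hy⟩ := (hM s.2 (Finset.mem_product.1 hs).2).2
      refine ⟨m + s.1 * y, ?_⟩
      simp only [hθ, hy]
      push_cast
      field_simp
    have hfac : ∀ (l : ℕ) (s : ℤ × ι), 1 - ((p ^ (i + 1) : ℕ) : ℚ) * θ s / (l + 1) =
        1 - (p : ℚ) ^ i / (2 * (l + 1 : ℕ)) * (p * (2 * θ s)) := by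
      intro l s
      have : (l : ℚ) + 1 ≠ 0 := by positivity
      push_cast
      rw [pow_succ]
      field_simp
    have hUint : IntFun O (stepSigns ×ˢ S)
        (fun s => pathIdem (jmShift T) (extendPaths (p ^ (i + 1)) W s))
        (fun s => ∏ l ∈ Finset.range (p ^ (i + 1) - 1),
          (1 - ((p ^ (i + 1) : ℕ) : ℚ) * θ s / (l + 1))) := by
      refine IntFun.prod hort I1 _ _ fun l hl => ?_
      rw [Finset.mem_range] at hl
      have hκ := (h.factor_unit (i := i) (l := l + 1) (by omega) (by omega) 0).1
      refine ((IntFun.const h.smul_mem R.one_mem I1).sub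
        (((IntFun.const h.smul_mem (natCast_mem R (p * m)) I1).add I2).const_mul
          h.smul_mem hκ)).congr fun s hs => ?_
      rw [hfac]
      congr 2
      simp only [hθ]
      push_cast
      rw [pow_succ]
      field_simp
    have hU : ∀ s ∈ stepSigns ×ˢ S, ∀ l ∈ Finset.range (p ^ (i + 1) - 1),
        1 - ((p ^ (i + 1) : ℕ) : ℚ) * θ s / (l + 1) ≠ 0 ∧
        1 - ((p ^ (i + 1) : ℕ) : ℚ) * θ s / (l + 1) ∈ R ∧
        (1 - ((p ^ (i + 1) : ℕ) : ℚ) * θ s / (l + 1))⁻¹ ∈ R := by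
      intro s hs l hl
      rw [Finset.mem_range] at hl
      obtain ⟨z, hz⟩ := hz s hs
      rw [hfac, hz]
      exact (h.factor_unit (i := i) (l := l + 1) (by omega) (by omega) z).2
    have hU0 := fun s hs => Finset.prod_ne_zero_iff.2 fun l hl => (hU s hs l hl).1
    have hUinv := IntFun.inv h.smul_mem hort I1 hUint
      (fun s hs => R.prod_mem fun l hl => (hU s hs l hl).2.1)
      (fun s hs => by
        rw [← Finset.prod_inv_distrib]
        exact R.prod_mem fun l hl => (hU s hs l hl).2.2) hU0
    have hone := (hrf.mul hort hUinv).congr (g := fun s => 1 - θ s) fun s hs => by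
      rw [hθc, prod_rising_div_factorial _ hq, mul_assoc, mul_comm (1 - θ s), ← mul_assoc,
        mul_inv_cancel₀ (hU0 s hs), one_mul]
    refine ((IntFun.const h.smul_mem (c := 2 - m) (R.sub_mem (ofNat_mem R 2) (natCast_mem R m))
      I1).sub (hone.const_mul h.smul_mem (ofNat_mem R 2))).congr fun s hs => ?_
    simp only [hθ]
    ring

end PowerSteps

section DigitFamilies

open Equiv

variable {B : Type} [Ring B] [Algebra ℚ B] {n p : ℕ} {T : Perm (Fin n) →* B} {O : Subring B}
  {R : Subring ℚ}

theorem validPath_replicate_one (r : ℕ) : ValidPath (List.replicate r 1) := by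
  induction r with
  | zero => exact trivial
  | succ r ih =>
    refine ⟨ih, ?_, Or.inl rfl⟩
    simp only [pathHeight, List.sum_replicate, nsmul_eq_mul, mul_one]
    omega

theorem pathHeight_replicate_one {r : ℕ} (hr : 1 ≤ r) :
    pathHeight (List.replicate (r - 1) 1) = r := by
  simp only [pathHeight, List.sum_replicate, nsmul_eq_mul, mul_one]
  omega

theorem IntegralRep.pathIdem_column_step (h : IntegralRep p T O R) {b i : ℕ} (hb : 1 ≤ b)
    (hbp : b < p) (hn : (b + 1) * p ^ i - 1 ≤ n)
    (hO : pathIdem (jmShift T) (List.replicate (b * p ^ i - 1) 1) ∈ O) :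
    pathIdem (jmShift T) (List.replicate ((b + 1) * p ^ i - 1) 1) ∈ O := by
  have hQ : 0 < p ^ i := pow_pos h.prime.pos i
  have hbQ : 1 ≤ b * p ^ i := Nat.mul_pos hb hQ
  have hlen : (b + 1) * p ^ i - 1 = p ^ i + (b * p ^ i - 1) := by
    rw [add_mul, one_mul]; omega
  set W : Unit → List ℤ := fun _ => List.replicate (b * p ^ i - 1) 1 with hW
  have hht := pathHeight_replicate_one hbQ
  have hpos : 0 < pathHeight (List.replicate (b * p ^ i - 1) 1) := by
    rw [hht]; exact_mod_cast hbQ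
  have hS : PathFamily {()} W (b * p ^ i - 1) :=
    ⟨fun _ _ _ _ _ => rfl, fun _ _ => validPath_replicate_one _, fun _ _ => by simp [hW]⟩
  have h1 : IntFun O {()} (fun s => pathIdem (jmShift T) (W s)) 1 := by
    simpa [IntFun, hW] using hO
  have hQ0 : ((p ^ i : ℕ) : ℚ) ≠ 0 := by exact_mod_cast hQ.ne'
  obtain ⟨i1, i2⟩ := h.stepIntegral_pow i {()} W _ hS
    (fun s _ => ⟨hpos, by rw [hW, hht]; push_cast; exact dvd_mul_left _ _⟩)
    (by rw [Nat.sub_add_cancel hbQ]; exact dvd_mul_left _ _) (by omega) h1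
    ((h1.const h.smul_mem (c := b ^ 2) (pow_mem (natCast_mem R b) 2)).congr fun s _ => by
      rw [hW, hht]
      push_cast at hQ0 ⊢
      field_simp)
  have hinv : ((2 * b : ℤ) : ℚ)⁻¹ ∈ R := by
    refine h.inv_mem _ fun hd => ?_
    rcases (Nat.prime_iff_prime_int.1 h.prime).dvd_or_dvd hd with hd | hd
    · have := Int.le_of_dvd (by norm_num) hd
      have := h.odd
      omega
    · exact absurd (Nat.le_of_dvd hb (Int.natCast_dvd_natCast.1 hd)) (by omega)
  have hb0 : (b : ℚ) ≠ 0 := by exact_mod_cast (by omega : b ≠ 0)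
  have key := ((i1.const h.smul_mem (natCast_mem R b)).add i2).const_mul h.smul_mem hinv
  unfold IntFun at key
  rw [Finset.sum_product_right, Finset.sum_singleton, stepSigns,
    Finset.sum_pair (show (1 : ℤ) ≠ -1 by norm_num)] at key
  simp only [hW, hht, extendPaths, ← List.replicate_add, ← hlen] at key
  push_cast at key hQ0
  have e1 : (2 * (b : ℚ))⁻¹ * (b + 1 * (b * p ^ i) / p ^ i) = 1 := by field_simp; norm_num
  have e2 : (2 * (b : ℚ))⁻¹ * (b + -1 * (b * p ^ i) / p ^ i) = 0 := by field_simp; norm_num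
  rw [e1, e2, one_smul, zero_smul, add_zero] at key
  exact key

/-- The integrality of the Jones–Wenzl projectors on `b pⁱ - 1` strands for `1 ≤ b ≤ p`. -/
theorem IntegralRep.pathIdem_column_mem (h : IntegralRep p T O R) (i : ℕ) {b : ℕ} (hb : 1 ≤ b)
    (hbp : b ≤ p) (hn : b * p ^ i - 1 ≤ n) :
    pathIdem (jmShift T) (List.replicate (b * p ^ i - 1) 1) ∈ O := by
  induction i generalizing b with
  | zero =>
    induction b, hb using Nat.le_induction with
    | base => simp [pathIdem]
    | succ b hb ih =>
      exact h.pathIdem_column_step hb (by omega) hn (ih (by omega) (by simp at hn ⊢; omega))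
  | succ i ihi =>
    induction b, hb using Nat.le_induction with
    | base =>
      rw [one_mul, pow_succ'] at hn ⊢
      exact ihi h.prime.one_lt.le le_rfl hn
    | succ b hb ih =>
      refine h.pathIdem_column_step hb (by omega) hn (ih (by omega) ?_)
      rw [add_mul] at hn
      omega

/-- A finite set of paths of length `N` whose heights are divisible by `Q`, for which the sum of
the projections and the quadratic Casimir of the heights are integral. -/
structure LevelIntegral (T : Perm (Fin n) →* B) (O : Subring B) (D : Finset (List ℤ))
    (N Q : ℕ) : Prop where
  family : PathFamily D id N
  pos : ∀ w ∈ D, 0 < pathHeight w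
  dvd : ∀ w ∈ D, (Q : ℤ) ∣ pathHeight w
  dvd_succ : Q ∣ N + 1
  one : IntFun O D (pathIdem (jmShift T)) 1
  sq : IntFun O D (pathIdem (jmShift T)) fun w => ((pathHeight w : ℚ) / Q) ^ 2

theorem intFun_image_iff {ι κ : Type} [DecidableEq κ] {S : Finset ι} {W : ι → κ} {P : κ → B}
    {f : κ → ℚ} (hW : Set.InjOn W S) :
    IntFun O (S.image W) P f ↔ IntFun O S (fun s => P (W s)) fun s => f (W s) := by
  unfold IntFun
  rw [Finset.sum_image hW]

theorem LevelIntegral.extend (h : IntegralRep p T O R) {D : Finset (List ℤ)} {N i b : ℕ}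
    (hD : LevelIntegral T O D N (p ^ (i + 1))) (hb : b < p) (hn : N + b * p ^ i ≤ n) :
    LevelIntegral T O ((stepSigns ×ˢ D).image (extendPaths (b * p ^ i) id)) (N + b * p ^ i)
      (p ^ i) := by
  have hp0 : (p : ℚ) ≠ 0 := by exact_mod_cast h.prime.ne_zero
  have hQ : 0 < p ^ i := pow_pos h.prime.pos i
  have hdvd : p ^ i ∣ p ^ (i + 1) := pow_dvd_pow p (Nat.le_succ i)
  have hsq : IntFun O D (pathIdem (jmShift T)) fun w => ((pathHeight w : ℚ) / (p ^ i : ℕ)) ^ 2 :=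
    (hD.sq.const_mul h.smul_mem (c := p ^ 2) (pow_mem (natCast_mem R p) 2)).congr fun s _ => by
      push_cast
      field_simp
      ring
  rcases Nat.eq_zero_or_pos b with rfl | hb1
  · have himg : (stepSigns ×ˢ D).image (extendPaths (0 * p ^ i) id) = D := by
      ext w
      simp only [Finset.mem_image, Finset.mem_product, extendPaths, zero_mul, Prod.exists,
        List.replicate_zero, List.nil_append, id]
      exact ⟨fun ⟨_, _, h, e⟩ => e ▸ h.2, fun hw => ⟨1, w, ⟨mem_stepSigns.2 (Or.inl rfl), hw⟩, rfl⟩⟩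
    rw [himg, zero_mul, add_zero]
    exact ⟨hD.family, hD.pos, fun w hw => (Int.natCast_dvd_natCast.2 hdvd).trans (hD.dvd w hw),
      hdvd.trans hD.dvd_succ, hD.one, hsq⟩
  have hq : 0 < b * p ^ i := Nat.mul_pos hb1 hQ
  have hlt : ∀ w ∈ D, ((b * p ^ i : ℕ) : ℤ) < pathHeight w := fun w hw =>
    lt_of_lt_of_le (by rw [pow_succ']; exact_mod_cast Nat.mul_lt_mul_of_pos_right hb hQ)
      (Int.le_of_dvd (hD.pos w hw) (hD.dvd w hw))
  have hext := hD.family.extend hq fun w hw => (hlt w hw).le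
  have hort := h.orthFam hext hn
  obtain ⟨i1, i2⟩ := h.multi_step hQ (h.stepIntegral_pow i) hD.family
    (fun w hw => ⟨hD.pos w hw, by rw [← pow_succ']; exact hD.dvd w hw⟩)
    (hdvd.trans hD.dvd_succ) hD.one hsq hb1 hb.le hn
  have hheight : ∀ s : ℤ × List ℤ, pathHeight (extendPaths (b * p ^ i) id s) =
      pathHeight s.2 + (b * p ^ i : ℕ) * s.1 := fun s => pathHeight_replicate_append _ _ _
  refine ⟨⟨Function.injective_id.injOn, ?_, ?_⟩, ?_, ?_, ?_, ?_, ?_⟩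
  · intro w hw
    obtain ⟨s, hs, rfl⟩ := Finset.mem_image.1 hw
    exact hext.valid s hs
  · intro w hw
    obtain ⟨s, hs, rfl⟩ := Finset.mem_image.1 hw
    exact hext.length s hs
  · intro w hw
    obtain ⟨s, hs, rfl⟩ := Finset.mem_image.1 hw
    obtain ⟨hs1, hs2⟩ := Finset.mem_product.1 hs
    rw [hheight]
    have := hlt s.2 hs2
    rcases mem_stepSigns.1 hs1 with e | e <;> rw [e] <;> omega
  · intro w hw
    obtain ⟨s, hs, rfl⟩ := Finset.mem_image.1 hw
    obtain ⟨hs1, hs2⟩ := Finset.mem_product.1 hs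
    rw [hheight]
    refine dvd_add ((Int.natCast_dvd_natCast.2 hdvd).trans (hD.dvd _ hs2)) ?_
    push_cast
    exact Dvd.intro_left (b * s.1) (by ring)
  · rw [add_right_comm]
    exact (hdvd.trans hD.dvd_succ).add (dvd_mul_left _ _)
  · exact (intFun_image_iff hext.inj).2 i1
  · rw [intFun_image_iff hext.inj]
    have hy := i2.mul hort i2
    refine ((hy.add (i2.const_mul h.smul_mem (c := 2 * b)
      (R.mul_mem (ofNat_mem R 2) (natCast_mem R b)))).add
      (i1.const h.smul_mem (c := b ^ 2) (pow_mem (natCast_mem R b) 2))).congr fun s hs => ?_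
    obtain ⟨hs1, hs2⟩ := Finset.mem_product.1 hs
    have hs3 : (s.1 : ℚ) * s.1 = 1 := by
      rcases mem_stepSigns.1 hs1 with e | e <;> rw [e] <;> norm_num
    simp only [hheight, id]
    push_cast
    field_simp
    ring_nf
    rw [pow_two (s.1 : ℚ), hs3]
    ring

theorem IntegralRep.levelIntegral_column (h : IntegralRep p T O R) {i b : ℕ} (hb : 1 ≤ b)
    (hbp : b ≤ p) (hn : b * p ^ i - 1 ≤ n) :
    LevelIntegral T O {List.replicate (b * p ^ i - 1) 1} (b * p ^ i - 1) (p ^ i) := by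
  have hQ : 0 < p ^ i := pow_pos h.prime.pos i
  have hQ0 : ((p ^ i : ℕ) : ℚ) ≠ 0 := by exact_mod_cast hQ.ne'
  have hbQ : 1 ≤ b * p ^ i := Nat.mul_pos hb hQ
  have hht := pathHeight_replicate_one hbQ
  have h1 : IntFun O {List.replicate (b * p ^ i - 1) (1 : ℤ)} (pathIdem (jmShift T)) 1 := by
    simpa [IntFun] using h.pathIdem_column_mem i hb hbp hn
  refine ⟨⟨Function.injective_id.injOn, ?_, ?_⟩, ?_, ?_, ?_, h1, ?_⟩
  · intro w hw
    rw [Finset.mem_singleton.1 hw]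
    exact validPath_replicate_one _
  · intro w hw
    rw [Finset.mem_singleton.1 hw]
    simp
  · intro w hw
    rw [Finset.mem_singleton.1 hw, hht]
    exact_mod_cast hbQ
  · intro w hw
    rw [Finset.mem_singleton.1 hw, hht]
    push_cast
    exact dvd_mul_left _ _
  · rw [Nat.sub_add_cancel hbQ]
    exact dvd_mul_left _ _
  · refine (h1.const h.smul_mem (c := b ^ 2) (pow_mem (natCast_mem R b) 2)).congr fun w hw => ?_
    rw [Finset.mem_singleton.1 hw, hht]
    push_cast at hQ0 ⊢
    field_simp

end DigitFamilies

section DigitWords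

open Equiv

/-- The path whose first `N` steps are `σ 0, …, σ (N - 1)`. -/
def signWord (σ : ℕ → ℤ) : ℕ → List ℤ
  | 0 => []
  | N + 1 => σ N :: signWord σ N

theorem signWord_length (σ : ℕ → ℤ) (N : ℕ) : (signWord σ N).length = N := by
  induction N with
  | zero => rfl
  | succ N ih => simp [signWord, ih]

theorem signWord_congr {σ τ : ℕ → ℤ} {N : ℕ} (h : ∀ j < N, σ j = τ j) :
    signWord σ N = signWord τ N := by
  induction N with
  | zero => rfl
  | succ N ih =>
    rw [signWord, signWord, h N (Nat.lt_succ_self N), ih fun j hj => h j (by omega)]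

theorem eq_of_signWord_eq {σ τ : ℕ → ℤ} {N : ℕ} (h : signWord σ N = signWord τ N) :
    ∀ j < N, σ j = τ j := by
  induction N with
  | zero => intro j hj; omega
  | succ N ih =>
    rw [signWord, signWord, List.cons.injEq] at h
    intro j hj
    rcases Nat.lt_succ_iff_lt_or_eq.1 hj with hj | rfl
    · exact ih h.2 j hj
    · exact h.1

theorem signWord_add {σ : ℕ → ℤ} {N r : ℕ} {e : ℤ} (h : ∀ j < r, σ (N + j) = e) :
    signWord σ (N + r) = List.replicate r e ++ signWord σ N := by
  induction r with
  | zero => rfl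
  | succ r ih =>
    rw [← add_assoc, signWord, h r (Nat.lt_succ_self r), ih fun j hj => h j (by omega)]
    rfl

variable {p k : ℕ} {a : ℕ → ℕ}

theorem upSum_eq_add {i : ℕ} (hi : i ≤ k) :
    upSum p a k i = upSum p a k (i + 1) + a i * p ^ i := by
  rw [upSum, Finset.sum_eq_sum_Ico_succ_bot (by omega), add_comm]
  rfl

theorem upSum_self : upSum p a k k = a k * p ^ k := by simp [upSum]

theorem upSum_antitone : Antitone (upSum p a k) := fun _ _ h =>
  Finset.sum_le_sum_of_subset (Finset.Ico_subset_Ico h le_rfl)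

theorem digitAt_eq {i q : ℕ} (h1 : upSum p a k (i + 1) ≤ q) (h2 : q < upSum p a k i) :
    digitAt p a k q = i := by
  rw [digitAt, Nat.find_eq_iff]
  exact ⟨h1, fun m hm => not_le.2 (h2.trans_le (upSum_antitone (by omega)))⟩

theorem lt_digitAt {i q : ℕ} (h : q < upSum p a k (i + 1)) : i < digitAt p a k q := by
  rw [digitAt, Nat.lt_find_iff]
  exact fun m hm => not_le.2 (h.trans_le (upSum_antitone (by omega)))

/-- The `j`-th step of the path attached to a choice of signs of the digits. -/
def digitSign (p : ℕ) (a : ℕ → ℕ) (k : ℕ) (ε : Fin k → Bool) (j : ℕ) : ℤ :=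
  if sgn k ε (digitAt p a k (j + 1)) then 1 else -1

/-- The paths of the signed digit expansions truncated below the digit `i`. -/
def digitPaths (p : ℕ) (a : ℕ → ℕ) (k i : ℕ) : Finset (List ℤ) :=
  (Finset.univ : Finset (Fin k → Bool)).image fun ε =>
    signWord (digitSign p a k ε) (upSum p a k i - 1)

theorem digitPaths_self (hk : 1 ≤ upSum p a k k) :
    digitPaths p a k k = {List.replicate (a k * p ^ k - 1) 1} := by
  have h : ∀ ε : Fin k → Bool, signWord (digitSign p a k ε) (upSum p a k k - 1) =
      List.replicate (a k * p ^ k - 1) 1 := by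
    intro ε
    have := signWord_add (σ := digitSign p a k ε) (N := 0) (r := upSum p a k k - 1) (e := 1)
      fun j hj => by
        rw [zero_add, digitSign, digitAt_eq (i := k) (by simp [upSum]) (by omega)]
        simp [sgn]
    rw [zero_add] at this
    rw [this, upSum_self]
    simp [signWord]
  simp only [digitPaths, h]
  exact Finset.image_const ⟨fun _ => true, Finset.mem_univ _⟩ _

theorem digitPaths_of_lt {i : ℕ} (hi : i < k) (h1 : 1 ≤ upSum p a k (i + 1)) :
    digitPaths p a k i =
      (stepSigns ×ˢ digitPaths p a k (i + 1)).image (extendPaths (a i * p ^ i) id) := by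
  have hstep : ∀ ε : Fin k → Bool, signWord (digitSign p a k ε) (upSum p a k i - 1) =
      List.replicate (a i * p ^ i) (if ε ⟨i, hi⟩ then 1 else -1) ++
        signWord (digitSign p a k ε) (upSum p a k (i + 1) - 1) := by
    intro ε
    have hs := upSum_eq_add (p := p) (a := a) hi.le
    rw [show upSum p a k i - 1 = upSum p a k (i + 1) - 1 + a i * p ^ i by omega]
    refine signWord_add fun j hj => ?_
    rw [digitSign, digitAt_eq (i := i) (by omega) (by omega)]
    simp [sgn, hi]
  ext w
  simp only [digitPaths, Finset.mem_image, Finset.mem_univ, true_and, Finset.mem_product,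
    Prod.exists, extendPaths, id, hstep]
  constructor
  · rintro ⟨ε, rfl⟩
    refine ⟨_, _, ⟨?_, ε, rfl⟩, rfl⟩
    rw [mem_stepSigns]
    split_ifs <;> simp
  · rintro ⟨e, v, ⟨he, ε, rfl⟩, rfl⟩
    refine ⟨Function.update ε ⟨i, hi⟩ (decide (e = 1)), ?_⟩
    congr 1
    · rw [Function.update_self]
      rcases mem_stepSigns.1 he with rfl | rfl <;> simp
    · refine signWord_congr fun j hj => ?_
      have hj' := lt_digitAt (p := p) (a := a) (k := k) (i := i) (q := j + 1) (by omega)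
      simp only [digitSign, sgn]
      split_ifs with h2 <;> simp_all [Function.update, Fin.ext_iff, hj'.ne']

variable {B : Type} [Ring B] [Algebra ℚ B] {n : ℕ} {T : Perm (Fin n) →* B} {O : Subring B}
  {R : Subring ℚ}

theorem IntegralRep.levelIntegral_digitPaths (h : IntegralRep p T O R)
    (ha : ∀ i, i ≤ k → a i < p) (hak : a k ≠ 0) (hsum : n + 1 = upSum p a k 0) {i : ℕ}
    (hi : i ≤ k) :
    LevelIntegral T O (digitPaths p a k i) (upSum p a k i - 1) (p ^ i) := by
  have hk : 1 ≤ upSum p a k k := by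
    rw [upSum_self]
    exact Nat.mul_pos (by omega) (pow_pos h.prime.pos k)
  have hp : ∀ {i : ℕ}, i ≤ k → 1 ≤ upSum p a k i := fun hi => hk.trans (upSum_antitone hi)
  have hn : ∀ i, upSum p a k i - 1 ≤ n := fun i => by
    have := upSum_antitone (p := p) (a := a) (k := k) (Nat.zero_le i)
    omega
  induction hi using Nat.decreasingInduction with
  | self =>
    rw [digitPaths_self hk, upSum_self]
    exact h.levelIntegral_column (by omega) (ha k le_rfl).le (upSum_self (p := p) (a := a) ▸ hn k)
  | of_succ i hi ih =>
    have hs := upSum_eq_add (p := p) (a := a) hi.le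
    have h1 : 1 ≤ upSum p a k (i + 1) := hp hi
    have hi' := hn i
    have e : upSum p a k i - 1 = upSum p a k (i + 1) - 1 + a i * p ^ i := by omega
    rw [digitPaths_of_lt hi h1, e]
    exact ih.extend h (ha i hi.le) (by omega)

end DigitWords

section TemperleyLieb

open Equiv

theorem TLbase_TLu {R S : Type} [CommRing R] [CommRing S] (φ : R →+* S) (n : ℕ)
    (i : Fin (n - 1)) : TLbase φ n (TLu R n i) = TLu S n i := by
  unfold TLbase
  let _ : Algebra R (TL S n) := RingHom.toAlgebra' ((algebraMap S (TL S n)).comp φ)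
    (fun c x => by
      simp only [RingHom.coe_comp, Function.comp_apply]
      exact Algebra.commutes (φ c) x)
  simp only [TLu, AlgHom.toRingHom_eq_coe, RingHom.coe_coe, RingQuot.liftAlgHom_mkAlgHom_apply,
    FreeAlgebra.lift_ι_apply]

theorem TLbase_algebraMap {R S : Type} [CommRing R] [CommRing S] (φ : R →+* S) (n : ℕ) (c : R) :
    TLbase φ n (algebraMap R (TL R n) c) = algebraMap S (TL S n) (φ c) := by
  unfold TLbase
  let _ : Algebra R (TL S n) := RingHom.toAlgebra' ((algebraMap S (TL S n)).comp φ)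
    (fun c x => by
      simp only [RingHom.coe_comp, Function.comp_apply]
      exact Algebra.commutes (φ c) x)
  simp only [AlgHom.toRingHom_eq_coe, RingHom.coe_coe, AlgHom.commutes]
  rfl

theorem inv_mem_range_ZpToQ (p : ℕ) [Fact p.Prime] {z : ℤ} (hz : ¬ (p : ℤ) ∣ z) :
    (z : ℚ)⁻¹ ∈ (ZpToQ p).range := by
  have hz0 : (z : ℚ) ≠ 0 := Int.cast_ne_zero.2 fun h => hz (h ▸ dvd_zero _)
  let s : (Ideal.span {(p : ℤ)}).primeCompl := ⟨z, fun h => hz (Ideal.mem_span_singleton.1 h)⟩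
  refine ⟨IsLocalization.mk' (Zp p) 1 s, ?_⟩
  have h1 := congrArg (ZpToQ p) (IsLocalization.mk'_spec (Zp p) 1 s)
  have h2 : ∀ y : ℤ, ZpToQ p (algebraMap ℤ (Zp p) y) = y := fun y => by simp
  rw [map_mul, h2, h2] at h1
  exact eq_inv_of_mul_eq_one_left (by simpa [s] using h1)

theorem symmetrizer_eq_zero {A : Type} [Ring A] {U V : A} (hUU : U * U = 2 * U)
    (hVV : V * V = 2 * V) (hUVU : U * V * U = U) (hVUV : V * U * V = V) :
    1 + (U - 1) + (U - 1) * (V - 1) * (U - 1) + (V - 1) +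
      (U - 1) * (V - 1) * (U - 1) * (V - 1) + (V - 1) * ((U - 1) * (V - 1) * (U - 1)) = 0 := by
  have hst : (U - 1) * (V - 1) * (U - 1) = U + V - V * U - U * V - 1 := by
    calc _ = U * V * U - U * V - U * U - V * U + 2 * U + V - 1 := by noncomm_ring
      _ = _ := by rw [hUVU, hUU]; noncomm_ring
  have h1 : (U + V - V * U - U * V - 1) * (V - 1) = (V - 1) * (U - 1) := by
    calc _ = V * V - V * U * V - U * (V * V) - 2 * V + 2 * (U * V) + V * U - U + 1 := by
          noncomm_ring
      _ = _ := by rw [hVUV, hVV]; noncomm_ring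
  have h2 : (V - 1) * (U + V - V * U - U * V - 1) = (U - 1) * (V - 1) := by
    calc _ = V * V - V * U * V - V * V * U - 2 * V + 2 * (V * U) + U * V - U + 1 := by
          noncomm_ring
      _ = _ := by rw [hVUV, hVV]; noncomm_ring
  rw [hst, h1, h2]
  noncomm_ring

variable {n : ℕ} {B : Type} [Ring B] {T : Perm (Fin n) →* B}

theorem killsSymmetrizers_of_adjacent (h0 : 2 < n)
    (h : 1 + T (swap ⟨0, by omega⟩ ⟨1, by omega⟩) + T (swap ⟨0, by omega⟩ ⟨2, by omega⟩) +
      T (swap ⟨1, by omega⟩ ⟨2, by omega⟩) +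
      T (swap ⟨0, by omega⟩ ⟨2, by omega⟩ * swap ⟨1, by omega⟩ ⟨2, by omega⟩) +
      T (swap ⟨1, by omega⟩ ⟨2, by omega⟩ * swap ⟨0, by omega⟩ ⟨2, by omega⟩) = 0) :
    KillsSymmetrizers T := by
  intro a b c hab hac hbc
  let f : Fin 3 ↪ Fin n := ⟨fun i => ⟨i.val, by omega⟩, fun i j hij => by
    simpa [Fin.ext_iff] using hij⟩
  let g : Fin 3 ↪ Fin n := ⟨![a, b, c], by
    intro i j hij
    fin_cases i <;> fin_cases j <;> simp_all⟩
  obtain ⟨σ, hσ⟩ := (Equiv.Perm.isMultiplyPretransitive (Fin n) 3).exists_smul_eq f g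
  have e0 : σ ⟨0, by omega⟩ = a := DFunLike.congr_fun hσ 0
  have e1 : σ ⟨1, by omega⟩ = b := DFunLike.congr_fun hσ 1
  have e2 : σ ⟨2, by omega⟩ = c := DFunLike.congr_fun hσ 2
  have hc : ∀ x y, T (swap (σ x) (σ y)) = T σ * T (swap x y) * T σ⁻¹ := fun x y => by
    rw [← map_mul, ← map_mul, mul_swap_eq_swap_mul, mul_inv_cancel_right]
  have hinv : T σ⁻¹ * T σ = 1 := by rw [← map_mul, inv_mul_cancel, map_one]
  have hinv' : T σ * T σ⁻¹ = 1 := by rw [← map_mul, mul_inv_cancel, map_one]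
  have key := congrArg (fun z => T σ * z * T σ⁻¹) h
  simp only [mul_zero, zero_mul] at key
  rw [← key, ← e0, ← e1, ← e2]
  have hcc : ∀ x y : B, T σ * (x * y) * T σ⁻¹ = (T σ * x * T σ⁻¹) * (T σ * y * T σ⁻¹) := by
    intro x y
    calc T σ * (x * y) * T σ⁻¹ = T σ * x * 1 * y * T σ⁻¹ := by simp only [mul_assoc, one_mul]
      _ = _ := by rw [← hinv]; simp only [mul_assoc]
  simp only [map_mul, hc, mul_add, add_mul, hcc, mul_one, hinv']

theorem perm_mem_of_simpleT {O : Subring B} (hn : 0 < n)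
    (h : ∀ i : Fin (n - 1), T (simpleT n i) ∈ O) (w : Perm (Fin n)) : T w ∈ O := by
  obtain ⟨m, rfl⟩ : ∃ m, n = m + 1 := ⟨n - 1, by omega⟩
  have hw : w ∈ Submonoid.closure (Set.range fun i : Fin m => swap i.castSucc i.succ) := by
    rw [Equiv.Perm.mclosure_swap_castSucc_succ]
    trivial
  have hle : Submonoid.closure (Set.range fun i : Fin m => swap i.castSucc i.succ) ≤
      O.toSubmonoid.comap T := by
    rw [Submonoid.closure_le]
    rintro _ ⟨i, rfl⟩
    exact h i
  exact hle hw

theorem integralRep_TL (p : ℕ) [Fact p.Prime] (hp2 : 2 < p) (hpn : p ≤ n)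
    (Φ : SymGrpAlg ℚ n →ₐ[ℚ] TL ℚ n)
    (hΦ : ∀ i : Fin (n - 1),
      Φ (MonoidAlgebra.of ℚ (Equiv.Perm (Fin n)) (simpleT n i)) = TLu ℚ n i - 1) :
    IntegralRep p ((Φ : SymGrpAlg ℚ n →* TL ℚ n).comp (MonoidAlgebra.of ℚ (Perm (Fin n))))
      (TLbase (ZpToQ p) n).range (ZpToQ p).range where
  kills := by
    set T := (Φ : SymGrpAlg ℚ n →* TL ℚ n).comp (MonoidAlgebra.of ℚ (Perm (Fin n)))
    have hT : ∀ i, T (simpleT n i) = TLu ℚ n i - 1 := hΦ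
    apply killsSymmetrizers_of_adjacent (by omega)
    have hs : T (swap ⟨0, by omega⟩ ⟨1, by omega⟩) = TLu ℚ n ⟨0, by omega⟩ - 1 :=
      hT ⟨0, by omega⟩
    have ht : T (swap ⟨1, by omega⟩ ⟨2, by omega⟩) = TLu ℚ n ⟨1, by omega⟩ - 1 :=
      hT ⟨1, by omega⟩
    have h02 : (swap ⟨0, by omega⟩ ⟨2, by omega⟩ : Perm (Fin n)) =
        swap ⟨0, by omega⟩ ⟨1, by omega⟩ * swap ⟨1, by omega⟩ ⟨2, by omega⟩ *
          swap ⟨0, by omega⟩ ⟨1, by omega⟩ := by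
      have hsw : ∀ x y z : Fin n, y ≠ z → x ≠ z → swap x z = swap x y * swap y z * swap x y :=
        fun x y z hyz hxz => by
          rw [swap_comm x y, swap_comm y z, swap_mul_swap_mul_swap hyz.symm hxz.symm]
      exact hsw _ _ _ (by simp) (by simp)
    have hUU := TLu_mul_self ℚ n ⟨0, by omega⟩
    have hVV := TLu_mul_self ℚ n ⟨1, by omega⟩
    have hUVU := TLu_braid ℚ n ⟨0, by omega⟩ ⟨1, by omega⟩ rfl
    have hVUV := TLu_braid ℚ n ⟨1, by omega⟩ ⟨0, by omega⟩ rfl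
    rw [map_mul, map_mul, h02, map_mul, map_mul, hs, ht]
    exact symmetrizer_eq_zero hUU hVV hUVU hVUV
  mem := by
    refine perm_mem_of_simpleT (by omega) fun i => ?_
    refine (hΦ i).symm ▸ Subring.sub_mem _ ⟨TLu _ n i, TLbase_TLu _ _ _⟩ (Subring.one_mem _)
  smul_mem := by
    rintro _ ⟨c, rfl⟩ x hx
    rw [Algebra.smul_def]
    exact Subring.mul_mem _ ⟨_, TLbase_algebraMap _ _ _⟩ hx
  inv_mem _ hz := inv_mem_range_ZpToQ p hz
  prime := Fact.out
  odd := hp2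

end TemperleyLieb

section SeminormalIdempotents

open Equiv

/-- The steps of the path attached to a column word: `1` for the first column, `-1` for the
second. -/
def colSign {n : ℕ} (c : Fin n → Fin 2) (N : ℕ) : ℤ :=
  if h : N < n then (if c ⟨N, h⟩ = 0 then 1 else -1) else 1

theorem colSign_inj {n : ℕ} {c c' : Fin n → Fin 2} (h : ∀ N < n, colSign c N = colSign c' N) :
    c = c' := by
  funext j
  have := h j j.2
  simp only [colSign, j.2, dite_true, Fin.eta] at this
  split_ifs at this with h1 h2 h2
  · rw [h1, h2]
  · omega

/-- The number of entries at most `N` in the column `v`. -/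
def colCount {n : ℕ} (c : Fin n → Fin 2) (v : Fin 2) (N : ℕ) : ℕ :=
  (Finset.univ.filter fun i : Fin n => i.val < N ∧ c i = v).card

theorem colCount_succ {n : ℕ} (c : Fin n → Fin 2) (v : Fin 2) {N : ℕ} (hN : N < n) :
    colCount c v (N + 1) = colCount c v N + if c ⟨N, hN⟩ = v then 1 else 0 := by
  unfold colCount
  split_ifs with h
  · rw [← Finset.card_insert_of_notMem (a := (⟨N, hN⟩ : Fin n)) (by simp)]
    congr 1
    ext i
    simp only [Finset.mem_filter, Finset.mem_univ, true_and, Finset.mem_insert]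
    constructor
    · rintro ⟨h1, h2⟩
      rcases Nat.lt_succ_iff_lt_or_eq.1 h1 with h3 | h3
      · exact Or.inr ⟨h3, h2⟩
      · exact Or.inl (Fin.ext h3)
    · rintro (rfl | ⟨h1, h2⟩)
      · exact ⟨Nat.lt_succ_self N, h⟩
      · exact ⟨by omega, h2⟩
  · rw [add_zero]
    congr 1
    ext i
    simp only [Finset.mem_filter, Finset.mem_univ, true_and]
    constructor
    · rintro ⟨h1, h2⟩
      rcases Nat.lt_succ_iff_lt_or_eq.1 h1 with h3 | h3
      · exact ⟨h3, h2⟩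
      · exact absurd (by rw [← h2]; congr 1; exact Fin.ext h3.symm) h
    · rintro ⟨h1, h2⟩
      exact ⟨by omega, h2⟩

theorem colCount_add {n : ℕ} (c : Fin n → Fin 2) {N : ℕ} (hN : N ≤ n) :
    colCount c 0 N + colCount c 1 N = N ∧
    pathHeight (signWord (colSign c) N) = 1 + colCount c 0 N - colCount c 1 N := by
  induction N with
  | zero => simp [colCount, signWord, pathHeight]
  | succ N ih =>
    obtain ⟨h1, h2⟩ := ih (by omega)
    have hN' : N < n := hN
    rw [colCount_succ c 0 hN', colCount_succ c 1 hN', signWord, pathHeight_cons, h2, colSign,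
      dif_pos hN']
    have : c ⟨N, hN'⟩ = 0 ∨ c ⟨N, hN'⟩ = 1 := by omega
    rcases this with h | h <;> simp only [h] <;> constructor <;> simp <;> omega

theorem colContent_eq {n : ℕ} (c : Fin n → Fin 2) {N : ℕ} (hN : N < n) :
    colContent c ⟨N, hN⟩ =
      if c ⟨N, hN⟩ = 0 then -(colCount c 0 N : ℤ) else 1 - (colCount c 1 N : ℤ) := by
  have h : ∀ v, (Finset.univ.filter fun i : Fin n => i ≤ ⟨N, hN⟩ ∧ c i = v).card =
      colCount c v (N + 1) := by
    intro v
    unfold colCount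
    congr 1
    ext i
    simp [Fin.le_def]
  rw [colContent, h, h, colCount_succ c 0 hN, colCount_succ c 1 hN]
  have : c ⟨N, hN⟩ = 0 ∨ c ⟨N, hN⟩ = 1 := by omega
  rcases this with h | h <;> simp only [h] <;> simp
  ring

theorem two_mul_colContent {n : ℕ} (c : Fin n → Fin 2) {N : ℕ} (hN : N < n) :
    2 * colContent c ⟨N, hN⟩ = 1 - N - colSign c N * pathHeight (signWord (colSign c) N) := by
  obtain ⟨h1, h2⟩ := colCount_add c hN.le
  rw [colContent_eq c hN, h2, colSign, dif_pos hN]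
  split_ifs <;> omega

theorem neg_mem_contSet {n m : ℕ} (hm : m < n) : -(m : ℤ) ∈ ContSet n := by
  unfold ContSet
  rw [Finset.mem_image]
  refine ⟨(fun _ => 0, ⟨m, hm⟩), Finset.mem_filter.2 ⟨Finset.mem_univ _, fun m => by simp⟩, ?_⟩
  have hIic : (Finset.univ.filter fun i : Fin n => i ≤ ⟨m, hm⟩) = Finset.Iic (⟨m, hm⟩ : Fin n) :=
    Finset.ext fun i => by rw [Finset.mem_filter_univ, Finset.mem_Iic]
  have : (Finset.univ.filter fun i : Fin n => i ≤ ⟨m, hm⟩).card = m + 1 := by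
    rw [hIic, Fin.card_Iic]
  simp [colContent, this]

theorem one_mem_contSet {n : ℕ} (hn : 1 < n) : 1 ∈ ContSet n := by
  have hle : ∀ m : Fin n, (Finset.univ.filter fun i : Fin n => i ≤ m ∧ i.val = 1).card ≤
      (Finset.univ.filter fun i : Fin n => i ≤ m ∧ ¬ i.val = 1).card := by
    intro m
    by_cases hm : 1 ≤ m.val
    · refine le_trans (Finset.card_le_one.2 ?_) (Finset.card_pos.2 ⟨(⟨0, by omega⟩ : Fin n), ?_⟩)
      · intro i hi j hj
        simp only [Finset.mem_filter, Finset.mem_univ, true_and] at hi hj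
        exact Fin.ext (by omega)
      · rw [Finset.mem_filter_univ, Fin.le_def]
        exact ⟨Nat.zero_le _, by simp⟩
    · rw [Finset.card_eq_zero.2]
      · exact Nat.zero_le _
      · ext i
        simp only [Finset.mem_filter, Finset.mem_univ, true_and, Finset.notMem_empty, iff_false,
          Fin.le_def]
        omega
  unfold ContSet
  rw [Finset.mem_image]
  refine ⟨(fun i => if i.val = 1 then 1 else 0, ⟨1, hn⟩), ?_, ?_⟩
  · rw [Finset.mem_filter]
    refine ⟨Finset.mem_univ _, fun m => ?_⟩
    simpa using hle m
  · have : (Finset.univ.filter fun i : Fin n => i ≤ ⟨1, hn⟩ ∧ i.val = 1).card = 1 := by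
      rw [Finset.card_eq_one]
      refine ⟨⟨1, hn⟩, ?_⟩
      ext i
      simp only [Finset.mem_filter, Finset.mem_univ, true_and, Finset.mem_singleton, Fin.ext_iff,
        Fin.le_def]
      omega
    simp [colContent, this]

/-- The content of the entry `N + 1` if it is moved to the other column occurs in some tableau. -/
theorem exists_contSet {n : ℕ} (hn : 1 < n) (c : Fin n → Fin 2) {N : ℕ} (hN : N < n) :
    ∃ d ∈ ContSet n,
      2 * d = 1 - N + colSign c N * pathHeight (signWord (colSign c) N) := by
  obtain ⟨h1, h2⟩ := colCount_add c hN.le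
  rw [h2, colSign, dif_pos hN]
  split_ifs with h
  · refine ⟨1 - colCount c 1 N, ?_, by omega⟩
    rcases Nat.eq_zero_or_pos (colCount c 1 N) with h0 | h0
    · simpa [h0] using one_mem_contSet hn
    · have := neg_mem_contSet (n := n) (m := colCount c 1 N - 1) (by omega)
      rwa [show (1 : ℤ) - colCount c 1 N = -((colCount c 1 N - 1 : ℕ) : ℤ) by omega]
  · exact ⟨-(colCount c 0 N : ℤ), neg_mem_contSet (by omega), by omega⟩

theorem list_prod_mul_of_fixed {A : Type} [Monoid A] {l : List A} {P : A}
    (h : ∀ f ∈ l, f * P = P) : l.prod * P = P := by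
  induction l with
  | nil => simp
  | cons f l ih =>
    rw [List.prod_cons, mul_assoc, ih fun g hg => h g (List.mem_cons_of_mem _ hg),
      h f List.mem_cons_self]

theorem list_prod_mul_eq_zero {A : Type} [MonoidWithZero A] {l : List A} {f P : A} (hf : f ∈ l)
    (hc : ∀ g ∈ l, Commute f g) (h : f * P = 0) : l.prod * P = 0 := by
  obtain ⟨s, t, rfl⟩ := List.append_of_mem hf
  have ht : Commute f t.prod := Commute.list_prod_right _ _ fun g hg => hc g (by simp [hg])
  rw [List.prod_append, List.prod_cons, ht.eq, mul_assoc, mul_assoc, h, mul_zero, mul_zero]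

theorem eeltC_eq_prod (n : ℕ) (L : Fin n → TL ℚ n) (c : Fin n → Fin 2) :
    EeltC n L c = (((ContSet n).sort (· ≤ ·)).flatMap fun d =>
      ((List.finRange n).filter fun i => colContent c i ≠ d).map fun i =>
        (((colContent c i - d : ℤ) : ℚ))⁻¹ • (L i - (d : TL ℚ n))).prod := by
  rw [EeltC, List.flatMap, List.prod_flatten, List.map_map]
  rfl

section Eigenvectors

variable {B : Type} [Ring B] [Algebra ℚ B] {L P : B} {d z : ℤ}

theorem sub_intCast_mul (h : L * P = (z : ℚ) • P) : (L - (d : B)) * P = ((z - d : ℤ) : ℚ) • P := by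
  rw [sub_mul, h, Int.cast_sub, sub_smul, ← map_intCast (algebraMap ℚ B) d, ← Algebra.smul_def]

theorem smul_sub_intCast_mul (h : L * P = (z : ℚ) • P) (hz : z ≠ d) :
    (((z - d : ℤ) : ℚ))⁻¹ • (L - (d : B)) * P = P := by
  rw [smul_mul_assoc, sub_intCast_mul h, smul_smul,
    inv_mul_cancel₀ (Int.cast_ne_zero.2 (sub_ne_zero.2 hz)), one_smul]

theorem smul_sub_intCast_mul_eq_zero (c : ℚ) (h : L * P = (d : ℚ) • P) :
    c • (L - (d : B)) * P = 0 := by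
  rw [smul_mul_assoc, sub_intCast_mul h, sub_self, Int.cast_zero, zero_smul, smul_zero]

end Eigenvectors

variable {n : ℕ} {T : Perm (Fin n) →* TL ℚ n}

theorem jmSum_mul_of_jmShift {N : ℕ} (hN : N < n) {P : TL ℚ n} {z d : ℤ}
    (h : jmShift T N * P = (z : ℚ) • P) (hd : 2 * d = 1 - N - z) :
    jmSum T ⟨N, hN⟩ * P = (d : ℚ) • P := by
  have hd' : (d : ℚ) = (1 - N - z) / 2 := by
    have : (2 * d : ℚ) = 1 - N - z := by exact_mod_cast hd
    linarith
  rw [jmShift, dif_pos hN, sub_mul, smul_mul_assoc, smul_mul_assoc, one_mul] at h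
  rw [hd']
  linear_combination (norm := module) (-1 / 2 : ℚ) • h

theorem signWord_eq_append (σ : ℕ → ℤ) {N M : ℕ} (h : N ≤ M) :
    ∃ u, signWord σ M = u ++ signWord σ N := by
  induction M, h using Nat.le_induction with
  | base => exact ⟨[], rfl⟩
  | succ M _ ih =>
    obtain ⟨u, hu⟩ := ih
    exact ⟨σ M :: u, by rw [signWord, hu]; rfl⟩

/-- The seminormal idempotent of a standard column word is the spectral projection of its path. -/
theorem eeltC_eq_pathIdem (hn : 1 < n) (hT : KillsSymmetrizers T) {c : Fin n → Fin 2}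
    (hc : ValidPath (signWord (colSign c) n)) :
    EeltC n (jmSum T) c = pathIdem (jmShift T) (signWord (colSign c) n) := by
  have hq := quadRel_jmShift T hT
  have hfix : EeltC n (jmSum T) c * pathIdem (jmShift T) (signWord (colSign c) n) =
      pathIdem (jmShift T) (signWord (colSign c) n) := by
    rw [eeltC_eq_prod]
    refine list_prod_mul_of_fixed fun f hf => ?_
    simp only [List.mem_flatMap, List.mem_map, List.mem_filter, decide_eq_true_eq] at hf
    obtain ⟨d, -, i, ⟨-, hi⟩, rfl⟩ := hf
    obtain ⟨u, hu⟩ := signWord_eq_append (colSign c) (Nat.succ_le_of_lt i.2)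
    have hu' : signWord (colSign c) n = u ++ colSign c i :: signWord (colSign c) i := hu
    have he := hq.eigen (u := u) (e := colSign c i) (v := signWord (colSign c) i) (hu' ▸ hc)
      (by rw [signWord_length]; exact i.2)
    rw [← hu', signWord_length] at he
    have hL := jmSum_mul_of_jmShift i.2 he (two_mul_colContent c i.2)
    exact smul_sub_intCast_mul hL hi
  have habs : ∀ N ≤ n,
      EeltC n (jmSum T) c * pathIdem (jmShift T) (signWord (colSign c) N) =
        EeltC n (jmSum T) c := by
    intro N hN
    induction N with
    | zero => simp [signWord, pathIdem]
    | succ N ih =>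
      have hN' : N < n := hN
      obtain ⟨u, hu⟩ := signWord_eq_append (colSign c) hN
      have hv : ValidPath (colSign c N :: signWord (colSign c) N) :=
        ValidPath.of_append (u := u) (hu ▸ hc)
      have hv' : ValidPath (-colSign c N :: signWord (colSign c) N) :=
        ⟨hv.1, hv.2.1, by rcases hv.2.2 with h | h <;> simp [h]⟩
      have hsplit := pathIdem_split (x := jmShift T) (colSign c N) _ hv.2.1
      obtain ⟨d, hd, hd2⟩ := exists_contSet hn c hN'
      have he := hq.step_mul hv' (by simpa [signWord_length] using hN)
      rw [signWord_length] at he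
      have hL := jmSum_mul_of_jmShift hN' (d := d) he (by rw [hd2]; ring)
      have hcd : colContent c ⟨N, hN'⟩ ≠ d := by
        intro h
        have h1 := two_mul_colContent c hN'
        rw [h, hd2] at h1
        have h2 : colSign c N * pathHeight (signWord (colSign c) N) ≠ 0 :=
          mul_ne_zero (by rcases hv.2.2 with h | h <;> simp [h]) hv.2.1.ne'
        omega
      have hkill : EeltC n (jmSum T) c *
          pathIdem (jmShift T) (-colSign c N :: signWord (colSign c) N) = 0 := by
        rw [eeltC_eq_prod]
        refine list_prod_mul_eq_zero (f := (((colContent c ⟨N, hN'⟩ - d : ℤ) : ℚ))⁻¹ •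
          (jmSum T ⟨N, hN'⟩ - (d : TL ℚ n))) ?_ ?_ ?_
        · simp only [List.mem_flatMap, List.mem_map, List.mem_filter, decide_eq_true_eq,
            Finset.mem_sort]
          exact ⟨d, hd, ⟨N, hN'⟩, ⟨List.mem_finRange _, hcd⟩, rfl⟩
        · intro g hg
          simp only [List.mem_flatMap, List.mem_map] at hg
          obtain ⟨d', -, i, -, rfl⟩ := hg
          exact (((jmSum_commute T _ _).sub_right (Int.cast_commute d' _).symm).sub_left
            (Int.cast_commute d _)).smul_left _ |>.smul_right _
        · exact smul_sub_intCast_mul_eq_zero _ hL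
      rw [signWord, eq_sub_of_add_eq hsplit, mul_sub, hkill, sub_zero, ih (by omega)]
  rw [← habs n le_rfl, hfix]

end SeminormalIdempotents

theorem jmSum_comp_of {n : ℕ} (Φ : SymGrpAlg ℚ n →ₐ[ℚ] TL ℚ n) :
    (fun l => Φ (JMelt ℚ n l)) = jmSum ((Φ : SymGrpAlg ℚ n →* TL ℚ n).comp
      (MonoidAlgebra.of ℚ (Equiv.Perm (Fin n)))) := by
  funext l
  rw [JMelt, map_sum]
  rfl

theorem signWord_colSign_tmCol (p n k : ℕ) (a : ℕ → ℕ) (ε : Fin k → Bool) :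
    signWord (colSign (tmCol p n k a ε)) n = signWord (digitSign p a k ε) n := by
  refine signWord_congr fun j hj => ?_
  rw [colSign, dif_pos hj, tmCol, digitSign]
  split_ifs <;> simp_all

/-- Let `p > 2` be a prime with `p ≤ n` and write
`n + 1 = a_k p^k + ⋯ + a_0` in base `p` with top digit `a_k ≠ 0`.  The
`p`-Jones–Wenzl idempotent `^pJW_n = Σ_{m ∈ I_n} E_{t_m} ∈ TL_n^ℚ` (here the sum
is over the distinct tableaux `t_m`, `m ∈ I_n`, i.e. over the distinct column words
`tmCol ε` as `ε` ranges over all sign choices) lies in the image of the canonical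
ring homomorphism `TL_n^{ℤ_(p)} → TL_n^ℚ` induced by `ℤ_(p) ⊆ ℚ`. -/
theorem pJonesWenzl_integral (p n k : ℕ) [Fact p.Prime] (hp2 : 2 < p) (hpn : p ≤ n)
    (a : ℕ → ℕ) (ha : ∀ i, i ≤ k → a i < p) (hak : a k ≠ 0)
    (hsum : n + 1 = ∑ i ∈ Finset.range (k + 1), a i * p ^ i)
    (Φ : SymGrpAlg ℚ n →ₐ[ℚ] TL ℚ n)
    (hΦ : ∀ i : Fin (n - 1),
      Φ (MonoidAlgebra.of ℚ (Equiv.Perm (Fin n)) (simpleT n i)) = TLu ℚ n i - 1) :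
    (∑ c ∈ (Finset.univ : Finset (Fin k → Bool)).image (tmCol p n k a),
        EeltC n (fun l => Φ (JMelt ℚ n l)) c) ∈
      Set.range (TLbase (ZpToQ p) n) := by
  have h := integralRep_TL p hp2 hpn Φ hΦ
  have hsum' : n + 1 = upSum p a k 0 := by rw [hsum, upSum, Finset.range_eq_Ico]
  have hD := h.levelIntegral_digitPaths ha hak hsum' (Nat.zero_le k)
  rw [← hsum', Nat.add_sub_cancel] at hD
  have himage : digitPaths p a k 0 = ((Finset.univ : Finset (Fin k → Bool)).image
      (tmCol p n k a)).image fun c => signWord (colSign c) n := by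
    rw [Finset.image_image, digitPaths, ← hsum', Nat.add_sub_cancel]
    exact Finset.image_congr fun ε _ => (signWord_colSign_tmCol p n k a ε).symm
  rw [jmSum_comp_of, Finset.sum_congr rfl fun c hc => eeltC_eq_pathIdem (by omega) h.kills
      (hD.family.valid _ (himage ▸ Finset.mem_image_of_mem _ hc)),
    ← Finset.sum_image (f := pathIdem (jmShift _)) (g := fun c => signWord (colSign c) n)
      fun c _ c' _ hcc => colSign_inj (eq_of_signWord_eq hcc), ← himage]
  simpa [IntFun] using hD.one
end

section
/- Let p ≥ 2, k ≥ 1, and let a_0, a_1, …, a_{k−1} be integers with 0 ≤ a_i < p. If ε, ε' ∈ {+1, −1}^k satisfy Σ_{i=0}^{k−1} ε_i a_i p^i = Σ_{i=0}^{k−1} ε'_i a_i p^i, then ε_i = ε'_i for every index i with a_i ≠ 0. Consequently, each element of I_n is given by a unique sequence of signs on the nonzero digits of n + 1 in base p. -/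
/-- A vanishing base-`p` expansion whose digits are integers of absolute value less than `p`
has only zero digits. -/
theorem eq_zero_of_sum_mul_pow_eq_zero {p : ℤ} {k : ℕ} {c : Fin k → ℤ}
    (hc : ∀ i, |c i| < p) (h : ∑ i, c i * p ^ i.val = 0) (i : Fin k) : c i = 0 := by
  induction k with
  | zero => exact i.elim0
  | succ k ih =>
    have hp : p ≠ 0 := ((abs_nonneg _).trans_lt (hc 0)).ne'
    have h_shift : c 0 + p * ∑ j : Fin k, c j.succ * p ^ j.val = 0 := by
      rw [← h, Fin.sum_univ_succ, Finset.mul_sum]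
      simp [pow_succ, mul_comm, mul_left_comm]
    have h_zero : c 0 = 0 :=
      Int.eq_zero_of_abs_lt_dvd ⟨-∑ j : Fin k, c j.succ * p ^ j.val, by linarith⟩ (hc 0)
    have h_tail : ∑ j : Fin k, c j.succ * p ^ j.val = 0 := by
      simpa [h_zero, hp] using h_shift
    cases i using Fin.cases with
    | zero => exact h_zero
    | succ j => exact ih (fun j => hc j.succ) h_tail j

/-- The signs on the nonzero digits are determined by the signed base-`p` sum. -/
theorem sign_eq_of_signed_digit_sum_eq {p k : ℕ} {a : ℕ → ℕ} (ha : ∀ i, i < k → a i < p)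
    {ε ε' : Fin k → Bool}
    (h : (∑ i : Fin k, (if ε i then ((a i.val : ℤ) * (p : ℤ) ^ i.val)
          else -((a i.val : ℤ) * (p : ℤ) ^ i.val))) =
        ∑ i : Fin k, (if ε' i then ((a i.val : ℤ) * (p : ℤ) ^ i.val)
          else -((a i.val : ℤ) * (p : ℤ) ^ i.val)))
    (i : Fin k) (hi : a i.val ≠ 0) : ε i = ε' i := by
  let c : Fin k → ℤ := fun j =>
    a j.val * ((if ε j then 1 else 0) - (if ε' j then 1 else 0))
  have hc : ∀ j, |c j| < p := by
    intro j
    have hj := ha j.val j.isLt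
    cases hε : ε j <;> cases hε' : ε' j <;> simp [c, hε, hε'] <;> omega
  have h_double : 2 * ∑ j, c j * (p : ℤ) ^ j.val = 0 := by
    rw [← sub_eq_zero.mpr h, ← Finset.sum_sub_distrib, Finset.mul_sum]
    refine Finset.sum_congr rfl fun j _ => ?_
    cases hε : ε j <;> cases hε' : ε' j <;> simp [c, hε, hε'] <;> ring
  have hci : c i = 0 := eq_zero_of_sum_mul_pow_eq_zero hc (by linarith) i
  cases hε : ε i <;> cases hε' : ε' i <;> simp_all [c]

/-- Let `p ≥ 2`, `k ≥ 1`, and let `a_0, …, a_{k−1}` be integers with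
`0 ≤ a_i < p`.  If two sign sequences `ε, ε' ∈ {±1}^k` give the same signed sum
`Σ_i ε_i a_i p^i`, then `ε_i = ε'_i` for every index `i` with `a_i ≠ 0`.
Consequently (second part), each element of `I_n` — of the form
`(a_k p^k ± a_{k−1} p^{k−1} ± ⋯ ± a_0) − 1` — is given by a unique sequence of
signs on the nonzero digits of `n + 1` in base `p`. -/
theorem signed_digit_sum_injective (p k : ℕ) (hp : 2 ≤ p) (hk : 1 ≤ k)
    (a : ℕ → ℕ) (ha : ∀ i, i < k → a i < p) :
    (∀ ε ε' : Fin k → Bool,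
      (∑ i : Fin k, (if ε i then ((a i.val : ℤ) * (p : ℤ) ^ i.val)
          else -((a i.val : ℤ) * (p : ℤ) ^ i.val))) =
        (∑ i : Fin k, (if ε' i then ((a i.val : ℤ) * (p : ℤ) ^ i.val)
          else -((a i.val : ℤ) * (p : ℤ) ^ i.val))) →
      ∀ i : Fin k, a i.val ≠ 0 → ε i = ε' i) ∧
    (∀ ak : ℕ, ak ≠ 0 → ak < p →
      ∀ ε ε' : Fin k → Bool,
      ((ak : ℤ) * (p : ℤ) ^ k +
          ∑ i : Fin k, (if ε i then ((a i.val : ℤ) * (p : ℤ) ^ i.val)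
            else -((a i.val : ℤ) * (p : ℤ) ^ i.val))) - 1 =
        ((ak : ℤ) * (p : ℤ) ^ k +
          ∑ i : Fin k, (if ε' i then ((a i.val : ℤ) * (p : ℤ) ^ i.val)
            else -((a i.val : ℤ) * (p : ℤ) ^ i.val))) - 1 →
      ∀ i : Fin k, a i.val ≠ 0 → ε i = ε' i) := by
  refine ⟨fun ε ε' h => sign_eq_of_signed_digit_sum_eq ha h, fun ak _ _ ε ε' h => ?_⟩
  exact sign_eq_of_signed_digit_sum_eq ha (add_left_cancel (sub_left_injective h))
end

section
/- In the group algebra ℚ𝔖_n, the elements E_t (for t ranging over the standard Young tableaux of all partitions of n) defined by the content-product formula form a complete set of pairwise orthogonal idempotents diagonalizing the Jucys–Murphy elements: Σ_t E_t = 1; E_s E_t = δ_{s,t} E_s for all standard tableaux s, t of size n; and L_i E_t = E_t L_i = c_t(i) E_t for all i = 1, …, n. -/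
/-- The standardness condition on a filling `f : Fin n → Fin n × Fin n`
(entry `j+1` placed in (row, column) `f j`, `0`-indexed; any standard tableau of
size `n` fits in an `n × n` box): the filling is injective and, for every `j`, every
box weakly above and to the left of the box of `j+1` is occupied by some entry `≤ j+1`.
This says exactly that the boxes of the entries `1, …, m` form a Young diagram for
every `m`, i.e. that `f` is a standard Young tableau (of some partition shape of `n`). -/
def IsStdFilling (n : ℕ) (f : Fin n → Fin n × Fin n) : Prop :=
  Function.Injective f ∧
  ∀ j : Fin n, ∀ q : Fin n × Fin n, q.1 ≤ (f j).1 → q.2 ≤ (f j).2 →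
    ∃ i : Fin n, i ≤ j ∧ f i = q

/-- A standard Young tableau of size `n`, of arbitrary partition shape. -/
structure StdTab (n : ℕ) where
  cell : Fin n → Fin n × Fin n
  std : IsStdFilling n cell

theorem StdTab.ext' {n : ℕ} : ∀ {s t : StdTab n}, s.cell = t.cell → s = t
  | ⟨a, _⟩, ⟨b, _⟩, h => by
      obtain rfl : a = b := h
      rfl

noncomputable instance (n : ℕ) : Fintype (StdTab n) :=
  Fintype.ofInjective StdTab.cell (fun _ _ h => StdTab.ext' h)

/-- The content `c_t(j+1) = (column of j+1) − (row of j+1)`. -/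
def stdContent {n : ℕ} (t : StdTab n) (j : Fin n) : ℤ :=
  ((t.cell j).2 : ℤ) - ((t.cell j).1 : ℤ)

/-- The set `𝒞' = {c_s(i) : s ∈ Std(Par_n), 1 ≤ i ≤ n}` of all contents of standard
tableaux of size `n`. -/
instance (n : ℕ) (f : Fin n → Fin n × Fin n) : Decidable (IsStdFilling n f) :=
  inferInstanceAs (Decidable (Function.Injective f ∧
    ∀ j : Fin n, ∀ q : Fin n × Fin n, q.1 ≤ (f j).1 → q.2 ≤ (f j).2 →
      ∃ i : Fin n, i ≤ j ∧ f i = q))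

noncomputable def ContSetAll (n : ℕ) : Finset ℤ :=
  ((Finset.univ : Finset ((Fin n → Fin n × Fin n) × Fin n)).filter
      (fun x : (Fin n → Fin n × Fin n) × Fin n => IsStdFilling n x.1)).image
    (fun x : (Fin n → Fin n × Fin n) × Fin n => (((x.1 x.2).2 : ℤ) - ((x.1 x.2).1 : ℤ)))

/-- The seminormal idempotent
`E_t = ∏_{c ∈ 𝒞'} ∏_{1 ≤ i ≤ n, c_t(i) ≠ c} (L_i − c)/(c_t(i) − c) ∈ ℚ𝔖_n`.
(All the factors commute, so the ordered product below agrees with the usual one.) -/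
noncomputable def EeltS (n : ℕ) (t : StdTab n) : SymGrpAlg ℚ n :=
  (((ContSetAll n).sort (· ≤ ·)).map fun d =>
    (((List.finRange n).filter fun i => stdContent t i ≠ d).map fun i =>
      (((stdContent t i - d : ℤ) : ℚ))⁻¹ • (JMelt ℚ n i - (d : SymGrpAlg ℚ n))).prod).prod

/-- A set of real sequences, considered up to index `n`, with the closure properties shared by the
joint spectra of the Jucys–Murphy elements. -/
structure IsSpectrumLike (n : ℕ) (S : Set (ℕ → ℝ)) : Prop where
  zero : ∀ a ∈ S, 0 < n → a 0 = 0
  ne_succ : ∀ a ∈ S, ∀ i, i + 1 < n → a i ≠ a (i + 1)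
  swap : ∀ a ∈ S, ∀ i, i + 1 < n → (a (i + 1) - a i) ^ 2 ≠ 1 → a ∘ Equiv.swap i (i + 1) ∈ S
  braid : ∀ a ∈ S, ∀ i, i + 2 < n → a i = a (i + 2) → (a (i + 1) - a i) ^ 2 ≠ 1

namespace IsSpectrumLike

variable {n : ℕ} {S : Set (ℕ → ℝ)}

theorem exists_between (h : IsSpectrumLike n S) {p q : ℕ} (hpq : p < q) (hq : q < n) {a : ℕ → ℝ}
    (ha : a ∈ S) (haa : a p = a q) :
    (∃ i, p < i ∧ i < q ∧ a i = a p + 1) ∧ ∃ i, p < i ∧ i < q ∧ a i = a p - 1 := by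
  induction hd : q - p using Nat.strong_induction_on generalizing p q a with
  | _ d ih =>
    subst hd
    by_cases hr : ∃ r, p < r ∧ r < q ∧ a r = a p
    · obtain ⟨r, hpr, hrq, har⟩ := hr
      obtain ⟨⟨i, hi⟩, j, hj⟩ := ih (r - p) (by omega) hpr (by omega) ha har.symm rfl
      exact ⟨⟨i, hi.1, hi.2.1.trans hrq, hi.2.2⟩, j, hj.1, hj.2.1.trans hrq, hj.2.2⟩
    push Not at hr
    obtain rfl | hpq1 := eq_or_lt_of_le (Nat.succ_le_of_lt hpq)
    · exact absurd haa (h.ne_succ a ha p hq)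
    have hleft : (a (p + 1) - a p) ^ 2 = 1 ∨
        (∃ i, p < i ∧ i < q ∧ a i = a p + 1) ∧ ∃ i, p < i ∧ i < q ∧ a i = a p - 1 := by
      refine or_iff_not_imp_left.2 fun hne => ?_
      have hb := h.swap a ha p (by omega) hne
      have hsw : ∀ i, p + 1 < i → Equiv.swap p (p + 1) i = i := fun i hi =>
        Equiv.swap_apply_of_ne_of_ne (by omega) (by omega)
      obtain ⟨⟨i, hi⟩, j, hj⟩ := ih (q - (p + 1)) (by omega) hpq1 hq hb
        (by simp [hsw q hpq1, haa]) rfl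
      simp only [Function.comp_apply, Equiv.swap_apply_right, hsw i hi.1] at hi
      simp only [Function.comp_apply, Equiv.swap_apply_right, hsw j hj.1] at hj
      exact ⟨⟨i, by omega, hi.2⟩, j, by omega, hj.2⟩
    obtain ⟨q, rfl⟩ : ∃ r, q = r + 1 := ⟨q - 1, by omega⟩
    have hright : (a (q + 1) - a q) ^ 2 = 1 ∨
        (∃ i, p < i ∧ i < q + 1 ∧ a i = a p + 1) ∧ ∃ i, p < i ∧ i < q + 1 ∧ a i = a p - 1 := by
      refine or_iff_not_imp_left.2 fun hne => ?_
      have hb := h.swap a ha q (by omega) hne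
      have hsw : ∀ i, i < q → Equiv.swap q (q + 1) i = i := fun i hi =>
        Equiv.swap_apply_of_ne_of_ne (by omega) (by omega)
      have hpq' : p < q := by omega
      obtain ⟨⟨i, hi⟩, j, hj⟩ := ih (q - p) (by omega) hpq' (by omega) hb
        (by simp [hsw p hpq', haa]) rfl
      simp only [Function.comp_apply, hsw p hpq', hsw i hi.2.1] at hi
      simp only [Function.comp_apply, hsw p hpq', hsw j hj.2.1] at hj
      exact ⟨⟨i, hi.1, by omega, hi.2.2⟩, j, hj.1, by omega, hj.2.2⟩
    rcases hleft with hl | hl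
    swap
    · exact hl
    rcases hright with hr' | hr'
    swap
    · exact hr'
    rw [← haa] at hr'
    have key : a (p + 1) ≠ a q := by
      intro heq
      obtain rfl | hlt := eq_or_lt_of_le (show p + 1 ≤ q by omega)
      · exact h.braid a ha p hq haa hl
      obtain ⟨⟨i, hi1, hi2, hi⟩, j, hj1, hj2, hj⟩ :=
        ih (q - (p + 1)) (by omega) hlt (by omega) ha heq rfl
      rcases sq_eq_one_iff.1 hl with h1 | h1
      · exact hr j (by omega) (by omega) (by linarith)
      · exact hr i (by omega) (by omega) (by linarith)
    rcases sq_eq_one_iff.1 hl with h1 | h1 <;>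
      rcases sq_eq_one_iff.1 hr' with h2 | h2
    · exact ⟨⟨p + 1, by omega, by omega, by linarith⟩, q, by omega, by omega, by linarith⟩
    · exact absurd (by linarith) key
    · exact absurd (by linarith) key
    · exact ⟨⟨q, by omega, by omega, by linarith⟩, p + 1, by omega, by omega, by linarith⟩

theorem exists_adjacent (h : IsSpectrumLike n S) {q : ℕ} (hq0 : 0 < q) (hq : q < n) {a : ℕ → ℝ}
    (ha : a ∈ S) : ∃ i < q, a i = a q + 1 ∨ a i = a q - 1 := by
  induction q generalizing a with
  | zero => omega
  | succ q ih =>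
    by_cases hne : (a (q + 1) - a q) ^ 2 = 1
    · refine ⟨q, by omega, ?_⟩
      rcases sq_eq_one_iff.1 hne with h1 | h1
      · right; linarith
      · left; linarith
    · have hb := h.swap a ha q hq hne
      have hsw : ∀ i, i < q → Equiv.swap q (q + 1) i = i := fun i hi =>
        Equiv.swap_apply_of_ne_of_ne (by omega) (by omega)
      rcases Nat.eq_zero_or_pos q with rfl | hq1
      · have h0 := h.zero a ha (by omega)
        have h1 := h.zero _ hb (by omega)
        have h2 := h.ne_succ a ha 0 hq
        simp at h1
        simp [h0, h1] at h2
      · obtain ⟨i, hi, hi'⟩ := ih hq1 (by omega) hb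
        simp only [Function.comp_apply, hsw i hi, Equiv.swap_apply_left] at hi'
        exact ⟨i, by omega, hi'⟩

theorem exists_int (h : IsSpectrumLike n S) {a : ℕ → ℝ} (ha : a ∈ S) (q : ℕ) (hq : q < n) :
    ∃ z : ℤ, a q = z := by
  induction q using Nat.strong_induction_on with
  | _ q ih =>
    rcases Nat.eq_zero_or_pos q with rfl | hq0
    · exact ⟨0, by simpa using h.zero a ha hq⟩
    · obtain ⟨i, hi, hi'⟩ := h.exists_adjacent hq0 hq ha
      obtain ⟨z, hz⟩ := ih i hi (by omega)
      rcases hi' with hi' | hi'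
      · exact ⟨z - 1, by push_cast; linarith⟩
      · exact ⟨z + 1, by push_cast; linarith⟩

end IsSpectrumLike

open Function in
/-- An integer sequence with the adjacency properties of content vectors is, up to any index `k`,
the content vector of a standard filling. -/
theorem exists_filling_of_adjacency {n : ℕ} {a : ℕ → ℤ} (h0 : 0 < n → a 0 = 0)
    (h1 : ∀ q, 0 < q → q < n → ∃ i < q, a i = a q + 1 ∨ a i = a q - 1)
    (h2 : ∀ p q, p < q → q < n → a p = a q →
      (∃ i, p < i ∧ i < q ∧ a i = a p + 1) ∧ ∃ i, p < i ∧ i < q ∧ a i = a p - 1)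
    (k : ℕ) (hk : k ≤ n) :
    ∃ T : ℕ → ℕ × ℕ, ∀ j < k, ((T j).2 : ℤ) - (T j).1 = a j ∧ (T j).1 + (T j).2 ≤ j ∧
      (∀ i < j, T i ≠ T j) ∧ ∀ r ≤ (T j).1, ∀ c ≤ (T j).2, ∃ i ≤ j, T i = (r, c) := by
  induction k with
  | zero => exact ⟨fun _ => 0, by simp⟩
  | succ k ih =>
    obtain ⟨T, hT⟩ := ih (by omega)
    -- it suffices to find an addable cell of content `a k`
    suffices hx : ∃ x : ℕ × ℕ, (x.2 : ℤ) - x.1 = a k ∧ x.1 + x.2 ≤ k ∧ (∀ i < k, T i ≠ x) ∧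
        ∀ r ≤ x.1, ∀ c ≤ x.2, (r, c) ≠ x → ∃ i < k, T i = (r, c) by
      obtain ⟨x, hx1, hx2, hx3, hx4⟩ := hx
      refine ⟨update T k x, fun j hj => ?_⟩
      have hlt : ∀ i < k, update T k x i = T i := fun i hi => update_of_ne (by omega) _ _
      obtain hj' | rfl := Nat.lt_succ_iff_lt_or_eq.1 hj
      · rw [hlt j hj']
        obtain ⟨t1, t2, t3, t4⟩ := hT j hj'
        refine ⟨t1, t2, fun i hi => ?_, fun r hr c hc => ?_⟩
        · rw [hlt i (by omega)]; exact t3 i hi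
        · obtain ⟨i, hi, hi'⟩ := t4 r hr c hc
          exact ⟨i, hi, by rw [hlt i (by omega)]; exact hi'⟩
      · simp only [update_self]
        refine ⟨hx1, hx2, fun i hi => ?_, fun r hr c hc => ?_⟩
        · rw [hlt i hi]; exact hx3 i hi
        · by_cases hrc : (r, c) = x
          · exact ⟨j, le_rfl, by simp [hrc]⟩
          · obtain ⟨i, hi, hi'⟩ := hx4 r hr c hc hrc
            exact ⟨i, hi.le, by rw [hlt i hi]; exact hi'⟩
    have hinj : ∀ i < k, ∀ j < k, T i = T j → i = j := by
      intro i hi j hj hij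
      rcases lt_trichotomy i j with h | h | h
      · exact absurd hij ((hT j hj).2.2.1 i h)
      · exact h
      · exact absurd hij.symm ((hT i hi).2.2.1 j h)
    have hmono : ∀ i < k, ∀ j < k, (T i).1 ≤ (T j).1 → (T i).2 ≤ (T j).2 → i ≤ j := by
      intro i hi j hj h h'
      obtain ⟨l, hl, hl'⟩ := (hT j hj).2.2.2 _ h _ h'
      rwa [← hinj l (by omega) i hi hl']
    by_cases hocc : ∃ p < k, a p = a k
    · obtain ⟨p, ⟨hpk, hp⟩, hmax⟩ : ∃ p, (p < k ∧ a p = a k) ∧ ∀ q, q < k ∧ a q = a k → q ≤ p := by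
        obtain ⟨p, hp⟩ := ((Finset.range k).filter fun p => a p = a k).exists_maximal
          (by obtain ⟨p, hp⟩ := hocc; exact ⟨p, by simpa using hp⟩)
        refine ⟨p, by simpa using hp.1, fun q hq => ?_⟩
        by_contra hlt
        exact hlt (hp.2 (by simpa using hq) (by omega))
      obtain ⟨⟨i, hpi, hik, hi⟩, j, hpj, hjk, hj⟩ := h2 p k hpk (by omega) hp
      obtain ⟨p1, p2, p3, p4⟩ := hT p hpk
      have hic := (hT i hik).1
      have hjc := (hT j hjk).1
      have hir : (T p).1 ≤ (T i).1 := by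
        by_contra hlt
        have := hmono i hik p hpk (by omega) (by omega)
        omega
      have hjr : (T p).2 ≤ (T j).2 := by
        by_contra hlt
        have := hmono j hjk p hpk (by omega) (by omega)
        omega
      have hij : i ≠ j := by rintro rfl; omega
      refine ⟨((T p).1 + 1, (T p).2 + 1), by push_cast; omega, by simp only; omega, ?_, ?_⟩
      · intro q hq hqx
        have hqc := (hT q hq).1
        have hqp := hmax q ⟨hq, by rw [← hqc, hqx]; push_cast; omega⟩
        have hpq := hmono p hpk q hq (by simp [hqx]) (by simp [hqx])
        obtain rfl : p = q := by omega
        have := congrArg Prod.fst hqx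
        simp at this
      · intro r hr c hc hne
        simp only [ne_eq, Prod.mk.injEq, not_and] at hne hr hc
        by_cases hr' : r ≤ (T p).1
        · obtain ⟨l, hl, hl'⟩ := (hT i hik).2.2.2 r (by omega) c (by omega)
          exact ⟨l, by omega, hl'⟩
        · obtain ⟨l, hl, hl'⟩ := (hT j hjk).2.2.2 r (by omega) c (by omega)
          exact ⟨l, by omega, hl'⟩
    · push Not at hocc
      rcases Nat.eq_zero_or_pos k with rfl | hk0
      · refine ⟨(0, 0), by simp [h0 (by omega)], by simp, by simp, ?_⟩
        intro r hr c hc hne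
        simp at hr hc
        simp [hr, hc] at hne
      have hk00 : a k ≠ 0 := fun h => hocc 0 hk0 (by rw [h0 (by omega), h])
      have hno : ∀ l < k, ∀ r c, T l = (r, c) → (c : ℤ) - r ≠ a k := by
        intro l hl r c hlrc hrc
        apply hocc l hl
        rw [← (hT l hl).1, hlrc, ← hrc]
      obtain ⟨i, hik, hi⟩ := h1 k hk0 (by omega)
      obtain ⟨ic, is, -, ist⟩ := hT i hik
      rcases lt_or_gt_of_ne hk00 with hneg | hpos
      · replace hi : a i = a k + 1 := by
          refine hi.resolve_right fun hi => ?_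
          obtain ⟨l, hl, hl'⟩ := ist ((T i).1 - 1) (by omega) (T i).2 le_rfl
          exact hno l (by omega) _ _ hl' (by omega)
        refine ⟨((-a k).toNat, 0), by simp only; omega, by simp only; omega, ?_, ?_⟩
        · exact fun l hl h => hno l hl _ _ h (by omega)
        · intro r hr c hc hne
          simp only [ne_eq, Prod.mk.injEq, not_and] at hne hr hc
          obtain ⟨l, hl, hl'⟩ := ist r (by omega) c (by omega)
          exact ⟨l, by omega, hl'⟩
      · replace hi : a i = a k - 1 := by
          refine hi.resolve_left fun hi => ?_
          obtain ⟨l, hl, hl'⟩ := ist (T i).1 le_rfl ((T i).2 - 1) (by omega)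
          exact hno l (by omega) _ _ hl' (by omega)
        refine ⟨(0, (a k).toNat), by simp only; omega, by simp only; omega, ?_, ?_⟩
        · exact fun l hl h => hno l hl _ _ h (by omega)
        · intro r hr c hc hne
          simp only [ne_eq, Prod.mk.injEq, not_and] at hne hr hc
          obtain ⟨l, hl, hl'⟩ := ist r (by omega) c (by omega)
          exact ⟨l, by omega, hl'⟩

namespace JucysMurphy

open Equiv Module Finset

theorem swap_braid {α : Type*} [DecidableEq α] {p q r : α} (hpq : p ≠ q) (hpr : p ≠ r)
    (hqr : q ≠ r) : swap p q * swap q r * swap p q = swap q r * swap p q * swap q r := by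
  rw [swap_mul_swap_mul_swap hpq hpr, swap_comm p q, swap_comm q r,
    swap_mul_swap_mul_swap hqr.symm hpr.symm, swap_comm]

variable {n : ℕ} {A : Type*} [Ring A] (U : Perm (Fin n) →* A)

/-- The image of the `i`-th Jucys–Murphy element under a homomorphism from the symmetric group. -/
def jmMap (i : Fin n) : A := ∑ j with j < i, U (swap j i)

theorem commute_jmMap {g : Perm (Fin n)} {i : Fin n} (hi : g i = i) (hg : ∀ j, g j < i ↔ j < i) :
    Commute (U g) (jmMap U i) := by
  rw [Commute, SemiconjBy, jmMap, mul_sum, sum_mul]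
  refine sum_bij (fun j _ => g j) (fun j hj => by simpa [hg] using hj)
    (fun _ _ _ _ h => g.injective h) (fun j hj => ⟨g⁻¹ j, ?_, by simp⟩) (fun j _ => ?_)
  · have := hg (g⁻¹ j)
    simp_all
  · rw [← map_mul, ← map_mul, mul_swap_eq_swap_mul, hi]

theorem commute_swap_jmMap {i j k : Fin n} (h : j < i ∧ k < i ∨ i < j ∧ i < k) :
    Commute (U (swap j k)) (jmMap U i) := by
  refine commute_jmMap U (swap_apply_of_ne_of_ne (by grind) (by grind)) fun l => ?_
  rcases eq_or_ne l j with rfl | hj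
  · rw [swap_apply_left]; grind
  rcases eq_or_ne l k with rfl | hk
  · rw [swap_apply_right]; grind
  · rw [swap_apply_of_ne_of_ne hj hk]

theorem commute_jmMap_jmMap (i j : Fin n) : Commute (jmMap U i) (jmMap U j) := by
  wlog h : i < j generalizing i j
  · rcases eq_or_lt_of_le (not_lt.1 h) with rfl | h
    · exact Commute.refl _
    · exact (this j i h).symm
  refine Commute.sum_left _ _ _ fun k hk => commute_swap_jmMap U (.inl ⟨?_, h⟩)
  simp only [mem_filter, mem_univ, true_and] at hk
  exact hk.trans h

theorem jmMap_succ_mul_swap {i : ℕ} (hi : i + 1 < n) :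
    jmMap U ⟨i + 1, hi⟩ * U (swap ⟨i, by omega⟩ ⟨i + 1, hi⟩) =
      U (swap ⟨i, by omega⟩ ⟨i + 1, hi⟩) * jmMap U ⟨i, by omega⟩ + 1 := by
  have hset : (univ.filter fun j : Fin n => j < ⟨i + 1, hi⟩) =
      insert ⟨i, by omega⟩ (univ.filter fun j : Fin n => j < ⟨i, by omega⟩) := by
    ext j; simp [Fin.lt_def, Fin.ext_iff]; omega
  rw [jmMap, hset, sum_insert (by simp), add_mul, ← map_mul, swap_mul_self, map_one, add_comm,
    jmMap, mul_sum, sum_mul]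
  congr 1
  refine sum_congr rfl fun j hj => ?_
  simp only [mem_filter, mem_univ, true_and, Fin.lt_def] at hj
  rw [← map_mul, ← map_mul, mul_swap_eq_swap_mul _ j ⟨i, _⟩, swap_apply_left,
    swap_apply_of_ne_of_ne (by simp [Fin.ext_iff]; omega) (by simp [Fin.ext_iff]; omega)]

theorem swap_mul_jmMap_succ {i : ℕ} (hi : i + 1 < n) :
    U (swap ⟨i, by omega⟩ ⟨i + 1, hi⟩) * jmMap U ⟨i + 1, hi⟩ =
      jmMap U ⟨i, by omega⟩ * U (swap ⟨i, by omega⟩ ⟨i + 1, hi⟩) + 1 := by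
  set s := U (swap ⟨i, by omega⟩ ⟨i + 1, hi⟩) with hs
  have hss : s * s = 1 := by rw [hs, ← map_mul, swap_mul_self, map_one]
  calc s * jmMap U ⟨i + 1, hi⟩ = s * (jmMap U ⟨i + 1, hi⟩ * s) * s := by
        rw [mul_assoc, mul_assoc, hss, mul_one]
    _ = s * s * jmMap U ⟨i, by omega⟩ * s + s * s := by
        rw [jmMap_succ_mul_swap, mul_add, add_mul, mul_one, ← hs, mul_assoc s s]
    _ = _ := by rw [hss, one_mul]

variable {E : Type*} [NormedAddCommGroup E] [InnerProductSpace ℝ E]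
  {V : Perm (Fin n) →* End ℝ E}

theorem inner_swap_left (hV : ∀ g v w, inner ℝ (V g v) (V g w) = inner ℝ v w)
    (i j : Fin n) (v w : E) :
    inner ℝ (V (swap i j) v) w = inner ℝ v (V (swap i j) w) := by
  rw [← hV (swap i j) v, ← End.mul_apply, ← map_mul, swap_mul_self, map_one, End.one_apply]

theorem isSymmetric_jmMap (hV : ∀ g v w, inner ℝ (V g v) (V g w) = inner ℝ v w) (i : Fin n) :
    LinearMap.IsSymmetric (jmMap V i) := by
  intro v w
  simp only [jmMap, LinearMap.sum_apply, sum_inner, inner_sum, inner_swap_left hV]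

variable (V) in
/-- The joint spectrum of the Jucys–Murphy operators; only the values at indices below `n` of its
members matter. -/
def jointSpectrum : Set (ℕ → ℝ) :=
  {a | ∃ v : E, v ≠ 0 ∧ ∀ i : Fin n, jmMap V i v = a i • v}

section Adjacent

variable {a : ℕ → ℝ} {v : E} {i : ℕ} (hi : i + 1 < n)

theorem jmMap_swap_apply (hv : ∀ i : Fin n, jmMap V i v = a i • v) :
    jmMap V ⟨i, by omega⟩ (V (swap ⟨i, by omega⟩ ⟨i + 1, hi⟩) v) =
      a (i + 1) • V (swap ⟨i, by omega⟩ ⟨i + 1, hi⟩) v - v := by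
  have h := LinearMap.congr_fun (swap_mul_jmMap_succ V hi) v
  rw [End.mul_apply, hv, map_smul, LinearMap.add_apply, End.mul_apply, End.one_apply] at h
  exact eq_sub_of_add_eq h.symm

theorem jmMap_succ_swap_apply (hv : ∀ i : Fin n, jmMap V i v = a i • v) :
    jmMap V ⟨i + 1, hi⟩ (V (swap ⟨i, by omega⟩ ⟨i + 1, hi⟩) v) =
      a i • V (swap ⟨i, by omega⟩ ⟨i + 1, hi⟩) v + v := by
  have h := LinearMap.congr_fun (jmMap_succ_mul_swap V hi) v
  rwa [End.mul_apply, LinearMap.add_apply, End.mul_apply, hv, map_smul, End.one_apply] at h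

theorem mul_inner_swap (hV : ∀ g v w, inner ℝ (V g v) (V g w) = inner ℝ v w)
    (hv : ∀ i : Fin n, jmMap V i v = a i • v) :
    (a (i + 1) - a i) * inner ℝ (V (swap ⟨i, by omega⟩ ⟨i + 1, hi⟩) v) v = inner ℝ v v := by
  have h := isSymmetric_jmMap hV ⟨i, by omega⟩ (V (swap ⟨i, by omega⟩ ⟨i + 1, hi⟩) v) v
  rw [jmMap_swap_apply hi hv, hv, inner_sub_left, real_inner_smul_left, real_inner_smul_right] at h
  simp only at h
  linarith

theorem smul_swap_eq (hV : ∀ g v w, inner ℝ (V g v) (V g w) = inner ℝ v w)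
    (hv : ∀ i : Fin n, jmMap V i v = a i • v) (hd : (a (i + 1) - a i) ^ 2 = 1) :
    V (swap ⟨i, by omega⟩ ⟨i + 1, hi⟩) v = (a (i + 1) - a i) • v := by
  have h := mul_inner_swap hi hV hv
  rw [← sub_eq_zero, ← inner_self_eq_zero (𝕜 := ℝ)]
  simp only [inner_sub_left, inner_sub_right, real_inner_smul_left, real_inner_smul_right, hV]
  rw [real_inner_comm (V (swap ⟨i, by omega⟩ ⟨i + 1, hi⟩) v) v]
  linear_combination inner ℝ v v * hd - 2 * h

theorem swap_mem_jointSpectrum (hi : i + 1 < n)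
    (hV : ∀ g v w, inner ℝ (V g v) (V g w) = inner ℝ v w) (hv0 : v ≠ 0)
    (hv : ∀ i : Fin n, jmMap V i v = a i • v) (hd : (a (i + 1) - a i) ^ 2 ≠ 1) :
    a ∘ swap i (i + 1) ∈ jointSpectrum V := by
  refine ⟨(a (i + 1) - a i) • V (swap ⟨i, by omega⟩ ⟨i + 1, hi⟩) v - v, fun h => hd ?_, ?_⟩
  · have h' := sub_eq_zero.1 h
    have hvv : inner ℝ v v ≠ (0 : ℝ) := inner_self_ne_zero.2 hv0
    apply mul_right_cancel₀ hvv
    conv_rhs => rw [← h']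
    rw [real_inner_smul_left, real_inner_smul_right, hV]
    ring
  · rintro ⟨j, hj⟩
    rw [map_sub, map_smul, hv]
    rcases eq_or_ne j i with rfl | hji
    · rw [jmMap_swap_apply hi hv]
      simp only [Function.comp_apply, swap_apply_left]
      module
    rcases eq_or_ne j (i + 1) with rfl | hji'
    · rw [jmMap_succ_swap_apply hi hv]
      simp only [Function.comp_apply, swap_apply_right]
      module
    · have hc := LinearMap.congr_fun (commute_swap_jmMap V (i := ⟨j, hj⟩) (j := ⟨i, by omega⟩)
        (k := ⟨i + 1, hi⟩) (by simp only [Fin.lt_def]; omega)).eq v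
      rw [End.mul_apply, End.mul_apply, hv, map_smul] at hc
      rw [← hc]
      simp only [Function.comp_apply, swap_apply_of_ne_of_ne hji hji']
      module

end Adjacent

theorem isSpectrumLike_jointSpectrum (hV : ∀ g v w, inner ℝ (V g v) (V g w) = inner ℝ v w) :
    IsSpectrumLike n (jointSpectrum V) where
  zero := by
    rintro a ⟨v, hv0, hv⟩ hn
    have h := hv ⟨0, hn⟩
    simp only [jmMap, Fin.lt_def, not_lt_zero, filter_false, sum_empty, LinearMap.zero_apply] at h
    exact (smul_eq_zero.1 h.symm).resolve_right hv0
  ne_succ := by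
    rintro a ⟨v, hv0, hv⟩ i hi h
    have h' := mul_inner_swap hi hV hv
    rw [h, sub_self, zero_mul] at h'
    exact hv0 (inner_self_eq_zero.1 h'.symm)
  swap := by
    rintro a ⟨v, hv0, hv⟩ i hi hd
    exact swap_mem_jointSpectrum hi hV hv0 hv hd
  braid := by
    rintro a ⟨v, hv0, hv⟩ i hi haa hd
    have h1 := smul_swap_eq (i := i) (by omega) hV hv hd
    have h2 := smul_swap_eq (i := i + 1) hi hV hv (by
      rw [← hd, show i + 1 + 1 = i + 2 from rfl, ← haa]
      ring)
    have hb := swap_braid (p := (⟨i, by omega⟩ : Fin n)) (q := ⟨i + 1, by omega⟩) (r := ⟨i + 2, hi⟩)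
      (by simp) (by simp) (by simp)
    have h3 := LinearMap.congr_fun (congrArg V hb) v
    simp only [map_mul, End.mul_apply, h1, h2, map_smul, smul_smul] at h3
    rw [show i + 1 + 1 = i + 2 from rfl, ← haa, ← sub_eq_zero, ← sub_smul] at h3
    have h4 := (smul_eq_zero.1 h3).resolve_right hv0
    have h5 : a (i + 1) - a i = 0 := by
      linear_combination (-1 / 2 : ℝ) * h4 - (a (i + 1) - a i) * hd
    simp [h5] at hd

theorem exists_stdTab_of_eigenvector (hV : ∀ g v w, inner ℝ (V g v) (V g w) = inner ℝ v w)
    {a : Fin n → ℝ} {v : E}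
    (hv0 : v ≠ 0) (hv : ∀ i, jmMap V i v = a i • v) :
    ∃ t : StdTab n, ∀ i, a i = stdContent t i := by
  have hS := isSpectrumLike_jointSpectrum hV
  let b : ℕ → ℝ := fun i => if h : i < n then a ⟨i, h⟩ else 0
  have hb : b ∈ jointSpectrum V := ⟨v, hv0, fun i => by simp [b, hv]⟩
  choose! z hz using hS.exists_int hb
  obtain ⟨T, hT⟩ := exists_filling_of_adjacency (n := n) (a := z)
    (fun h => by have := hS.zero b hb h; rw [hz 0 h] at this; exact_mod_cast this)
    (fun q h0 hq => by
      obtain ⟨i, hi, h⟩ := hS.exists_adjacent h0 hq hb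
      rw [hz i (by omega), hz q hq] at h
      exact ⟨i, hi, by exact_mod_cast h⟩)
    (fun p q hpq hq h => by
      obtain ⟨⟨i, hi⟩, j, hj⟩ := hS.exists_between hpq hq hb (by rw [hz p (by omega), hz q hq, h])
      rw [hz i (by omega), hz p (by omega)] at hi
      rw [hz j (by omega), hz p (by omega)] at hj
      exact ⟨⟨i, by exact_mod_cast hi⟩, j, by exact_mod_cast hj⟩) n le_rfl
  refine ⟨⟨fun j => (⟨(T j).1, ?_⟩, ⟨(T j).2, ?_⟩), ?_, ?_⟩, fun i => ?_⟩
  · have := (hT j j.2).2.1; omega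
  · have := (hT j j.2).2.1; omega
  · intro i j hij
    simp only [Prod.mk.injEq, Fin.mk.injEq, ← Prod.ext_iff] at hij
    rcases lt_trichotomy i j with h | h | h
    · exact absurd hij ((hT j j.2).2.2.1 i h)
    · exact h
    · exact absurd hij.symm ((hT i i.2).2.2.1 j h)
  · rintro j ⟨r, c⟩ hr hc
    obtain ⟨i, hi, h⟩ := (hT j j.2).2.2.2 r hr c hc
    exact ⟨⟨i, by omega⟩, hi, by simp [h]⟩
  · have := hz i i.2
    simp only [b, i.2, dite_true] at this
    rw [this, stdContent, ← (hT i i.2).1]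

end JucysMurphy

theorem StdTab.eq_of_stdContent_eq {n : ℕ} {s t : StdTab n}
    (h : ∀ i, stdContent s i = stdContent t i) : s = t := by
  refine StdTab.ext' (funext fun j => ?_)
  induction hj : (j : ℕ) using Nat.strong_induction_on generalizing j with
  | _ m ih =>
    subst hj
    wlog hle : (s.cell j).1 ≤ (t.cell j).1 generalizing s t
    · exact (this (fun i => (h i).symm) (fun m hm i hi => (ih m hm i hi).symm)
        (le_of_not_ge hle)).symm
    have hc := h j
    simp only [stdContent] at hc
    obtain ⟨i, hij, hi⟩ := t.std.2 j (s.cell j) hle (by simp only [Fin.le_def] at hle ⊢; omega)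
    rcases eq_or_lt_of_le hij with rfl | hlt
    · exact hi.symm
    · rw [← ih i hlt i rfl] at hi
      exact absurd (s.std.1 hi) hlt.ne

theorem stdContent_mem_ContSetAll {n : ℕ} (t : StdTab n) (i : Fin n) :
    stdContent t i ∈ ContSetAll n :=
  Finset.mem_image.2 ⟨(t.cell, i), by simpa using t.std, rfl⟩

section Eigenvector

variable {R M : Type*} [Ring R] [AddCommGroup M] [Module ℝ M] (ρ : R →+* Module.End ℝ M)

theorem map_list_prod_apply_eigenvector {ι : Type*} (l : List ι) (f : ι → R) (r : ι → ℝ) {v : M}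
    (h : ∀ i ∈ l, ρ (f i) v = r i • v) : ρ (l.map f).prod v = (l.map r).prod • v := by
  induction l with
  | nil => simp
  | cons i l ih =>
    rw [List.map_cons, List.prod_cons, map_mul, Module.End.mul_apply,
      ih fun j hj => h j (List.mem_cons_of_mem _ hj), map_smul, h i List.mem_cons_self, smul_smul,
      List.map_cons, List.prod_cons, mul_comm]

end Eigenvector

open Classical in
theorem map_EeltS_apply_eigenvector {n : ℕ} {M : Type*} [AddCommGroup M] [Module ℝ M]
    (ρ : SymGrpAlg ℚ n →+* Module.End ℝ M) (s t : StdTab n) {v : M}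
    (hv : ∀ i, ρ (JMelt ℚ n i) v = (stdContent s i : ℝ) • v) :
    ρ (EeltS n t) v = (if s = t then 1 else 0 : ℝ) • v := by
  have hfac (d : ℤ) (i : Fin n) :
      ρ ((((stdContent t i - d : ℤ) : ℚ))⁻¹ • (JMelt ℚ n i - (d : SymGrpAlg ℚ n))) v =
        ((((stdContent t i - d : ℤ) : ℝ))⁻¹ * (stdContent s i - d : ℤ)) • v := by
    have h := map_ratCast_smul ρ ℚ ℝ ((stdContent t i - d : ℤ) : ℚ)⁻¹
      (JMelt ℚ n i - (d : SymGrpAlg ℚ n))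
    simp only [Rat.cast_inv, Rat.cast_intCast] at h
    rw [h, LinearMap.smul_apply, map_sub, map_intCast, LinearMap.sub_apply, hv, mul_smul,
      Int.cast_sub (stdContent s i), sub_smul, Int.cast_smul_eq_zsmul ℝ d v]
    simp
  rw [EeltS, map_list_prod_apply_eigenvector ρ _ _ _ fun d _ =>
    map_list_prod_apply_eigenvector ρ _ _ _ fun i _ => hfac d i]
  congr 1
  split_ifs with hst
  · subst hst
    refine List.prod_eq_one fun x hx => ?_
    obtain ⟨d, -, rfl⟩ := List.mem_map.1 hx
    refine List.prod_eq_one fun y hy => ?_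
    obtain ⟨i, hi, rfl⟩ := List.mem_map.1 hy
    have hi : stdContent s i ≠ d := by simpa using hi
    exact inv_mul_cancel₀ (by exact_mod_cast sub_ne_zero.2 hi)
  · obtain ⟨i, hi⟩ : ∃ i, stdContent s i ≠ stdContent t i := by
      by_contra! h
      exact hst (StdTab.eq_of_stdContent_eq h)
    refine List.prod_eq_zero (List.mem_map.2 ⟨stdContent s i, ?_, List.prod_eq_zero
      (List.mem_map.2 ⟨i, ?_, ?_⟩)⟩)
    · simpa using stdContent_mem_ContSetAll s i
    · simpa using hi.symm
    · simp

section Regular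

variable (G : Type*) [Group G] [Fintype G]

/-- The left regular representation of a finite group on a real Euclidean space. -/
noncomputable def euclideanRegular : G →* Module.End ℝ (EuclideanSpace ℝ G) where
  toFun g := (LinearIsometryEquiv.piLpCongrLeft 2 ℝ ℝ (Equiv.mulLeft g)).toLinearEquiv.toLinearMap
  map_one' := by
    ext v h
    simp [LinearIsometryEquiv.piLpCongrLeft_apply]
    rfl
  map_mul' g g' := by
    ext v h
    simp [LinearIsometryEquiv.piLpCongrLeft_apply]
    rfl

variable {G}

theorem euclideanRegular_apply (g : G) (v : EuclideanSpace ℝ G) (h : G) :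
    euclideanRegular G g v h = v (g⁻¹ * h) := by
  simp [euclideanRegular, LinearIsometryEquiv.piLpCongrLeft_apply]

theorem inner_euclideanRegular (g : G) (v w : EuclideanSpace ℝ G) :
    inner ℝ (euclideanRegular G g v) (euclideanRegular G g w) = inner ℝ v w :=
  LinearIsometryEquiv.inner_map_map _ v w

theorem lift_euclideanRegular_injective :
    Function.Injective (MonoidAlgebra.lift ℚ (Module.End ℝ (EuclideanSpace ℝ G)) G
      (euclideanRegular G)) := by
  classical
  rw [injective_iff_map_eq_zero]
  intro x hx
  ext h
  have h1 := congrArg (fun v => v h) (LinearMap.congr_fun hx (EuclideanSpace.single 1 1))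
  simp only [MonoidAlgebra.lift_apply, Finsupp.sum_fintype, zero_smul, implies_true,
    LinearMap.sum_apply, LinearMap.smul_apply, LinearMap.zero_apply] at h1
  simpa [euclideanRegular_apply, inv_mul_eq_one, Pi.single_apply, Rat.smul_def] using h1

end Regular

/-- In `ℚ𝔖_n` the seminormal idempotents `E_t`, for `t` ranging over
the standard Young tableaux of all partitions of `n`, form a complete set of pairwise
orthogonal idempotents diagonalizing the Jucys–Murphy elements: `Σ_t E_t = 1`,
`E_s E_t = δ_{s,t} E_s`, and `L_i E_t = E_t L_i = c_t(i) E_t`. -/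
theorem EeltS_complete_orthogonal_eigen (n : ℕ) :
    (∑ t : StdTab n, EeltS n t = 1) ∧
    (∀ s t : StdTab n,
      (s = t → EeltS n s * EeltS n t = EeltS n s) ∧
      (s ≠ t → EeltS n s * EeltS n t = 0)) ∧
    (∀ (t : StdTab n) (i : Fin n),
      JMelt ℚ n i * EeltS n t = ((stdContent t i : ℤ) : ℚ) • EeltS n t ∧
      EeltS n t * JMelt ℚ n i = ((stdContent t i : ℤ) : ℚ) • EeltS n t) := by
  classical
  let V := euclideanRegular (Equiv.Perm (Fin n))
  let ρ := MonoidAlgebra.lift ℚ (Module.End ℝ (EuclideanSpace ℝ (Equiv.Perm (Fin n)))) _ V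
  have hV : ∀ g v w, inner ℝ (V g v) (V g w) = inner ℝ v w := inner_euclideanRegular
  have hJ (i : Fin n) : ρ (JMelt ℚ n i) = JucysMurphy.jmMap V i := by
    simp [JMelt, JucysMurphy.jmMap, ρ]
  have hext (x y : SymGrpAlg ℚ n) (h : ∀ (s : StdTab n) v,
      (∀ i, ρ (JMelt ℚ n i) v = (stdContent s i : ℝ) • v) → ρ x v = ρ y v) : x = y := by
    apply lift_euclideanRegular_injective
    change ρ x = ρ y
    rw [← LinearMap.eqLocus_eq_top, eq_top_iff,
      ← LinearMap.IsSymmetric.iSup_iInf_eq_top_of_commute (JucysMurphy.isSymmetric_jmMap hV)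
        fun i j _ => JucysMurphy.commute_jmMap_jmMap V i j]
    refine iSup_le fun a v hv => ?_
    simp only [Submodule.mem_iInf, Module.End.mem_eigenspace_iff] at hv
    rcases eq_or_ne v 0 with rfl | hv0
    · exact zero_mem _
    obtain ⟨s, hs⟩ := JucysMurphy.exists_stdTab_of_eigenvector hV hv0 hv
    exact h s v fun i => by rw [hJ, hv, hs]
  have hE (s t : StdTab n) (v) (hv : ∀ i, ρ (JMelt ℚ n i) v = (stdContent s i : ℝ) • v) :
      ρ (EeltS n t) v = (if s = t then 1 else 0 : ℝ) • v :=
    map_EeltS_apply_eigenvector ρ.toRingHom s t hv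
  refine ⟨hext _ _ fun s v hv => ?_, fun s t => ⟨?_, fun hst => hext _ _ fun r v hv => ?_⟩,
    fun t i => ⟨hext _ _ fun s v hv => ?_, hext _ _ fun s v hv => ?_⟩⟩
  · rw [map_sum, LinearMap.sum_apply, Finset.sum_congr rfl fun t _ => hE s t v hv]
    simp
  · rintro rfl
    refine hext _ _ fun r v hv => ?_
    rw [map_mul, Module.End.mul_apply, hE r s v hv, map_smul, hE r s v hv]
    split_ifs <;> simp
  · rw [map_mul, Module.End.mul_apply, hE r t v hv, map_smul, hE r s v hv]
    rw [map_zero, LinearMap.zero_apply, smul_smul]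
    split_ifs with h1 h2
    · exact absurd (h1.symm.trans h2) hst.symm
    all_goals simp only [mul_zero, zero_mul, zero_smul]
  · rw [map_mul, Module.End.mul_apply, hE s t v hv, map_smul, hv, map_smul, LinearMap.smul_apply,
      hE s t v hv, ← Rat.cast_smul_eq_qsmul ℝ, Rat.cast_intCast]
    split_ifs with h1
    · rw [h1, one_smul, one_smul]
    · rw [zero_smul, zero_smul, smul_zero]
  · rw [map_mul, Module.End.mul_apply, hv, map_smul, map_smul, LinearMap.smul_apply,
      hE s t v hv, ← Rat.cast_smul_eq_qsmul ℝ, Rat.cast_intCast]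
    split_ifs with h1
    · rw [h1]
    · rw [zero_smul, smul_zero, smul_zero]
end
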